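/- (Bombieri–Vinogradov theorem) For every θ with 0 < θ < 1/2 and every A > 0, there exists a constant C_A such that for all x ≥ 2, Σ_{q ≤ x^θ} sup_{a : gcd(a,q)=1} |Σ_{n ≤ x, n ≡ a (mod q)} Λ(n) − x/φ(q)| ≤ C_A · x · (log x)^{−A}; that is, the primes have level of distribution θ for every θ < 1/2. -/

import Mathlib

open Filter
open scoped ArithmeticFunction

namespace BombieriVinogradov

section Kernel

open MeasureTheory Complex FourierTransform

/-- `u ↦ max u 0 * exp (-σ u)`, whose Fourier transform is `w ↦ 1 / (σ + 2 π i w) ^ 2`. -/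
noncomputable def rampExp (σ u : ℝ) : ℂ := ((max u 0 * Real.exp (-(σ * u)) : ℝ) : ℂ)

lemma rampExp_eq_indicator (σ : ℝ) :
    rampExp σ = Set.indicator (Set.Ioi 0) (fun u : ℝ => (u : ℂ) * cexp (-(σ * u))) := by
  funext u
  by_cases hu : 0 < u
  · simp [rampExp, hu, max_eq_left hu.le]
  · simp [rampExp, hu, max_eq_right (not_lt.mp hu)]

lemma integrable_rampExp {σ : ℝ} (hσ : 0 < σ) : Integrable (rampExp σ) := by
  rw [rampExp_eq_indicator, integrable_indicator_iff measurableSet_Ioi]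
  have h := integrableOn_rpow_mul_exp_neg_mul_rpow (s := 1) (p := 1) (b := σ)
    (by norm_num) one_pos hσ
  have h2 := h.ofReal (𝕜 := ℂ)
  refine h2.congr (Eventually.of_forall fun u => ?_)
  simp

lemma integral_mul_exp_neg_mul_Ioi {z : ℂ} (hz : 0 < z.re) :
    ∫ u in Set.Ioi (0 : ℝ), (u : ℂ) * cexp (-(z * u)) = 1 / z ^ 2 := by
  have hz0 : z ≠ 0 := fun h => by simp [h] at hz
  have hder : ∀ u : ℝ, HasDerivAt (fun u : ℝ => -((u : ℂ) / z + 1 / z ^ 2) * cexp (-(z * u)))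
      ((u : ℂ) * cexp (-(z * u))) u := fun u => by
    have h1 : HasDerivAt (fun u : ℂ => -(u / z + 1 / z ^ 2) * cexp (-(z * u)))
        (-(1 / z) * cexp (-(z * u)) + -((u : ℂ) / z + 1 / z ^ 2) *
          (cexp (-(z * u)) * -(z * 1))) (u : ℂ) :=
      (((hasDerivAt_id _).div_const z).add_const _).neg.mul
        (((hasDerivAt_id _).const_mul z).neg.cexp)
    convert h1.comp_ofReal using 1
    field_simp
    ring
  have hintg : IntegrableOn (fun u : ℝ => (u : ℂ) * cexp (-(z * u))) (Set.Ioi 0) := by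
    have h := integrable_rampExp hz
    rw [rampExp_eq_indicator, integrable_indicator_iff measurableSet_Ioi] at h
    refine Integrable.mono h (Continuous.aestronglyMeasurable (by fun_prop))
      (Eventually.of_forall fun u => ?_)
    simp [Complex.norm_exp]
  have hlim : Tendsto (fun u : ℝ => -((u : ℂ) / z + 1 / z ^ 2) * cexp (-(z * u))) atTop
      (nhds 0) := by
    rw [tendsto_zero_iff_norm_tendsto_zero]
    have h1 : Tendsto (fun u : ℝ => u ^ 1 * Real.exp (-z.re * u)) atTop (nhds 0) := by
      have := Real.tendsto_pow_mul_exp_neg_atTop_nhds_zero 1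
      have h2 := (this.comp (tendsto_id.const_mul_atTop hz)).const_mul (1 / z.re)
      rw [mul_zero] at h2
      refine h2.congr fun u => ?_
      simp
      field_simp
    have h0 : Tendsto (fun u : ℝ => Real.exp (-z.re * u)) atTop (nhds 0) := by
      have := Real.tendsto_exp_neg_atTop_nhds_zero.comp (tendsto_id.const_mul_atTop hz)
      refine this.congr fun u => ?_
      simp
    have h3 := (h1.const_mul (1 / ‖z‖)).add (h0.const_mul (1 / ‖z‖ ^ 2))
    simp only [mul_zero, add_zero] at h3
    refine tendsto_of_tendsto_of_tendsto_of_le_of_le' tendsto_const_nhds h3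
      (Eventually.of_forall fun u => norm_nonneg _) ?_
    filter_upwards [eventually_ge_atTop 0] with u hu
    rw [norm_mul, norm_neg, Complex.norm_exp]
    have : ‖(u : ℂ) / z + 1 / z ^ 2‖ ≤ u / ‖z‖ + 1 / ‖z‖ ^ 2 := by
      refine (norm_add_le _ _).trans (le_of_eq ?_)
      simp [abs_of_nonneg hu]
    calc _ ≤ (u / ‖z‖ + 1 / ‖z‖ ^ 2) * Real.exp (-z.re * u) := by
          gcongr
          simp
      _ = _ := by ring
  rw [integral_Ioi_of_hasDerivAt_of_tendsto' (fun u _ => hder u) hintg hlim]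
  simp

lemma fourier_rampExp {σ : ℝ} (hσ : 0 < σ) (w : ℝ) :
    𝓕 (rampExp σ) w = 1 / ((σ : ℂ) + 2 * Real.pi * w * I) ^ 2 := by
  rw [Real.fourier_eq', rampExp_eq_indicator]
  have h := integral_mul_exp_neg_mul_Ioi (z := (σ : ℂ) + 2 * Real.pi * w * I) (by simpa using hσ)
  rw [← h, ← integral_indicator measurableSet_Ioi]
  congr 1
  funext u
  by_cases hu : u ∈ Set.Ioi (0 : ℝ)
  · simp only [Set.indicator_of_mem hu, smul_eq_mul]
    rw [mul_left_comm, ← Complex.exp_add]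
    congr 2
    simp
    ring
  · simp [Set.indicator_of_notMem hu]

lemma integrable_one_div_sq_vertical {σ : ℝ} (hσ : 0 < σ) :
    Integrable (fun t : ℝ => 1 / ((σ : ℂ) + t * I) ^ 2) := by
  have h := (integrable_inv_one_add_sq).const_mul (max 1 (1 / σ ^ 2))
  have hne : ∀ t : ℝ, (σ : ℂ) + t * I ≠ 0 := fun t ht => by
    have := congrArg Complex.re ht
    simp at this
    exact hσ.ne' this
  refine h.mono' ?_ (Eventually.of_forall fun t => ?_)
  · exact Continuous.aestronglyMeasurable
      (continuous_const.div (by fun_prop) (fun t => pow_ne_zero 2 (hne t)))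
  · have : ‖(σ : ℂ) + t * I‖ ^ 2 = σ ^ 2 + t ^ 2 := by
      rw [← Complex.normSq_eq_norm_sq, Complex.normSq_add_mul_I]
    rw [norm_div, norm_one, norm_pow, this, ← div_eq_mul_inv, div_le_div_iff₀ (by positivity)
      (by positivity), one_mul]
    have h1 : σ ^ 2 ≤ max 1 (1 / σ ^ 2) * σ ^ 2 := le_mul_of_one_le_left (by positivity)
      (le_max_left _ _)
    have h2 : 1 ≤ max 1 (1 / σ ^ 2) * σ ^ 2 := by
      calc (1 : ℝ) = 1 / σ ^ 2 * σ ^ 2 := by field_simp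
        _ ≤ _ := by gcongr; exact le_max_right _ _
    have h3 : t ^ 2 ≤ max 1 (1 / σ ^ 2) * t ^ 2 := le_mul_of_one_le_left (by positivity)
      (le_max_left _ _)
    linarith

/-- The smoothed Perron formula. -/
theorem integral_exp_div_sq {σ : ℝ} (hσ : 0 < σ) (u : ℝ) :
    ∫ t : ℝ, cexp (u * ((σ : ℂ) + t * I)) / ((σ : ℂ) + t * I) ^ 2 =
      2 * Real.pi * ((max u 0 : ℝ) : ℂ) := by
  have hF : 𝓕 (rampExp σ) = fun w : ℝ => 1 / ((σ : ℂ) + 2 * Real.pi * w * I) ^ 2 :=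
    funext (fourier_rampExp hσ)
  have hintg : Integrable (𝓕 (rampExp σ)) := by
    rw [hF]
    have := (integrable_one_div_sq_vertical hσ).comp_mul_left' (R := 2 * Real.pi)
      (by positivity)
    refine this.congr (Eventually.of_forall fun w => ?_)
    simp
  have hcont : Continuous (rampExp σ) := by unfold rampExp; fun_prop
  have hinv := congrFun (hcont.fourierInv_fourier_eq (integrable_rampExp hσ) hintg) u
  rw [Real.fourierInv_eq', hF] at hinv
  have hsub := Measure.integral_comp_mul_left
    (fun t : ℝ => cexp (u * ((σ : ℂ) + t * I)) / ((σ : ℂ) + t * I) ^ 2) (2 * Real.pi)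
  have hpi : (0 : ℝ) < 2 * Real.pi := by positivity
  rw [abs_of_pos (by positivity)] at hsub
  have key : ∫ t : ℝ, cexp (u * ((σ : ℂ) + t * I)) / ((σ : ℂ) + t * I) ^ 2 =
      (2 * Real.pi : ℝ) • (cexp (u * σ) * rampExp σ u) := by
    rw [← hinv, ← integral_const_mul, ← inv_smul_eq_iff₀ hpi.ne', ← hsub]
    congr 1
    funext w
    simp only [smul_eq_mul]
    rw [← mul_assoc, ← Complex.exp_add, mul_one_div]
    congr 2
    · simp
      ring
    · push_cast
      ring
  rw [key, rampExp]
  push_cast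
  rw [mul_left_comm, ← Complex.exp_add]
  rw [show (u : ℂ) * σ + -(σ * u) = 0 by ring]
  simp

/-- Repeated integration by parts for an oscillating integral over the line. -/
theorem norm_integral_mul_exp_le {g : ℝ → ℂ} {k : ℕ} (hg : ContDiff ℝ k g)
    (hintg : ∀ j : ℕ, j ≤ k → Integrable (iteratedDeriv j g)) (u : ℝ) :
    |u| ^ k * ‖∫ t : ℝ, g t * cexp (u * t * I)‖ ≤ ∫ t : ℝ, ‖iteratedDeriv k g t‖ := by
  have h := congrFun (Real.fourier_iteratedDeriv (N := k) (n := k) (f := g) (by exact_mod_cast hg)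
    (fun j hj => hintg j (by exact_mod_cast hj)) le_rfl) (-u / (2 * Real.pi))
  have hpi : (0 : ℝ) < 2 * Real.pi := by positivity
  have h0 : 𝓕 g (-u / (2 * Real.pi)) = ∫ t : ℝ, g t * cexp (u * t * I) := by
    rw [Real.fourier_eq']
    congr 1
    funext t
    rw [smul_eq_mul, mul_comm]
    congr 2
    have : (Real.pi : ℂ) ≠ 0 := by exact_mod_cast Real.pi_ne_zero
    simp
    field_simp
  rw [h0] at h
  have h2 := congrArg norm h
  have hpc : (Real.pi : ℂ) ≠ 0 := by exact_mod_cast Real.pi_ne_zero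
  have h3 : (2 * (Real.pi : ℂ) * I * ((-u / (2 * Real.pi) : ℝ) : ℂ)) = -(u * I) := by
    push_cast
    field_simp
  rw [norm_smul, norm_pow, h3, norm_neg, norm_mul, norm_I, mul_one, norm_real,
    Real.norm_eq_abs] at h2
  rw [← h2, Real.fourier_eq']
  refine (norm_integral_le_integral_norm _).trans (le_of_eq ?_)
  congr 1
  funext t
  rw [norm_smul, norm_exp_ofReal_mul_I, one_mul]

end Kernel

section LUpper

open Complex

lemma norm_cpow_neg_succ_sub_le {m : ℝ} (hm : 1 ≤ m) {s : ℂ} (hs : -1 ≤ s.re) {u : ℝ}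
    (hu : u ∈ Set.Icc m (m + 1)) :
    ‖(u : ℂ) ^ (-s) - (m : ℂ) ^ (-s)‖ ≤ ‖s‖ * m ^ (-s.re - 1) := by
  have hder : ∀ x ∈ Set.Icc m (m + 1), HasDerivWithinAt (fun x : ℝ => (x : ℂ) ^ (-s))
      (-s * (x : ℂ) ^ (-s - 1)) (Set.Icc m (m + 1)) x := fun x hx => by
    have hx0 : 0 < x := by linarith [hx.1]
    have := (HasDerivAt.cpow_const (hasDerivAt_id (x : ℂ)) (c := -s)
      (Or.inl (by simpa using hx0))).comp_ofReal
    simpa using this.hasDerivWithinAt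
  have hb : ∀ x ∈ Set.Icc m (m + 1), ‖-s * (x : ℂ) ^ (-s - 1)‖ ≤ ‖s‖ * m ^ (-s.re - 1) :=
    fun x hx => by
      have hx0 : 0 < x := by linarith [hx.1]
      rw [norm_mul, norm_neg, norm_cpow_eq_rpow_re_of_pos hx0]
      gcongr ?_ * ?_
      simp only [sub_re, neg_re, one_re]
      exact Real.rpow_le_rpow_of_nonpos (by linarith) hx.1 (by linarith)
  have h := (convex_Icc m (m + 1)).norm_image_sub_le_of_norm_hasDerivWithin_le hder hb
    (Set.left_mem_Icc.mpr (by linarith)) hu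
  refine h.trans ?_
  have h1 : ‖u - m‖ ≤ 1 := by
    rw [Real.norm_eq_abs, abs_le]
    constructor <;> linarith [hu.1, hu.2]
  exact mul_le_of_le_one_right (by positivity) h1

/-- Partial sums `χ 1 + ⋯ + χ N`. -/
noncomputable def charSum {q : ℕ} (χ : DirichletCharacter ℂ q) (N : ℕ) : ℂ :=
  ∑ k ∈ Finset.range N, χ ((k + 1 : ℕ) : ZMod q)

lemma charSum_add_modulus {q : ℕ} [NeZero q] {χ : DirichletCharacter ℂ q} (hχ : χ ≠ 1) (N : ℕ) :
    charSum χ (N + q) = charSum χ N := by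
  rw [charSum, Finset.sum_range_add, ← charSum, add_eq_left]
  have h0 : ∑ a : ZMod q, χ a = 0 := MulChar.sum_eq_zero_of_ne_one hχ
  rw [← h0]
  have h1 : ∑ a : ZMod q, χ a = ∑ a : ZMod q, χ (a + ((N + 1 : ℕ) : ZMod q)) :=
    (Equiv.sum_comp (Equiv.addRight ((N + 1 : ℕ) : ZMod q)) (fun a => χ a)).symm
  rw [h1]
  refine Finset.sum_bij' (fun k _ => (k : ZMod q)) (fun a _ => a.val) ?_ ?_ ?_ ?_ ?_
  · intro k _; exact Finset.mem_univ _
  · intro a _; exact Finset.mem_range.mpr (ZMod.val_lt a)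
  · intro k hk; exact ZMod.val_cast_of_lt (Finset.mem_range.mp hk)
  · intro a _; exact ZMod.natCast_zmod_val a
  · intro k _
    congr 1
    push_cast
    ring

lemma norm_charSum_le {q : ℕ} [NeZero q] {χ : DirichletCharacter ℂ q} (hχ : χ ≠ 1) (N : ℕ) :
    ‖charSum χ N‖ ≤ q := by
  induction N using Nat.strong_induction_on with
  | _ N ih =>
    rcases lt_or_ge N q with h | h
    · calc ‖charSum χ N‖ ≤ ∑ k ∈ Finset.range N, 1 :=
          norm_sum_le_of_le _ fun k _ => DirichletCharacter.norm_le_one _ _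
        _ = N := by simp
        _ ≤ q := by exact_mod_cast h.le
    · obtain ⟨m, rfl⟩ := Nat.exists_eq_add_of_le' h
      rw [charSum_add_modulus hχ]
      exact ih m (by have := NeZero.pos q; omega)

/-- Terms of the Abel-summed series of `L(s, χ)`, convergent for `0 < re s`. -/
noncomputable def abelTerm {q : ℕ} (χ : DirichletCharacter ℂ q) (s : ℂ) (n : ℕ) : ℂ :=
  charSum χ (n + 1) * (((n + 1 : ℝ) : ℂ) ^ (-s) - ((n + 2 : ℝ) : ℂ) ^ (-s))

/-- Terms of a series for `(s - 1) ζ(s) - 1`, convergent for `0 < re s`. -/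
noncomputable def zetaTerm (s : ℂ) (n : ℕ) : ℂ :=
  (s - 1) * ((n + 1 : ℝ) : ℂ) ^ (-s) + ((n + 2 : ℝ) : ℂ) ^ (1 - s) - ((n + 1 : ℝ) : ℂ) ^ (1 - s)

lemma norm_abelTerm_le {q : ℕ} [NeZero q] {χ : DirichletCharacter ℂ q} (hχ : χ ≠ 1) {s : ℂ}
    (hs : 0 < s.re) (n : ℕ) : ‖abelTerm χ s n‖ ≤ q * ‖s‖ * (n + 1 : ℝ) ^ (-s.re - 1) := by
  rw [abelTerm, norm_mul, norm_sub_rev, mul_assoc]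
  have hn : (0 : ℝ) ≤ n := n.cast_nonneg
  refine mul_le_mul (norm_charSum_le hχ _) ?_ (norm_nonneg _) (Nat.cast_nonneg _)
  exact norm_cpow_neg_succ_sub_le (by linarith) (by linarith) ⟨by linarith, by linarith⟩

lemma norm_zetaTerm_le {s : ℂ} (hs : 0 < s.re) (n : ℕ) :
    ‖zetaTerm s n‖ ≤ ‖s - 1‖ * ‖s‖ * (n + 1 : ℝ) ^ (-s.re - 1) := by
  have hn : (0 : ℝ) ≤ n := n.cast_nonneg
  have hder : ∀ x ∈ Set.Icc (n + 1 : ℝ) (n + 1 + 1), HasDerivWithinAt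
      (fun x : ℝ => (x : ℂ) ^ (1 - s) - (1 - s) * ((n + 1 : ℝ) : ℂ) ^ (-s) * x)
      ((1 - s) * ((x : ℂ) ^ (-s) - ((n + 1 : ℝ) : ℂ) ^ (-s))) (Set.Icc (n + 1 : ℝ) (n + 1 + 1)) x :=
    fun x hx => by
    have hx0 : 0 < x := by linarith [hx.1]
    have h1 := (HasDerivAt.cpow_const (hasDerivAt_id (x : ℂ)) (c := 1 - s)
      (Or.inl (by simpa using hx0)))
    have h2 := (hasDerivAt_id (x : ℂ)).const_mul ((1 - s) * ((n + 1 : ℝ) : ℂ) ^ (-s))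
    have h3 := (h1.sub h2).comp_ofReal.hasDerivWithinAt (s := Set.Icc (n + 1 : ℝ) (n + 1 + 1))
    refine h3.congr_deriv ?_
    rw [mul_one, mul_one, id_eq, sub_sub_cancel_left]
    ring
  have hb : ∀ x ∈ Set.Icc (n + 1 : ℝ) (n + 1 + 1),
      ‖(1 - s) * ((x : ℂ) ^ (-s) - ((n + 1 : ℝ) : ℂ) ^ (-s))‖ ≤
        ‖s - 1‖ * ‖s‖ * (n + 1 : ℝ) ^ (-s.re - 1) := fun x hx => by
    rw [norm_mul, norm_sub_rev 1 s, mul_assoc]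
    gcongr
    exact norm_cpow_neg_succ_sub_le (by linarith) (by linarith) hx
  have h := (convex_Icc (n + 1 : ℝ) (n + 1 + 1)).norm_image_sub_le_of_norm_hasDerivWithin_le
    hder hb (Set.left_mem_Icc.mpr (by linarith)) (Set.right_mem_Icc.mpr (by linarith))
  rw [add_sub_cancel_left, norm_one, mul_one] at h
  refine le_trans (le_of_eq ?_) h
  rw [zetaTerm]
  congr 1
  push_cast
  ring_nf

lemma sum_abelTerm {q : ℕ} (χ : DirichletCharacter ℂ q) (s : ℂ) (N : ℕ) :
    ∑ n ∈ Finset.range N, abelTerm χ s n =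
      ∑ k ∈ Finset.range N, χ ((k + 1 : ℕ) : ZMod q) * ((k + 1 : ℝ) : ℂ) ^ (-s) -
        charSum χ N * ((N + 1 : ℝ) : ℂ) ^ (-s) := by
  induction N with
  | zero => simp [charSum]
  | succ N ih =>
    rw [Finset.sum_range_succ, ih, Finset.sum_range_succ, abelTerm]
    have : charSum χ (N + 1) = charSum χ N + χ ((N + 1 : ℕ) : ZMod q) := by
      rw [charSum, Finset.sum_range_succ, ← charSum]
    rw [this, show ((N + 1 : ℕ) : ℝ) + 1 = N + 2 by push_cast; ring]
    ring

lemma sum_zetaTerm (s : ℂ) (N : ℕ) :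
    ∑ n ∈ Finset.range N, zetaTerm s n =
      (s - 1) * ∑ k ∈ Finset.range N, ((k + 1 : ℝ) : ℂ) ^ (-s) +
        ((N + 1 : ℝ) : ℂ) ^ (1 - s) - 1 := by
  induction N with
  | zero => simp
  | succ N ih =>
    rw [Finset.sum_range_succ, ih, Finset.sum_range_succ, zetaTerm,
      show ((N + 1 : ℕ) : ℝ) + 1 = N + 2 by push_cast; ring]
    ring

lemma summable_succ_rpow {a : ℝ} (ha : 1 < a) : Summable fun n : ℕ => (n + 1 : ℝ) ^ (-a) := by
  have := (summable_nat_add_iff 1).mpr (Real.summable_nat_rpow.mpr (by linarith : -a < -1))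
  simpa using this

/-- A series with terms `O(‖g s‖ n ^ (-re s - 1))` defines a holomorphic function on `0 < re s`. -/
lemma differentiableOn_tsum_of_norm_le {u : ℕ → ℂ → ℂ} {g : ℂ → ℝ} (hg : Continuous g)
    (hg0 : ∀ s, 0 ≤ g s)
    (hu : ∀ n, Differentiable ℂ (u n))
    (hb : ∀ n s, 0 < s.re → ‖u n s‖ ≤ g s * (n + 1 : ℝ) ^ (-s.re - 1)) :
    DifferentiableOn ℂ (fun s => ∑' n, u n s) {s | 0 < s.re} := by
  intro s hs
  have hs' : 0 < s.re := hs
  obtain ⟨M, hM⟩ := (isCompact_closedBall s (s.re / 2)).exists_bound_of_continuousOn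
    hg.continuousOn
  have hsub : ∀ z ∈ Metric.ball s (s.re / 2), s.re / 2 < z.re := fun z hz => by
    have h1 := (abs_le.mp (Complex.abs_re_le_norm (z - s))).1
    rw [Metric.mem_ball, dist_eq_norm] at hz
    rw [Complex.sub_re] at h1
    linarith
  have hd : DifferentiableOn ℂ (fun s => ∑' n, u n s) (Metric.ball s (s.re / 2)) := by
    refine Complex.differentiableOn_tsum_of_summable_norm
      (u := fun n : ℕ => M * (n + 1 : ℝ) ^ (-(s.re / 2 + 1)))
      ((summable_succ_rpow (by linarith)).mul_left M) (fun n => (hu n).differentiableOn)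
      Metric.isOpen_ball fun n z hz => ?_
    have hz2 := hsub z hz
    refine (hb n z (by linarith)).trans ?_
    have hgz : g z ≤ M := (le_abs_self _).trans (hM z (Metric.ball_subset_closedBall hz))
    have : (1 : ℝ) ≤ n + 1 := by linarith [(n.cast_nonneg : (0 : ℝ) ≤ n)]
    have hrp : (n + 1 : ℝ) ^ (-z.re - 1) ≤ (n + 1 : ℝ) ^ (-(s.re / 2 + 1)) :=
      Real.rpow_le_rpow_of_exponent_le this (by linarith)
    exact mul_le_mul hgz hrp (by positivity) ((hg0 z).trans hgz)
  exact (hd.differentiableAt (Metric.isOpen_ball.mem_nhds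
    (Metric.mem_ball_self (by linarith)))).differentiableWithinAt

lemma eqOn_re_pos_of_eqOn {f g : ℂ → ℂ} (hf : DifferentiableOn ℂ f {s | 0 < s.re})
    (hg : DifferentiableOn ℂ g {s | 0 < s.re}) (h : ∀ s : ℂ, 1 < s.re → f s = g s) :
    ∀ s : ℂ, 0 < s.re → f s = g s := by
  have ho : IsOpen {s : ℂ | 0 < s.re} := isOpen_lt continuous_const continuous_re
  have hpre : IsPreconnected {s : ℂ | 0 < s.re} :=
    (convex_halfSpace_re_gt 0).isPreconnected
  have h2 : (2 : ℂ) ∈ {s : ℂ | 0 < s.re} := by simp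
  have := (hf.analyticOnNhd ho).eqOn_of_preconnected_of_eventuallyEq (hg.analyticOnNhd ho) hpre h2
    (by
      have : {s : ℂ | 1 < s.re} ∈ nhds (2 : ℂ) :=
        (isOpen_lt continuous_const continuous_re).mem_nhds (by simp)
      filter_upwards [this] with s hs using h s hs)
  exact fun s hs => this hs

lemma differentiable_cpow_neg {r : ℝ} (hr : 0 < r) (c : ℂ) :
    Differentiable ℂ fun s : ℂ => (r : ℂ) ^ (c - s) := fun s =>
  ((differentiableAt_const c).sub differentiableAt_id).const_cpow
    (Or.inl (by exact_mod_cast hr.ne'))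

lemma tendsto_succ_cpow_zero {s : ℂ} (hs : s.re < 0) :
    Tendsto (fun N : ℕ => ((N + 1 : ℝ) : ℂ) ^ s) atTop (nhds 0) := by
  rw [tendsto_zero_iff_norm_tendsto_zero]
  have h := (tendsto_rpow_neg_atTop (y := -s.re) (by linarith)).comp
    (tendsto_natCast_atTop_atTop.atTop_add (tendsto_const_nhds (x := (1 : ℝ))))
  refine h.congr fun N => ?_
  rw [norm_cpow_eq_rpow_re_of_pos (by positivity)]
  simp

lemma hasSum_abelTerm {q : ℕ} [NeZero q] {χ : DirichletCharacter ℂ q} (hχ : χ ≠ 1) {s : ℂ}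
    (hs : 0 < s.re) : HasSum (abelTerm χ s) (χ.LFunction s) := by
  have hsum : ∀ s : ℂ, 0 < s.re → Summable (abelTerm χ s) := fun s hs =>
    Summable.of_norm_bounded (g := fun n : ℕ => q * ‖s‖ * (n + 1 : ℝ) ^ (-s.re - 1))
      ((summable_succ_rpow (a := s.re + 1) (by linarith)).mul_left _ |>.congr fun n => by
        congr 2; ring) fun n => norm_abelTerm_le hχ hs n
  have key := eqOn_re_pos_of_eqOn (f := χ.LFunction) (g := fun s => ∑' n, abelTerm χ s n)
    (DirichletCharacter.differentiable_LFunction hχ).differentiableOn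
    (differentiableOn_tsum_of_norm_le (u := fun n s => abelTerm χ s n) (g := fun s => q * ‖s‖)
      (by fun_prop) (fun s => by positivity) (fun n => by
        unfold abelTerm
        have h1 := differentiable_cpow_neg (r := n + 1) (by positivity) 0
        have h2 := differentiable_cpow_neg (r := n + 2) (by positivity) 0
        simp only [zero_sub] at h1 h2
        exact (h1.sub h2).const_mul _) (fun n s hs => norm_abelTerm_le hχ hs n))
    (fun s hs => by
      have h1 := (hsum s (by linarith)).hasSum.tendsto_sum_nat
      have h2 : Tendsto (fun N : ℕ => ∑ n ∈ Finset.range N, abelTerm χ s n) atTop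
          (nhds (χ.LFunction s)) := by
        simp_rw [sum_abelTerm]
        have h3 : Tendsto (fun N : ℕ => charSum χ N * ((N + 1 : ℝ) : ℂ) ^ (-s)) atTop (nhds 0) := by
          have := (tendsto_succ_cpow_zero (s := -s) (by simp; linarith)).norm.const_mul (q : ℝ)
          rw [norm_zero, mul_zero] at this
          refine squeeze_zero_norm (fun N => ?_) this
          rw [norm_mul]
          gcongr
          exact norm_charSum_le hχ N
        have h4 : HasSum (fun k : ℕ => χ ((k + 1 : ℕ) : ZMod q) * ((k + 1 : ℝ) : ℂ) ^ (-s))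
            (χ.LFunction s) := by
          rw [DirichletCharacter.LFunction_eq_LSeries _ hs]
          have h5 := (DirichletCharacter.LSeriesSummable_of_one_lt_re χ hs).hasSum
          rw [← LSeries, ← hasSum_nat_add_iff' 1] at h5
          simp only [Finset.sum_range_one, LSeries.term_zero, sub_zero] at h5
          refine h5.congr_fun fun k => ?_
          rw [LSeries.term_of_ne_zero (by omega), cpow_neg, ← div_eq_mul_inv]
          push_cast
          rfl
        simpa using h4.tendsto_sum_nat.sub h3
      exact tendsto_nhds_unique h2 h1)
  rw [key s hs]
  exact (hsum s hs).hasSum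

end LUpper

section LUpper

open Complex

/-- The entire function `(s - 1) ζ(s)`. -/
noncomputable def zetaOne : ℂ → ℂ := Function.update (fun s => (s - 1) * riemannZeta s) 1 1

lemma zetaOne_one : zetaOne 1 = 1 := by simp [zetaOne]

lemma zetaOne_of_ne {s : ℂ} (hs : s ≠ 1) : zetaOne s = (s - 1) * riemannZeta s := by
  simp [zetaOne, hs]

lemma differentiable_zetaOne : Differentiable ℂ zetaOne := by
  have h : zetaOne = DirichletCharacter.LFunctionTrivChar₁ 1 := by
    unfold zetaOne DirichletCharacter.LFunctionTrivChar₁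
    simp [DirichletCharacter.LFunctionTrivChar, DirichletCharacter.LFunction_modOne_eq]
  rw [h]
  exact DirichletCharacter.differentiable_LFunctionTrivChar₁ 1

lemma hasSum_zetaTerm {s : ℂ} (hs : 0 < s.re) : HasSum (zetaTerm s) (zetaOne s - 1) := by
  have hsum : ∀ s : ℂ, 0 < s.re → Summable (zetaTerm s) := fun s hs =>
    Summable.of_norm_bounded (g := fun n : ℕ => ‖s - 1‖ * ‖s‖ * (n + 1 : ℝ) ^ (-s.re - 1))
      ((summable_succ_rpow (a := s.re + 1) (by linarith)).mul_left _ |>.congr fun n => by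
        congr 2; ring) (norm_zetaTerm_le hs)
  have key := eqOn_re_pos_of_eqOn (f := fun s => zetaOne s - 1) (g := fun s => ∑' n, zetaTerm s n)
    (differentiable_zetaOne.sub_const 1).differentiableOn
    (differentiableOn_tsum_of_norm_le (u := fun n s => zetaTerm s n)
      (g := fun s => ‖s - 1‖ * ‖s‖)
      (by fun_prop) (fun s => by positivity) (fun n => by
        unfold zetaTerm
        have h1 := differentiable_cpow_neg (r := n + 1) (by positivity) 0
        have h2 := differentiable_cpow_neg (r := n + 2) (by positivity) 1
        have h3 := differentiable_cpow_neg (r := n + 1) (by positivity) 1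
        simp only [zero_sub] at h1
        exact (((differentiable_id.sub_const 1).mul h1).add h2).sub h3)
      (fun n s hs => norm_zetaTerm_le hs n))
    (fun s hs => by
      have h1 := (hsum s (by linarith)).hasSum.tendsto_sum_nat
      have h2 : Tendsto (fun N : ℕ => ∑ n ∈ Finset.range N, zetaTerm s n) atTop
          (nhds (zetaOne s - 1)) := by
        simp_rw [sum_zetaTerm]
        have h3 := tendsto_succ_cpow_zero (s := 1 - s) (by simp; linarith)
        have h4 : HasSum (fun k : ℕ => ((k + 1 : ℝ) : ℂ) ^ (-s)) (riemannZeta s) := by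
          rw [zeta_eq_tsum_one_div_nat_add_one_cpow hs]
          have h5 := (summable_nat_add_iff 1).mpr (Complex.summable_one_div_nat_cpow.mpr hs)
          have h6 : (fun k : ℕ => ((k + 1 : ℝ) : ℂ) ^ (-s)) = fun k : ℕ => 1 / ((k : ℂ) + 1) ^ s := by
            funext k
            rw [cpow_neg, one_div]
            push_cast
            rfl
          simp only [Nat.cast_add, Nat.cast_one] at h5
          rw [h6]
          exact h5.hasSum
        have h6 := ((h4.tendsto_sum_nat.const_mul (s - 1)).add h3).sub_const 1
        rwa [add_zero, ← zetaOne_of_ne (fun h => by simp [h] at hs)] at h6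
      exact tendsto_nhds_unique h2 h1)
  rw [key s hs]
  exact (hsum s hs).hasSum

lemma sum_rpow_neg_le {ε σ : ℝ} (hε : 0 < ε) (hσ : 1 - ε ≤ σ) (N : ℕ) :
    ∑ k ∈ Finset.range N, (k + 1 : ℝ) ^ (-σ) ≤
      (N : ℝ) ^ (2 * ε) * ∑' k : ℕ, (k + 1 : ℝ) ^ (-(1 + ε)) := by
  have hs := summable_succ_rpow (a := 1 + ε) (by linarith)
  calc ∑ k ∈ Finset.range N, (k + 1 : ℝ) ^ (-σ)
      ≤ ∑ k ∈ Finset.range N, (N : ℝ) ^ (2 * ε) * (k + 1 : ℝ) ^ (-(1 + ε)) := by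
        refine Finset.sum_le_sum fun k hk => ?_
        have h1 : (1 : ℝ) ≤ k + 1 := by linarith [(k.cast_nonneg : (0 : ℝ) ≤ k)]
        have h2 : (k + 1 : ℝ) ≤ N := by exact_mod_cast Finset.mem_range.mp hk
        calc (k + 1 : ℝ) ^ (-σ) ≤ (k + 1 : ℝ) ^ (2 * ε + -(1 + ε)) :=
              Real.rpow_le_rpow_of_exponent_le h1 (by linarith)
          _ = (k + 1 : ℝ) ^ (2 * ε) * (k + 1 : ℝ) ^ (-(1 + ε)) :=
              Real.rpow_add (by linarith) _ _
          _ ≤ _ := by gcongr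
    _ = (N : ℝ) ^ (2 * ε) * ∑ k ∈ Finset.range N, (k + 1 : ℝ) ^ (-(1 + ε)) :=
        (Finset.mul_sum _ _ _).symm
    _ ≤ _ := by
        gcongr
        exact hs.sum_le_tsum _ fun k _ => by positivity

lemma norm_le_sum_add_of_hasSum {u : ℕ → ℂ} {L : ℂ} (hu : HasSum u L) {B ε σ : ℝ} (hε : 0 < ε)
    (hε2 : ε ≤ 1 / 2) (hσ : 1 - ε ≤ σ) (hB : 0 ≤ B)
    (hb : ∀ n, ‖u n‖ ≤ B * (n + 1 : ℝ) ^ (-σ - 1)) {N : ℕ} (hN : 1 ≤ N) :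
    ‖L‖ ≤ ‖∑ n ∈ Finset.range N, u n‖ +
      B / N * (N : ℝ) ^ (2 * ε) * ∑' k : ℕ, (k + 1 : ℝ) ^ (-(1 + ε)) := by
  have hs := summable_succ_rpow (a := 1 + ε) (by linarith)
  have hN' : (1 : ℝ) ≤ N := by exact_mod_cast hN
  rw [← hu.tsum_eq, ← hu.summable.sum_add_tsum_nat_add N]
  refine (norm_add_le _ _).trans ?_
  gcongr
  rw [← tsum_mul_left]
  refine tsum_of_norm_bounded (hs.mul_left _).hasSum fun n => (hb _).trans ?_
  have hn : (0 : ℝ) ≤ n := n.cast_nonneg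
  push_cast
  have h1 : (n + N + 1 : ℝ) ^ (-σ - 1) ≤ (n + N + 1 : ℝ) ^ (2 * ε - 1 + -(1 + ε)) :=
    Real.rpow_le_rpow_of_exponent_le (by linarith) (by linarith)
  rw [Real.rpow_add (by linarith)] at h1
  have h2 : (n + N + 1 : ℝ) ^ (2 * ε - 1) ≤ (N : ℝ) ^ (2 * ε - 1) :=
    Real.rpow_le_rpow_of_nonpos (by linarith) (by linarith) (by linarith)
  have h3 : (n + N + 1 : ℝ) ^ (-(1 + ε)) ≤ (n + 1 : ℝ) ^ (-(1 + ε)) :=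
    Real.rpow_le_rpow_of_nonpos (by linarith) (by linarith) (by linarith)
  calc B * (n + N + 1 : ℝ) ^ (-σ - 1)
      ≤ B * ((N : ℝ) ^ (2 * ε - 1) * (n + 1 : ℝ) ^ (-(1 + ε))) := by
        gcongr
        exact h1.trans (by gcongr)
    _ = _ := by
        rw [Real.rpow_sub_one (by linarith)]
        ring

lemma norm_le_of_abs_im {s : ℂ} (h0 : 0 ≤ s.re) (h3 : s.re ≤ 4) : ‖s‖ ≤ 2 * (|s.im| + 2) := by
  refine (Complex.norm_le_abs_re_add_abs_im s).trans ?_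
  rw [abs_of_nonneg h0]
  linarith [abs_nonneg s.im]

/-- Upper bound for `L(s, χ)` slightly to the left of the line `re s = 1`. -/
theorem exists_norm_LFunction_le {ε : ℝ} (hε : 0 < ε) (hε2 : ε ≤ 1 / 2) :
    ∃ C : ℝ, 0 < C ∧ ∀ (q : ℕ) [NeZero q] (χ : DirichletCharacter ℂ q), χ ≠ 1 →
      ∀ s : ℂ, 1 - ε ≤ s.re → s.re ≤ 4 →
        ‖χ.LFunction s‖ ≤ C * (q * (|s.im| + 2)) ^ (2 * ε) := by
  have hZ : (0 : ℝ) ≤ ∑' k : ℕ, (k + 1 : ℝ) ^ (-(1 + ε)) := tsum_nonneg fun k => by positivity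
  set Z : ℝ := ∑' k : ℕ, (k + 1 : ℝ) ^ (-(1 + ε)) with hZdef
  refine ⟨(3 * Z + 1) * 2, by positivity, fun q _ χ hχ s h1 h3 => ?_⟩
  have hs0 : 0 < s.re := by linarith
  have hq : (1 : ℝ) ≤ q := by exact_mod_cast NeZero.one_le
  set τ : ℝ := q * (|s.im| + 2) with hτ
  have hqτ : (q : ℝ) ≤ τ := le_mul_of_one_le_right (by linarith) (by linarith [abs_nonneg s.im])
  have hτ1 : 1 ≤ τ := hq.trans hqτ
  set N := ⌈τ⌉₊
  have hNτ : τ ≤ N := Nat.le_ceil τ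
  have hN2 : (N : ℝ) ≤ 2 * τ := by linarith [Nat.ceil_lt_add_one (by linarith : 0 ≤ τ)]
  have hN1 : 1 ≤ N := Nat.one_le_ceil_iff.mpr (by linarith)
  have hN1' : (1 : ℝ) ≤ N := by exact_mod_cast hN1
  have hmain := norm_le_sum_add_of_hasSum (hasSum_abelTerm hχ hs0) hε hε2 h1
    (B := q * ‖s‖) (by positivity) (norm_abelTerm_le hχ hs0) hN1
  rw [← hZdef] at hmain
  have hhead : ‖∑ n ∈ Finset.range N, abelTerm χ s n‖ ≤ (N : ℝ) ^ (2 * ε) * (Z + 1) := by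
    rw [sum_abelTerm]
    refine (norm_sub_le _ _).trans ?_
    rw [mul_add, mul_one]
    gcongr
    · refine (norm_sum_le_of_le _ fun k _ => ?_).trans (sum_rpow_neg_le hε h1 N)
      rw [norm_mul, norm_cpow_eq_rpow_re_of_pos (by positivity)]
      exact mul_le_of_le_one_left (by positivity) (DirichletCharacter.norm_le_one _ _)
    · rw [norm_mul, norm_cpow_eq_rpow_re_of_pos (by positivity)]
      calc ‖charSum χ N‖ * (N + 1 : ℝ) ^ ((-s).re) ≤ N * (N : ℝ) ^ (2 * ε - 1) := by
            gcongr
            · exact (norm_charSum_le hχ N).trans (hqτ.trans hNτ)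
            · refine (Real.rpow_le_rpow_of_nonpos (by linarith) (by linarith : (N : ℝ) ≤ N + 1)
                (by simp; linarith)).trans (Real.rpow_le_rpow_of_exponent_le hN1' ?_)
              simp
              linarith
        _ = _ := by rw [Real.rpow_sub_one (by linarith)]; field_simp
  have hBN : q * ‖s‖ / N ≤ 2 := by
    rw [div_le_iff₀ (by linarith)]
    calc q * ‖s‖ ≤ q * (2 * (|s.im| + 2)) := by gcongr; exact norm_le_of_abs_im hs0.le h3
      _ = 2 * τ := by rw [hτ]; ring
      _ ≤ _ := by linarith
  have hpow : (N : ℝ) ^ (2 * ε) ≤ 2 * τ ^ (2 * ε) := by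
    calc (N : ℝ) ^ (2 * ε) ≤ (2 * τ) ^ (2 * ε) := by gcongr
      _ = 2 ^ (2 * ε) * τ ^ (2 * ε) := Real.mul_rpow (by norm_num) (by linarith)
      _ ≤ 2 ^ (1 : ℝ) * τ ^ (2 * ε) := by
          gcongr
          · norm_num
          · linarith
      _ = _ := by rw [Real.rpow_one]
  calc ‖χ.LFunction s‖ ≤ (N : ℝ) ^ (2 * ε) * (Z + 1) + 2 * (N : ℝ) ^ (2 * ε) * Z := by
        refine hmain.trans ?_
        gcongr
    _ = (3 * Z + 1) * (N : ℝ) ^ (2 * ε) := by ring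
    _ ≤ (3 * Z + 1) * (2 * τ ^ (2 * ε)) := by gcongr
    _ = _ := by ring

theorem exists_norm_zetaOne_le {ε : ℝ} (hε : 0 < ε) (hε2 : ε ≤ 1 / 2) :
    ∃ C : ℝ, 0 < C ∧ ∀ s : ℂ, 1 - ε ≤ s.re → s.re ≤ 4 →
      ‖zetaOne s‖ ≤ C * (|s.im| + 2) ^ (1 + 2 * ε) := by
  have hZ : (0 : ℝ) ≤ ∑' k : ℕ, (k + 1 : ℝ) ^ (-(1 + ε)) := tsum_nonneg fun k => by positivity
  set Z : ℝ := ∑' k : ℕ, (k + 1 : ℝ) ^ (-(1 + ε)) with hZdef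
  refine ⟨12 * Z + 8, by positivity, fun s h1 h3 => ?_⟩
  have hs0 : 0 < s.re := by linarith
  set τ : ℝ := |s.im| + 2 with hτ
  have hτ1 : 2 ≤ τ := by linarith [abs_nonneg s.im]
  set N := ⌈τ⌉₊
  have hNτ : τ ≤ N := Nat.le_ceil τ
  have hN2 : (N : ℝ) + 1 ≤ 2 * τ := by
    linarith [Nat.ceil_lt_add_one (by linarith : 0 ≤ τ)]
  have hN1 : 1 ≤ N := Nat.one_le_ceil_iff.mpr (by linarith)
  have hN1' : (1 : ℝ) ≤ N := by exact_mod_cast hN1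
  have hs1 : ‖s - 1‖ ≤ 2 * τ := by
    refine (Complex.norm_le_abs_re_add_abs_im _).trans ?_
    have : |(s - 1).re| ≤ 3 := by
      rw [abs_le]; simp; constructor <;> linarith
    simp only [sub_im, one_im, sub_zero] at *
    linarith
  have hpow : (N + 1 : ℝ) ^ (2 * ε) ≤ 2 * τ ^ (2 * ε) := by
    calc (N + 1 : ℝ) ^ (2 * ε) ≤ (2 * τ) ^ (2 * ε) := by gcongr
      _ = 2 ^ (2 * ε) * τ ^ (2 * ε) := Real.mul_rpow (by norm_num) (by linarith)
      _ ≤ 2 ^ (1 : ℝ) * τ ^ (2 * ε) := by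
          gcongr
          · norm_num
          · linarith
      _ = _ := by rw [Real.rpow_one]
  have hpow' : (N : ℝ) ^ (2 * ε) ≤ 2 * τ ^ (2 * ε) :=
    (Real.rpow_le_rpow (by linarith) (by linarith) (by linarith)).trans hpow
  have hτp : 1 ≤ τ ^ (2 * ε) := Real.one_le_rpow (by linarith) (by linarith)
  have hmain := norm_le_sum_add_of_hasSum (hasSum_zetaTerm hs0) hε hε2 h1
    (B := ‖s - 1‖ * ‖s‖) (by positivity) (norm_zetaTerm_le hs0) hN1
  rw [← hZdef] at hmain
  have hhead : ‖∑ n ∈ Finset.range N, zetaTerm s n‖ ≤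
      2 * τ * (2 * τ ^ (2 * ε) * Z) + 2 * τ ^ (2 * ε) + 1 := by
    rw [sum_zetaTerm]
    refine (norm_sub_le _ _).trans ?_
    rw [norm_one]
    gcongr
    refine (norm_add_le _ _).trans ?_
    gcongr
    · rw [norm_mul]
      gcongr
      refine (norm_sum_le_of_le _ fun k _ => ?_).trans ((sum_rpow_neg_le hε h1 N).trans ?_)
      · exact (norm_cpow_eq_rpow_re_of_pos (by positivity) _).le
      · gcongr
    · rw [norm_cpow_eq_rpow_re_of_pos (by positivity)]
      refine (Real.rpow_le_rpow_of_exponent_le (by linarith) ?_).trans hpow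
      simp
      linarith
  have hBN : ‖s - 1‖ * ‖s‖ / N ≤ 4 * τ := by
    rw [div_le_iff₀ (by linarith)]
    calc ‖s - 1‖ * ‖s‖ ≤ (2 * τ) * (2 * τ) := by gcongr; exact norm_le_of_abs_im hs0.le h3
      _ = 4 * τ * τ := by ring
      _ ≤ _ := by gcongr
  have hfin : ‖zetaOne s‖ ≤ ‖zetaOne s - 1‖ + 1 := by
    simpa using norm_add_le (zetaOne s - 1) 1
  have htail : ‖s - 1‖ * ‖s‖ / N * (N : ℝ) ^ (2 * ε) * Z ≤ 4 * τ * (2 * τ ^ (2 * ε)) * Z := by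
    gcongr
  rw [Real.rpow_add (by linarith), Real.rpow_one]
  have hττ : τ ^ (2 * ε) ≤ τ * τ ^ (2 * ε) := le_mul_of_one_le_left (by positivity) (by linarith)
  nlinarith

end LUpper

section TotientBounds

open Real

lemma prod_self_div_sub_one_le (S : Finset ℕ) (hS : ∀ p ∈ S, 2 ≤ p) :
    ∏ p ∈ S, (p : ℝ) / (p - 1) ≤ S.card + 1 := by
  induction S using Finset.induction_on_max with
  | empty => simp
  | insert m S hm ih =>
    have hmS : m ∉ S := fun h => lt_irrefl _ (hm m h)
    rw [Finset.prod_insert hmS, Finset.card_insert_of_notMem hmS]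
    have ih' := ih fun p hp => hS p (Finset.mem_insert_of_mem hp)
    have hm2 : 2 ≤ m := hS m (Finset.mem_insert_self _ _)
    have hcard : S.card + 2 ≤ m := by
      have : S ⊆ Finset.Ico 2 m := fun p hp =>
        Finset.mem_Ico.mpr ⟨hS p (Finset.mem_insert_of_mem hp), hm p hp⟩
      have := Finset.card_le_card this
      rw [Nat.card_Ico] at this
      omega
    have hc : (S.card : ℝ) + 2 ≤ m := by exact_mod_cast hcard
    have hc0 : (0 : ℝ) ≤ S.card := Nat.cast_nonneg _
    push_cast
    have h1 : (m : ℝ) / (m - 1) ≤ (S.card + 2) / (S.card + 1) := by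
      rw [div_le_div_iff₀ (by linarith) (by linarith)]
      nlinarith
    calc (m : ℝ) / (m - 1) * ∏ p ∈ S, (p : ℝ) / (p - 1)
        ≤ (S.card + 2) / (S.card + 1) * (S.card + 1) := by
          refine mul_le_mul h1 ih' (Finset.prod_nonneg fun p hp => ?_) (by positivity)
          have : (2 : ℝ) ≤ p := by exact_mod_cast hS p (Finset.mem_insert_of_mem hp)
          exact div_nonneg (by linarith) (by linarith)
      _ = S.card + 1 + 1 := by
          field_simp
          ring

lemma card_primeFactors_le (n : ℕ) (hn : n ≠ 0) : (n.primeFactors.card : ℝ) ≤ 2 * Real.log n := by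
  have h1 : 2 ^ n.primeFactors.card ≤ n :=
    (Finset.pow_card_le_prod _ _ _ fun p hp => (Nat.prime_of_mem_primeFactors hp).two_le).trans
      (Nat.le_of_dvd (Nat.pos_of_ne_zero hn) (Nat.prod_primeFactors_dvd n))
  have h2 : (2 : ℝ) ^ n.primeFactors.card ≤ n := by exact_mod_cast h1
  have h3 := Real.log_le_log (by positivity) h2
  rw [Real.log_pow] at h3
  nlinarith [Real.log_two_gt_d9, (Nat.cast_nonneg n.primeFactors.card : (0 : ℝ) ≤ _)]

lemma prod_primeFactors_le (n : ℕ) (hn : n ≠ 0) :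
    ∏ p ∈ n.primeFactors, (p : ℝ) / (p - 1) ≤ 2 * Real.log n + 1 :=
  (prod_self_div_sub_one_le _ fun _ hp => (Nat.prime_of_mem_primeFactors hp).two_le).trans
    (by linarith [card_primeFactors_le n hn])

lemma self_div_totient_eq (n : ℕ) (hn : n ≠ 0) :
    (n : ℝ) / n.totient = ∏ p ∈ n.primeFactors, (p : ℝ) / (p - 1) := by
  have h := Nat.totient_eq_mul_prod_factors n
  have h' : (n.totient : ℝ) = n * ∏ p ∈ n.primeFactors, (1 - (p : ℝ)⁻¹) := by
    have h2 := congrArg (fun r : ℚ => (r : ℝ)) h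
    push_cast at h2
    exact h2
  have hn' : (n : ℝ) ≠ 0 := by exact_mod_cast hn
  rw [h', div_mul_cancel_left₀ hn', ← Finset.prod_inv_distrib]
  refine Finset.prod_congr rfl fun p hp => ?_
  have : (2 : ℝ) ≤ p := by exact_mod_cast (Nat.prime_of_mem_primeFactors hp).two_le
  have h1 : (p : ℝ) - 1 ≠ 0 := by linarith
  have h2 : (p : ℝ) ≠ 0 := by linarith
  field_simp

lemma self_div_totient_le (n : ℕ) (hn : n ≠ 0) :
    (n : ℝ) / n.totient ≤ 2 * Real.log n + 1 :=
  (self_div_totient_eq n hn).trans_le (prod_primeFactors_le n hn)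

lemma prod_one_add_inv_le (n : ℕ) :
    ∏ p ∈ n.primeFactors, (1 + (p : ℝ)⁻¹) ≤ ∏ p ∈ n.primeFactors, (p : ℝ) / (p - 1) := by
  refine Finset.prod_le_prod (fun p _ => by positivity) fun p hp => ?_
  have : (2 : ℝ) ≤ p := by exact_mod_cast (Nat.prime_of_mem_primeFactors hp).two_le
  rw [le_div_iff₀ (by linarith)]
  have h2 : (p : ℝ) ≠ 0 := by linarith
  have : 0 ≤ (p : ℝ)⁻¹ := by positivity
  have h3 : (1 + (p : ℝ)⁻¹) * (p - 1) = p - (p : ℝ)⁻¹ := by field_simp; ring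
  linarith

lemma sum_inv_totient_le (Q : ℕ) (hQ : 1 ≤ Q) :
    ∑ k ∈ Finset.Icc 1 Q, (1 : ℝ) / k.totient ≤ (2 * Real.log Q + 1) * (1 + Real.log Q) := by
  calc ∑ k ∈ Finset.Icc 1 Q, (1 : ℝ) / k.totient
      ≤ ∑ k ∈ Finset.Icc 1 Q, (2 * Real.log Q + 1) * (k : ℝ)⁻¹ := by
        refine Finset.sum_le_sum fun k hk => ?_
        obtain ⟨h1, h2⟩ := Finset.mem_Icc.mp hk
        have hk0 : (0 : ℝ) < k := by exact_mod_cast h1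
        have h3 := self_div_totient_le k (by omega)
        have h4 := Real.log_le_log hk0 (by exact_mod_cast h2 : (k : ℝ) ≤ Q)
        calc (1 : ℝ) / k.totient = (k : ℝ) / k.totient * (k : ℝ)⁻¹ := by
              field_simp
          _ ≤ _ := by gcongr; linarith
    _ = (2 * Real.log Q + 1) * (harmonic Q : ℝ) := by
        rw [← Finset.mul_sum, harmonic_eq_sum_Icc]
        push_cast
        rfl
    _ ≤ _ := by
        have := harmonic_le_one_add_log Q
        have : 0 ≤ Real.log Q := Real.log_nonneg (by exact_mod_cast hQ)
        gcongr

end TotientBounds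

section SiegelCore

open Complex
open scoped ComplexOrder

lemma iteratedDeriv_inv_sub_one (m : ℕ) (c : ℂ) :
    iteratedDeriv m (fun s : ℂ => c * (s - 1)⁻¹) 2 = (-1) ^ m * (m.factorial : ℂ) * c := by
  rw [iteratedDeriv_const_mul_field, iteratedDeriv_eq_iterate]
  have h := iter_deriv_inv_linear_sub (𝕜 := ℂ) m 1 1
  simp only [one_mul, one_pow, mul_one] at h
  rw [h]
  have h2 : (2 - 1 : ℂ) = 1 := by norm_num
  beta_reduce
  rw [h2, one_zpow]
  ring

lemma one_le_re_LSeries_two {a : ℕ → ℂ} (ha : 0 ≤ a) (ha1 : a 1 = 1)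
    (hs : LSeries.abscissaOfAbsConv a < (2 : ℝ)) : 1 ≤ (LSeries a 2).re := by
  have hsum : LSeriesSummable a 2 := LSeriesSummable_of_abscissaOfAbsConv_lt_re (by simpa using hs)
  have h1 := (Complex.hasSum_re hsum.hasSum)
  have h2 : (LSeries.term a 2 1).re ≤ (LSeries a 2).re := le_hasSum h1 1 (fun j _ => by
    have := LSeries.term_nonneg (ha j) 2
    have := (Complex.le_def.mp this).1
    simpa using this)
  have h3 : (LSeries.term a 2 1).re = 1 := by simp [ha1]
  rwa [h3] at h2

/-- The Taylor expansion at `2` of `ζ P` minus its polar part at `1`, when `ζ P` is an `L`-series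
with nonnegative coefficients. -/
lemma exists_taylor_coeff {P : ℂ → ℂ} (hP : Differentiable ℂ P) {a : ℕ → ℂ} (ha : 0 ≤ a)
    (ha1 : a 1 = 1) (habs : LSeries.abscissaOfAbsConv a ≤ 1)
    (hF : ∀ s : ℂ, 1 < s.re → LSeries a s = riemannZeta s * P s) {D : ℝ}
    (hD : ∀ s ∈ Metric.sphere (2 : ℂ) (4 / 3), ‖dslope (fun s => zetaOne s * P s) 1 s‖ ≤ D) :
    ∃ f : ℕ → ℝ, (∀ m, 0 ≤ f m) ∧ 1 ≤ f 0 ∧ (∀ m, ‖(f m : ℂ) - P 1‖ ≤ D * (3 / 4) ^ m) ∧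
      ∀ s : ℂ, HasSum (fun m : ℕ => (2 - s) ^ m * ((f m : ℂ) - P 1))
        (dslope (fun s => zetaOne s * P s) 1 s) := by
  set H := dslope (fun s => zetaOne s * P s) 1 with hH
  have hHd : Differentiable ℂ H := by
    rw [← differentiableOn_univ] at *
    rw [hH, Complex.differentiableOn_dslope Filter.univ_mem]
    exact (differentiable_zetaOne.mul (differentiableOn_univ.mp hP)).differentiableOn
  have habs2 : LSeries.abscissaOfAbsConv a < (2 : ℝ) :=
    habs.trans_lt (by exact_mod_cast one_lt_two)
  have hopen : IsOpen {s : ℂ | 1 < s.re} := continuous_re.isOpen_preimage _ isOpen_Ioi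
  have h2mem : (2 : ℂ) ∈ {s : ℂ | 1 < s.re} := by simp
  have hLan : ContDiffOn ℂ ⊤ (LSeries a) {s : ℂ | 1 < s.re} := by
    refine DifferentiableOn.contDiffOn ?_ hopen
    refine (LSeries_differentiableOn a).mono fun s hs => ?_
    exact habs.trans_lt (by exact_mod_cast hs)
  have hEq : Set.EqOn H (fun s => LSeries a s - P 1 * (s - 1)⁻¹) {s : ℂ | 1 < s.re} := by
    intro s hs
    have hs1 : s ≠ 1 := fun h => by simp [h] at hs
    have hs1' : s - 1 ≠ 0 := sub_ne_zero.mpr hs1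
    simp only [hH]
    rw [dslope_of_ne _ hs1, slope_def_field, hF s hs, zetaOne_of_ne hs1, zetaOne_one]
    field_simp
  have hcoef : ∀ m : ℕ, iteratedDeriv m H 2 =
      iteratedDeriv m (LSeries a) 2 - (-1) ^ m * (m.factorial : ℂ) * P 1 := by
    intro m
    rw [hEq.iteratedDeriv_of_isOpen hopen m h2mem, iteratedDeriv_fun_sub,
      iteratedDeriv_inv_sub_one]
    · exact ((hLan.contDiffAt (hopen.mem_nhds h2mem))).of_le le_top
    · refine contDiffAt_const.mul (ContDiffAt.inv (by fun_prop) ?_)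
      norm_num
  have halt : ∀ m : ℕ, 0 ≤ (-1) ^ m * iteratedDeriv m (LSeries a) 2 := fun m => by
    have := LSeries.iteratedDeriv_alternating ha habs2 m
    simpa using this
  have hreal : ∀ m : ℕ, ((((-1) ^ m * iteratedDeriv m (LSeries a) 2).re : ℝ) : ℂ) =
      (-1) ^ m * iteratedDeriv m (LSeries a) 2 := fun m =>
    Complex.ext (by simp) (by simpa using (Complex.le_def.mp (halt m)).2)
  have hfac : ∀ m : ℕ, (m.factorial : ℂ) ≠ 0 := fun m => by exact_mod_cast m.factorial_ne_zero
  have hsq : ∀ m : ℕ, ((-1 : ℂ) ^ m) * (-1) ^ m = 1 := fun m => by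
    rw [← mul_pow]; simp
  have hdiff : ∀ m : ℕ, (((((-1) ^ m * iteratedDeriv m (LSeries a) 2).re / m.factorial : ℝ)) : ℂ)
      - P 1 = (-1) ^ m * ((m.factorial : ℂ)⁻¹ * iteratedDeriv m H 2) := by
    intro m
    rw [hcoef, ofReal_div, hreal]
    push_cast
    have := hfac m
    field_simp
    linear_combination ((m.factorial : ℂ) * P 1) * hsq m
  refine ⟨fun m => ((-1) ^ m * iteratedDeriv m (LSeries a) 2).re / m.factorial, fun m => ?_, ?_,
    fun m => ?_, fun s => ?_⟩
  · exact div_nonneg (Complex.le_def.mp (halt m)).1 (by positivity)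
  · simpa using one_le_re_LSeries_two ha ha1 habs2
  · rw [hdiff m, norm_mul, norm_pow, norm_neg, norm_one, one_pow, one_mul, norm_mul, norm_inv,
      Complex.norm_natCast]
    have h := Complex.norm_iteratedDeriv_le_of_forall_mem_sphere_norm_le (c := 2) (R := 4 / 3) m
      (by norm_num) hHd.diffContOnCl hD
    have hfp : (0 : ℝ) < m.factorial := by exact_mod_cast m.factorial_pos
    calc (m.factorial : ℝ)⁻¹ * ‖iteratedDeriv m H 2‖
        ≤ (m.factorial : ℝ)⁻¹ * (m.factorial * D / (4 / 3) ^ m) := by gcongr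
      _ = D * (3 / 4) ^ m := by
        have : ((4 : ℝ) / 3) = (3 / 4)⁻¹ := by norm_num
        rw [this, inv_pow, div_inv_eq_mul]
        field_simp
  · have h := Complex.hasSum_taylorSeries_of_entire hHd 2 s
    refine h.congr_fun fun m => ?_
    simp only [smul_eq_mul]
    rw [hdiff m]
    have : (s - 2) ^ m = (-1) ^ m * (2 - s) ^ m := by rw [← mul_pow]; ring
    rw [this]
    ring

lemma one_sub_le_re_of_taylor {f : ℕ → ℝ} (hf : ∀ m, 0 ≤ f m) (hf0 : 1 ≤ f 0) {lam : ℂ} {D : ℝ}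
    (hfD : ∀ m, ‖(f m : ℂ) - lam‖ ≤ D * (3 / 4) ^ m) {β : ℝ} (hβ : 7 / 8 ≤ β) (hβ1 : β < 1) {S : ℂ}
    (hS : HasSum (fun m : ℕ => (2 - (β : ℂ)) ^ m * ((f m : ℂ) - lam)) S) (M : ℕ) (hM : 1 ≤ M) :
    1 - ‖lam‖ * (2 - β) ^ M / (1 - β) - D * (27 / 32) ^ M * (32 / 5) ≤
      (S + lam / ((β : ℂ) - 1)).re := by
  have hD0 : 0 ≤ D := by simpa using (norm_nonneg _).trans (hfD 0)
  have hx : (1 : ℝ) < 2 - β := by linarith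
  have hbound : ∀ m : ℕ, ‖(2 - (β : ℂ)) ^ m * ((f m : ℂ) - lam)‖ ≤ D * (27 / 32) ^ m := fun m => by
    have h1 : ‖(2 - (β : ℂ))‖ = 2 - β := by
      rw [show (2 - (β : ℂ)) = ((2 - β : ℝ) : ℂ) by push_cast; rfl, Complex.norm_real,
        Real.norm_of_nonneg (by linarith)]
    rw [norm_mul, norm_pow, h1]
    calc (2 - β) ^ m * ‖(f m : ℂ) - lam‖ ≤ (9 / 8) ^ m * (D * (3 / 4) ^ m) := by
          gcongr
          · linarith
          · exact hfD m
      _ = D * (27 / 32) ^ m := by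
          rw [show (27 / 32 : ℝ) = (9 / 8) * (3 / 4) by norm_num, mul_pow]; ring
  have hgeo := (hasSum_geometric_of_lt_one (by norm_num) (by norm_num : (27 / 32 : ℝ) < 1)).mul_left
    (D * (27 / 32) ^ M)
  have htail : ‖∑' m : ℕ, (2 - (β : ℂ)) ^ (m + M) * ((f (m + M) : ℂ) - lam)‖ ≤
      D * (27 / 32) ^ M * (32 / 5) := by
    refine (tsum_of_norm_bounded hgeo fun m => (hbound (m + M)).trans_eq (by rw [pow_add]; ring)).trans_eq ?_
    norm_num
  have hsplit := hS.summable.sum_add_tsum_nat_add M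
  rw [hS.tsum_eq] at hsplit
  have hfin : 1 - ‖lam‖ * (((2 - β) ^ M - 1) / (1 - β)) ≤
      (∑ m ∈ Finset.range M, (2 - (β : ℂ)) ^ m * ((f m : ℂ) - lam)).re := by
    have h1 : (∑ m ∈ Finset.range M, (2 - (β : ℂ)) ^ m * ((f m : ℂ) - lam)).re =
        ∑ m ∈ Finset.range M, (2 - β) ^ m * (f m - lam.re) := by
      rw [Complex.re_sum]
      refine Finset.sum_congr rfl fun m _ => ?_
      rw [show (2 - (β : ℂ)) ^ m = (((2 - β) ^ m : ℝ) : ℂ) by push_cast; rfl, Complex.re_ofReal_mul]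
      simp
    rw [h1]
    have h2 : ∑ m ∈ Finset.range M, (2 - β) ^ m * (f m - lam.re) =
        ∑ m ∈ Finset.range M, (2 - β) ^ m * f m - lam.re * ∑ m ∈ Finset.range M, (2 - β) ^ m := by
      rw [Finset.mul_sum, ← Finset.sum_sub_distrib]
      exact Finset.sum_congr rfl fun m _ => by ring
    have h3 : 1 ≤ ∑ m ∈ Finset.range M, (2 - β) ^ m * f m := by
      have := Finset.single_le_sum (f := fun m => (2 - β) ^ m * f m)
        (fun m _ => mul_nonneg (by positivity) (hf m)) (Finset.mem_range.mpr hM)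
      simp only [pow_zero, one_mul] at this
      linarith
    have h4 : ∑ m ∈ Finset.range M, (2 - β) ^ m = ((2 - β) ^ M - 1) / (1 - β) := by
      rw [geom_sum_eq (by linarith)]
      congr 1
      ring
    have h5 : lam.re * (((2 - β) ^ M - 1) / (1 - β)) ≤ ‖lam‖ * (((2 - β) ^ M - 1) / (1 - β)) := by
      refine mul_le_mul_of_nonneg_right (Complex.re_le_norm lam) (div_nonneg ?_ (by linarith))
      linarith [one_le_pow₀ hx.le (n := M)]
    rw [h2, h4]
    linarith
  have hpole : -(‖lam‖ / (1 - β)) ≤ (lam / ((β : ℂ) - 1)).re := by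
    have h1 : (lam / ((β : ℂ) - 1)).re = lam.re / (β - 1) := by
      rw [show ((β : ℂ) - 1) = ((β - 1 : ℝ) : ℂ) by push_cast; rfl, Complex.div_ofReal_re]
    have h2 : lam.re / (β - 1) = -(lam.re / (1 - β)) := by
      rw [← neg_sub 1 β, div_neg]
    rw [h1, h2]
    have := div_le_div_of_nonneg_right (Complex.re_le_norm lam) (by linarith : 0 ≤ 1 - β)
    linarith
  have htail' := (abs_le.mp ((Complex.abs_re_le_norm _).trans htail)).1
  rw [← hsplit, Complex.add_re, Complex.add_re]
  have h6 : ‖lam‖ * (2 - β) ^ M / (1 - β) =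
      ‖lam‖ * (((2 - β) ^ M - 1) / (1 - β)) + ‖lam‖ / (1 - β) := by
    field_simp
    ring
  rw [h6]
  linarith

/-- Choosing the length of the Taylor expansion optimally. -/
lemma exists_nat_choice {D : ℝ} (hD : 1 ≤ D) :
    ∃ M : ℕ, 1 ≤ M ∧ D * (27 / 32) ^ M * (32 / 5) ≤ 1 / 2 ∧
      ∀ δ : ℝ, 0 ≤ δ → δ ≤ 1 / 8 → (1 + δ) ^ M ≤ 39 * D ^ (6 * δ) := by
  set y := Real.log (64 * D / 5) with hy
  have hy0 : 0 < y := Real.log_pos (by linarith)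
  have hexpy : Real.exp y = 64 * D / 5 := Real.exp_log (by linarith)
  refine ⟨⌈6 * y⌉₊, Nat.one_le_ceil_iff.mpr (by linarith), ?_, fun δ hδ hδ8 => ?_⟩
  · have h1 : (27 / 32 : ℝ) ≤ Real.exp (-(1 / 6)) := by
      have h2 : Real.exp (1 / 6) ≤ 32 / 27 := by
        refine le_of_pow_le_pow_left₀ (n := 6) (by norm_num) (by norm_num) ?_
        rw [← Real.exp_nat_mul]
        norm_num
        exact Real.exp_one_lt_d9.le.trans (by norm_num)
      rw [Real.exp_neg, show (27 / 32 : ℝ) = (32 / 27)⁻¹ by norm_num]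
      exact inv_anti₀ (Real.exp_pos _) h2
    have h3 : (27 / 32 : ℝ) ^ ⌈6 * y⌉₊ ≤ Real.exp (-y) := by
      refine (pow_le_pow_left₀ (by norm_num) h1 _).trans ?_
      rw [← Real.exp_nat_mul, Real.exp_le_exp]
      linarith [Nat.le_ceil (6 * y)]
    rw [Real.exp_neg, hexpy] at h3
    calc D * (27 / 32) ^ ⌈6 * y⌉₊ * (32 / 5) ≤ D * (64 * D / 5)⁻¹ * (32 / 5) := by gcongr
      _ = 1 / 2 := by
        have : D ≠ 0 := by linarith
        field_simp
        norm_num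
  · have h1 : (1 + δ) ^ ⌈6 * y⌉₊ ≤ Real.exp (1 + 6 * δ * y) := by
      refine (pow_le_pow_left₀ (by linarith) (by linarith [Real.add_one_le_exp δ] :
        1 + δ ≤ Real.exp δ) _).trans ?_
      rw [← Real.exp_nat_mul, Real.exp_le_exp]
      have := (Nat.ceil_lt_add_one (by linarith : 0 ≤ 6 * y)).le
      nlinarith
    refine h1.trans ?_
    rw [Real.exp_add, mul_comm (6 * δ) y, Real.exp_mul, hexpy, mul_div_right_comm,
      Real.mul_rpow (by norm_num) (by linarith), ← mul_assoc]
    gcongr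
    calc Real.exp 1 * (64 / 5) ^ (6 * δ) ≤ 3 * (64 / 5) ^ (1 : ℝ) := by
          gcongr
          · exact Real.exp_one_lt_d9.le.trans (by norm_num)
          · norm_num
          · linarith
      _ ≤ 39 := by norm_num

/-- **Estermann's inequality.** If `ζ P` is an `L`-series with nonnegative coefficients, then a
small value of `P 1` forces `ζ P` to be positive slightly to the left of `1`. -/
theorem exists_half_sub_le_re_zeta_mul :
    ∃ K : ℝ, 0 < K ∧ ∀ (P : ℂ → ℂ) (a : ℕ → ℂ) (B : ℝ), Differentiable ℂ P → 0 ≤ a → a 1 = 1 →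
      LSeries.abscissaOfAbsConv a ≤ 1 →
      (∀ s : ℂ, 1 < s.re → LSeries a s = riemannZeta s * P s) → 1 ≤ B →
      (∀ s ∈ Metric.sphere (2 : ℂ) (4 / 3), ‖P s‖ ≤ B) → ‖P 1‖ ≤ B →
      ∀ β : ℝ, 7 / 8 ≤ β → β < 1 →
        1 / 2 - ‖P 1‖ * (K * B ^ (6 * (1 - β))) / (1 - β) ≤ (riemannZeta β * P β).re := by
  obtain ⟨Z, hZ⟩ := (isCompact_sphere (2 : ℂ) (4 / 3)).exists_bound_of_continuousOn
    differentiable_zetaOne.continuous.continuousOn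
  have hZ0 : 0 ≤ Z := (norm_nonneg _).trans (hZ (2 + (4 / 3 : ℝ)) (by
    simp))
  set W := 3 * (Z + 1) with hW
  refine ⟨39 * W, by positivity, fun P a B hP ha ha1 habs hF hB1 hB hB' β hβ hβ1 => ?_⟩
  have hD : ∀ s ∈ Metric.sphere (2 : ℂ) (4 / 3), ‖dslope (fun s => zetaOne s * P s) 1 s‖ ≤ W * B := by
    intro s hs
    have hn : ‖s - 2‖ = 4 / 3 := mem_sphere_iff_norm.mp hs
    have h1 : 1 / 3 ≤ ‖s - 1‖ := by
      have := norm_sub_norm_le (s - 2) (-1)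
      rw [hn, norm_neg, norm_one, show s - 2 - -1 = s - 1 by ring] at this
      linarith
    have hs1 : s ≠ 1 := fun h => by rw [h] at h1; norm_num at h1
    rw [dslope_of_ne _ hs1, slope_def_field, zetaOne_one, one_mul, norm_div]
    rw [div_le_iff₀ (by linarith)]
    calc ‖zetaOne s * P s - P 1‖ ≤ Z * B + B := by
          refine (norm_sub_le _ _).trans (add_le_add ?_ hB')
          rw [norm_mul]
          exact mul_le_mul (hZ s hs) (hB s hs) (norm_nonneg _) hZ0
      _ = W * B * (1 / 3) := by rw [hW]; ring
      _ ≤ W * B * ‖s - 1‖ := by gcongr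
  obtain ⟨f, hf, hf0, hfD, hfS⟩ := exists_taylor_coeff hP ha ha1 habs hF hD
  have hW1 : 1 ≤ W := by rw [hW]; linarith
  obtain ⟨M, hM1, hM2, hM3⟩ := exists_nat_choice (one_le_mul_of_one_le_of_one_le hW1 hB1)
  have key := one_sub_le_re_of_taylor hf hf0 hfD hβ hβ1 (hfS β) M hM1
  have hβne : (β : ℂ) ≠ 1 := by exact_mod_cast hβ1.ne
  have hβ' : (β : ℂ) - 1 ≠ 0 := sub_ne_zero.mpr hβne
  have hval : dslope (fun s => zetaOne s * P s) 1 β + P 1 / ((β : ℂ) - 1) = riemannZeta β * P β := by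
    rw [dslope_of_ne _ hβne, slope_def_field, zetaOne_one, one_mul, zetaOne_of_ne hβne]
    field_simp
    ring
  rw [hval] at key
  have h3 := hM3 (1 - β) (by linarith) (by linarith)
  rw [show 1 + (1 - β) = 2 - β by ring] at h3
  have h4 : (W * B) ^ (6 * (1 - β)) ≤ W * B ^ (6 * (1 - β)) := by
    rw [Real.mul_rpow (by linarith) (by linarith)]
    gcongr
    calc W ^ (6 * (1 - β)) ≤ W ^ (1 : ℝ) := Real.rpow_le_rpow_of_exponent_le hW1 (by linarith)
      _ = W := Real.rpow_one W
  have h5 : ‖P 1‖ * (2 - β) ^ M / (1 - β) ≤ ‖P 1‖ * (39 * W * B ^ (6 * (1 - β))) / (1 - β) := by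
    have : 0 ≤ 1 - β := by linarith
    gcongr
    linarith
  linarith

end SiegelCore

section Siegel

open Complex DirichletCharacter
open scoped ComplexOrder

/-- A Dirichlet character viewed as an arithmetic function. -/
noncomputable def charArith {N : ℕ} (χ : DirichletCharacter ℂ N) : ArithmeticFunction ℂ :=
  toArithmeticFunction (χ ·)

/-- Multiplication by the logarithm, a derivation of the ring of arithmetic functions. -/
noncomputable def logDerivation (f : ArithmeticFunction ℂ) : ArithmeticFunction ℂ :=
  ⟨fun n => f n * (Real.log n : ℂ), by simp⟩

/-- The twist of the von Mangoldt function by a Dirichlet character. -/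
noncomputable def charMangoldt {N : ℕ} (χ : DirichletCharacter ℂ N) : ArithmeticFunction ℂ :=
  ⟨fun n => χ n * (Λ n : ℂ), by simp⟩

lemma logDerivation_apply (f : ArithmeticFunction ℂ) (n : ℕ) :
    logDerivation f n = f n * (Real.log n : ℂ) := rfl

lemma charMangoldt_apply {N : ℕ} (χ : DirichletCharacter ℂ N) (n : ℕ) :
    charMangoldt χ n = χ n * (Λ n : ℂ) := rfl

lemma charArith_apply {N : ℕ} (χ : DirichletCharacter ℂ N) {n : ℕ} (hn : n ≠ 0) :
    charArith χ n = χ n := by simp [charArith, toArithmeticFunction, hn]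

lemma logDerivation_mul (f g : ArithmeticFunction ℂ) :
    logDerivation (f * g) = logDerivation f * g + f * logDerivation g := by
  ext n
  simp only [logDerivation_apply, ArithmeticFunction.add_apply, ArithmeticFunction.mul_apply,
    Finset.sum_mul, ← Finset.sum_add_distrib]
  refine Finset.sum_congr rfl fun p hp => ?_
  obtain ⟨h1, h2⟩ := Nat.mem_divisorsAntidiagonal.mp hp
  have h3 : p.1 ≠ 0 ∧ p.2 ≠ 0 := by
    rw [← h1] at h2; exact ⟨left_ne_zero_of_mul h2, right_ne_zero_of_mul h2⟩
  rw [← h1, Nat.cast_mul, Real.log_mul (by exact_mod_cast h3.1) (by exact_mod_cast h3.2)]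
  push_cast
  ring

lemma logDerivation_charArith {N : ℕ} (χ : DirichletCharacter ℂ N) :
    logDerivation (charArith χ) = charMangoldt χ * charArith χ := by
  ext n
  rcases eq_or_ne n 0 with rfl | hn
  · simp
  have h1 : ∀ p ∈ n.divisorsAntidiagonal,
      charMangoldt χ p.1 * charArith χ p.2 = χ n * (Λ p.1 : ℂ) := by
    intro p hp
    obtain ⟨h1, h2⟩ := Nat.mem_divisorsAntidiagonal.mp hp
    rw [charMangoldt_apply, charArith_apply χ (fun h => h2 (by rw [← h1, h, mul_zero])), ← h1,
      Nat.cast_mul, map_mul]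
    ring
  rw [logDerivation_apply, charArith_apply χ hn, ArithmeticFunction.mul_apply,
    Finset.sum_congr rfl h1, ← Finset.mul_sum,
    Nat.sum_divisorsAntidiagonal (fun d _ => ((Λ d : ℝ) : ℂ)), ← ArithmeticFunction.vonMangoldt_sum]
  push_cast
  rfl

lemma nonneg_of_logDerivation_eq {a b : ArithmeticFunction ℂ} (h : logDerivation a = b * a) (ha1 : 0 ≤ a 1)
    (hb : ∀ n, 0 ≤ b n) (hb1 : b 1 = 0) (n : ℕ) : 0 ≤ a n := by
  induction n using Nat.strong_induction_on with
  | _ n ih =>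
    rcases Nat.lt_or_ge n 2 with hn | hn
    · interval_cases n
      · simp
      · exact ha1
    have h1 : a n * (Real.log n : ℂ) = ∑ p ∈ n.divisorsAntidiagonal, b p.1 * a p.2 := by
      rw [← logDerivation_apply, h, ArithmeticFunction.mul_apply]
    have hlog : 0 < Real.log n := Real.log_pos (by exact_mod_cast hn)
    have h2 : 0 ≤ ∑ p ∈ n.divisorsAntidiagonal, b p.1 * a p.2 := by
      refine Finset.sum_nonneg fun p hp => ?_
      obtain ⟨h3, h4⟩ := Nat.mem_divisorsAntidiagonal.mp hp
      rcases eq_or_ne p.1 1 with h5 | h5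
      · rw [h5, hb1, zero_mul]
      · refine mul_nonneg (hb _) (ih _ ?_)
        have h6 : p.1 ≠ 0 := fun h => h4 (by rw [← h3, h, zero_mul])
        have h7 : p.2 ≠ 0 := fun h => h4 (by rw [← h3, h, mul_zero])
        rw [← h3]
        exact lt_mul_of_one_lt_left (Nat.pos_of_ne_zero h7) (by omega)
    have h8 : a n = ((Real.log n)⁻¹ : ℝ) * ∑ p ∈ n.divisorsAntidiagonal, b p.1 * a p.2 := by
      rw [← h1]
      have : (Real.log n : ℂ) ≠ 0 := by exact_mod_cast hlog.ne'
      rw [Complex.ofReal_inv, mul_comm (a n), inv_mul_cancel_left₀ this]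
    rw [h8]
    exact mul_nonneg (by exact_mod_cast (inv_pos.mpr hlog).le) h2

/-- The coefficients of `ζ(s) L(s, χ) L(s, ψ) L(s, χψ)`. -/
noncomputable def quadCoeff {N : ℕ} (χ ψ : DirichletCharacter ℂ N) : ArithmeticFunction ℂ :=
  charArith (1 : DirichletCharacter ℂ 1) * charArith χ * (charArith ψ * charArith (χ * ψ))

lemma charArith_one {N : ℕ} (χ : DirichletCharacter ℂ N) : charArith χ 1 = 1 := by
  simp [charArith_apply]

lemma quadCoeff_one {N : ℕ} (χ ψ : DirichletCharacter ℂ N) : quadCoeff χ ψ 1 = 1 := by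
  simp [quadCoeff, charArith_one]

lemma quadCoeff_nonneg {N : ℕ} {χ ψ : DirichletCharacter ℂ N} (hχ : χ ^ 2 = 1) (hψ : ψ ^ 2 = 1)
    (n : ℕ) : 0 ≤ quadCoeff χ ψ n := by
  refine nonneg_of_logDerivation_eq (b := charMangoldt (1 : DirichletCharacter ℂ 1) + charMangoldt χ +
    charMangoldt ψ + charMangoldt (χ * ψ)) ?_ ?_ (fun n => ?_) ?_ n
  · simp only [quadCoeff, logDerivation_mul, logDerivation_charArith]
    ring
  · rw [quadCoeff_one]; exact zero_le_one
  · simp only [ArithmeticFunction.add_apply, charMangoldt_apply, MulChar.mul_apply]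
    have h1 : (1 : DirichletCharacter ℂ 1) (n : ZMod 1) = 1 :=
      MulChar.one_apply (isUnit_of_subsingleton _)
    have h2 : (0 : ℂ) ≤ (Λ n : ℂ) := by
      exact_mod_cast ArithmeticFunction.vonMangoldt_nonneg
    have h3 : (1 : DirichletCharacter ℂ 1) (n : ZMod 1) * (Λ n : ℂ) + χ n * (Λ n : ℂ) +
        ψ n * (Λ n : ℂ) + χ n * ψ n * (Λ n : ℂ) = ((1 + χ n) * (1 + ψ n)) * (Λ n : ℂ) := by
      rw [h1]; ring
    rw [h3]
    refine mul_nonneg (mul_nonneg ?_ ?_) h2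
    · rcases MulChar.isQuadratic_iff_sq_eq_one.mpr hχ n with h | h | h <;> rw [h] <;> norm_num
    · rcases MulChar.isQuadratic_iff_sq_eq_one.mpr hψ n with h | h | h <;> rw [h] <;> norm_num
  · simp [charMangoldt_apply]

lemma LSeries_charArith {N : ℕ} (χ : DirichletCharacter ℂ N) (s : ℂ) :
    LSeries (charArith χ ·) s = LSeries (χ ·) s :=
  LSeries_congr (fun {_} hn => charArith_apply χ hn) s

lemma LSeriesSummable_charArith {N : ℕ} (χ : DirichletCharacter ℂ N) {s : ℂ} (hs : 1 < s.re) :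
    LSeriesSummable (charArith χ ·) s :=
  (LSeriesSummable_congr s fun {_} hn => charArith_apply χ hn).mpr
    (LSeriesSummable_of_one_lt_re χ hs)

lemma LSeriesSummable_quadCoeff {N : ℕ} (χ ψ : DirichletCharacter ℂ N) {s : ℂ} (hs : 1 < s.re) :
    LSeriesSummable (quadCoeff χ ψ ·) s :=
  ArithmeticFunction.LSeriesSummable_mul
    (ArithmeticFunction.LSeriesSummable_mul (LSeriesSummable_charArith _ hs)
      (LSeriesSummable_charArith _ hs))
    (ArithmeticFunction.LSeriesSummable_mul (LSeriesSummable_charArith _ hs)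
      (LSeriesSummable_charArith _ hs))

lemma LSeries_quadCoeff {N : ℕ} [NeZero N] (χ ψ : DirichletCharacter ℂ N) {s : ℂ} (hs : 1 < s.re) :
    LSeries (quadCoeff χ ψ ·) s =
      riemannZeta s * (χ.LFunction s * ψ.LFunction s * (χ * ψ).LFunction s) := by
  have h := fun {M : ℕ} (χ : DirichletCharacter ℂ M) => LSeriesSummable_charArith χ hs
  rw [quadCoeff, ArithmeticFunction.LSeries_mul' (ArithmeticFunction.LSeriesSummable_mul (h _) (h _))
    (ArithmeticFunction.LSeriesSummable_mul (h _) (h _)),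
    ArithmeticFunction.LSeries_mul' (h _) (h _), ArithmeticFunction.LSeries_mul' (h _) (h _)]
  simp only [LSeries_charArith]
  rw [← LFunction_eq_LSeries _ hs, ← LFunction_eq_LSeries _ hs, ← LFunction_eq_LSeries _ hs,
    ← LFunction_eq_LSeries _ hs, LFunction_modOne_eq]
  ring

lemma abscissaOfAbsConv_le_one {a : ℕ → ℂ} (h : ∀ s : ℂ, 1 < s.re → LSeriesSummable a s) :
    LSeries.abscissaOfAbsConv a ≤ 1 :=
  LSeries.abscissaOfAbsConv_le_of_forall_lt_LSeriesSummable fun y hy => h y (by simpa using hy)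

/-- For a real character `χ`, `L(σ, χ)` is real. -/
lemma LFunction_im_eq_zero {q : ℕ} [NeZero q] {χ : DirichletCharacter ℂ q} (hχ : χ ≠ 1)
    (hχ2 : χ ^ 2 = 1) {σ : ℝ} (hσ : 0 < σ) : (χ.LFunction σ).im = 0 := by
  have h := Complex.hasSum_im (hasSum_abelTerm hχ (s := σ) (by simpa using hσ))
  have h0 : ∀ n, (abelTerm χ σ n).im = 0 := by
    intro n
    have h1 : (charSum χ (n + 1)).im = 0 := by
      rw [charSum, Complex.im_sum]
      refine Finset.sum_eq_zero fun k _ => ?_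
      rcases MulChar.isQuadratic_iff_sq_eq_one.mpr hχ2 ((k + 1 : ℕ) : ZMod q) with h | h | h <;>
        push_cast at h <;> simp [h]
    have h2 : ∀ r : ℝ, 0 ≤ r → ((r : ℂ) ^ (-(σ : ℂ))).im = 0 := fun r hr => by
      rw [← Complex.ofReal_neg, ← Complex.ofReal_cpow hr, Complex.ofReal_im]
    rw [abelTerm, Complex.mul_im, Complex.sub_im, h1, h2 _ (by positivity), h2 _ (by positivity)]
    simp
  simp only [h0] at h
  exact h.unique hasSum_zero

/-- The coefficients of `ζ(s) L(s, χ)`. -/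
noncomputable def linCoeff {N : ℕ} (χ : DirichletCharacter ℂ N) : ArithmeticFunction ℂ :=
  charArith (1 : DirichletCharacter ℂ 1) * charArith χ

lemma linCoeff_one {N : ℕ} (χ : DirichletCharacter ℂ N) : linCoeff χ 1 = 1 := by
  simp [linCoeff, charArith_one]

lemma linCoeff_nonneg {N : ℕ} {χ : DirichletCharacter ℂ N} (hχ : χ ^ 2 = 1) (n : ℕ) :
    0 ≤ linCoeff χ n := by
  refine nonneg_of_logDerivation_eq (b := charMangoldt (1 : DirichletCharacter ℂ 1) +
    charMangoldt χ) ?_ ?_ (fun n => ?_) ?_ n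
  · simp only [linCoeff, logDerivation_mul, logDerivation_charArith]
    ring
  · rw [linCoeff_one]; exact zero_le_one
  · simp only [ArithmeticFunction.add_apply, charMangoldt_apply]
    have h1 : (1 : DirichletCharacter ℂ 1) (n : ZMod 1) = 1 :=
      MulChar.one_apply (isUnit_of_subsingleton _)
    have h2 : (0 : ℂ) ≤ (Λ n : ℂ) := by
      exact_mod_cast ArithmeticFunction.vonMangoldt_nonneg
    rw [h1, ← add_mul]
    refine mul_nonneg ?_ h2
    rcases MulChar.isQuadratic_iff_sq_eq_one.mpr hχ n with h | h | h <;> rw [h] <;> norm_num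
  · simp [charMangoldt_apply]

lemma LSeriesSummable_linCoeff {N : ℕ} (χ : DirichletCharacter ℂ N) {s : ℂ} (hs : 1 < s.re) :
    LSeriesSummable (linCoeff χ ·) s :=
  ArithmeticFunction.LSeriesSummable_mul (LSeriesSummable_charArith _ hs)
    (LSeriesSummable_charArith _ hs)

lemma LSeries_linCoeff {N : ℕ} [NeZero N] (χ : DirichletCharacter ℂ N) {s : ℂ} (hs : 1 < s.re) :
    LSeries (linCoeff χ ·) s = riemannZeta s * χ.LFunction s := by
  rw [linCoeff, ArithmeticFunction.LSeries_mul' (LSeriesSummable_charArith _ hs)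
    (LSeriesSummable_charArith _ hs)]
  simp only [LSeries_charArith]
  rw [← LFunction_eq_LSeries _ hs, ← LFunction_eq_LSeries _ hs, LFunction_modOne_eq]

lemma re_LFunction_two_pos {q : ℕ} [NeZero q] {χ : DirichletCharacter ℂ q}
    (hχ2 : χ ^ 2 = 1) : 0 < (χ.LFunction 2).re := by
  have h := LSeries.positive (a := (linCoeff χ ·)) (fun n => linCoeff_nonneg hχ2 n)
    (by rw [linCoeff_one]; exact zero_lt_one) (x := 2)
    ((abscissaOfAbsConv_le_one fun s hs => LSeriesSummable_linCoeff χ hs).trans_lt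
      (by exact_mod_cast one_lt_two))
  simp only [Complex.ofReal_ofNat] at h
  rw [LSeries_linCoeff χ (by simp)] at h
  have h4 : (0 : ℂ) < riemannZeta (2 : ℝ) := riemannZeta_pos_of_one_lt (by norm_num)
  simp only [Complex.ofReal_ofNat] at h4
  exact (Complex.lt_def.mp (pos_of_mul_pos_right h h4.le)).1

lemma re_LFunction_pos {q : ℕ} [NeZero q] {χ : DirichletCharacter ℂ q} (hχ : χ ≠ 1)
    (hχ2 : χ ^ 2 = 1) {β : ℝ} (hβ0 : 0 < β) (hβ1 : β < 1)
    (h : ∀ σ : ℝ, β ≤ σ → σ < 1 → χ.LFunction σ ≠ 0) : 0 < (χ.LFunction β).re := by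
  by_contra! hneg
  have hcont : Continuous fun σ : ℝ => (χ.LFunction σ).re :=
    continuous_re.comp ((differentiable_LFunction hχ).continuous.comp continuous_ofReal)
  obtain ⟨σ, hσ, h0⟩ := intermediate_value_Icc (by linarith : β ≤ 2) hcont.continuousOn
    (show (0 : ℝ) ∈ Set.Icc (χ.LFunction β).re (χ.LFunction (2 : ℝ)).re from
      ⟨hneg, by simpa using (re_LFunction_two_pos hχ2).le⟩)
  have hz : χ.LFunction σ = 0 :=
    Complex.ext (by simpa using h0) (LFunction_im_eq_zero hχ hχ2 (by linarith [hσ.1]))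
  rcases lt_or_ge σ 1 with h1 | h1
  · exact h σ hσ.1 h1 hz
  · exact LFunction_ne_zero_of_one_le_re χ (Or.inl hχ) (by simpa using h1) hz

end Siegel

section SiegelTheorem

open Complex DirichletCharacter

lemma exists_norm_LFunction_le_near :
    ∃ C : ℝ, 1 ≤ C ∧ ∀ (q : ℕ) [NeZero q] (χ : DirichletCharacter ℂ q), χ ≠ 1 → ∀ s : ℂ,
      1 / 2 ≤ s.re → s.re ≤ 4 → |s.im| ≤ 2 → ‖χ.LFunction s‖ ≤ C * q := by
  obtain ⟨C, hC, h⟩ := exists_norm_LFunction_le (ε := 1 / 2) (by norm_num) le_rfl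
  refine ⟨max 1 (4 * C), le_max_left _ _, fun q _ χ hχ s h1 h4 him => ?_⟩
  refine (h q χ hχ s (by linarith) h4).trans ?_
  rw [show (2 * (1 / 2) : ℝ) = 1 by norm_num, Real.rpow_one]
  calc C * (q * (|s.im| + 2)) ≤ C * (q * 4) := by gcongr; linarith
    _ = (4 * C) * q := by ring
    _ ≤ _ := by gcongr; exact le_max_right _ _

lemma mem_sphere_two {s : ℂ} (hs : s ∈ Metric.sphere (2 : ℂ) (4 / 3)) :
    1 / 2 ≤ s.re ∧ s.re ≤ 4 ∧ |s.im| ≤ 2 := by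
  have hn : ‖s - 2‖ = 4 / 3 := mem_sphere_iff_norm.mp hs
  have h1 := abs_le.mp ((Complex.abs_re_le_norm (s - 2)).trans_eq hn)
  have h2 := (Complex.abs_im_le_norm (s - 2)).trans_eq hn
  simp at h1 h2
  refine ⟨by linarith, by linarith, by linarith⟩

lemma exists_re_zeta_neg : ∃ η : ℝ, 0 < η ∧ ∀ σ : ℝ, 1 - η ≤ σ → σ < 1 → (riemannZeta σ).re < 0 := by
  have hcont : Continuous fun σ : ℝ => (zetaOne σ).re :=
    continuous_re.comp (differentiable_zetaOne.continuous.comp continuous_ofReal)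
  have h1 : ∀ᶠ σ : ℝ in nhds 1, 0 < (zetaOne σ).re :=
    hcont.continuousAt.eventually (lt_mem_nhds (by simp [zetaOne_one]))
  obtain ⟨η, hη, h⟩ := Metric.eventually_nhds_iff.mp h1
  refine ⟨η / 2, by positivity, fun σ h2 h3 => ?_⟩
  have h4 : 0 < (zetaOne σ).re := h (by rw [Real.dist_eq, abs_lt]; constructor <;> linarith)
  have h5 : zetaOne σ = ((σ - 1 : ℝ) : ℂ) * riemannZeta σ := by
    rw [zetaOne_of_ne (by exact_mod_cast h3.ne)]; push_cast; rfl
  rw [h5, Complex.re_ofReal_mul] at h4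
  by_contra! h6
  nlinarith

lemma exists_log_le_rpow {ε : ℝ} (hε : 0 < ε) :
    ∃ C : ℝ, 0 < C ∧ ∀ n : ℕ, n ≠ 0 → 2 * Real.log n + 1 ≤ C * (n : ℝ) ^ ε := by
  refine ⟨2 / ε + 1, by positivity, fun n hn => ?_⟩
  have h1 := Real.log_le_rpow_div (Nat.cast_nonneg n) hε
  have h2 : (1 : ℝ) ≤ (n : ℝ) ^ ε :=
    Real.one_le_rpow (by exact_mod_cast Nat.one_le_iff_ne_zero.mpr hn) hε.le
  calc 2 * Real.log n + 1 ≤ 2 * ((n : ℝ) ^ ε / ε) + (n : ℝ) ^ ε := by linarith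
    _ = _ := by ring

lemma norm_LFunction_changeLevel_one_le {M N : ℕ} [NeZero M] [NeZero N] (h : M ∣ N)
    {χ : DirichletCharacter ℂ M} (hχ : χ ≠ 1) :
    ‖(changeLevel h χ).LFunction 1‖ ≤ ‖χ.LFunction 1‖ * (2 * Real.log N + 1) := by
  rw [LFunction_changeLevel h χ (Or.inl hχ), norm_mul]
  gcongr
  rw [norm_prod]
  refine (Finset.prod_le_prod (fun _ _ => norm_nonneg _) fun p hp => ?_).trans
    ((prod_one_add_inv_le N).trans (prod_primeFactors_le N (NeZero.ne N)))
  refine (norm_sub_le _ _).trans ?_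
  rw [norm_one, norm_mul, cpow_neg, cpow_one, norm_inv, Complex.norm_natCast]
  gcongr
  exact mul_le_of_le_one_left (by positivity) (χ.norm_le_one _)

/-- The case where no real `L`-function vanishes near `1`. -/
lemma siegel_of_no_zero {η : ℝ} (hη : 0 < η) (hη8 : η ≤ 1 / 8)
    (hζ : (riemannZeta ((1 - η : ℝ) : ℂ)).re < 0)
    (hno : ∀ (q : ℕ) [NeZero q] (χ : DirichletCharacter ℂ q), χ.IsPrimitive → χ ^ 2 = 1 → χ ≠ 1 →
      ∀ σ : ℝ, 1 - η ≤ σ → σ < 1 → χ.LFunction σ ≠ 0) :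
    ∃ c : ℝ, 0 < c ∧ ∀ (q : ℕ) [NeZero q] (χ : DirichletCharacter ℂ q), χ.IsPrimitive → χ ^ 2 = 1 →
      χ ≠ 1 → c * (q : ℝ) ^ (-(6 * η)) ≤ ‖χ.LFunction 1‖ := by
  obtain ⟨K, hK, hcore⟩ := exists_half_sub_le_re_zeta_mul
  obtain ⟨C, hC, hL⟩ := exists_norm_LFunction_le_near
  refine ⟨η / (2 * (K * C ^ (6 * η))), by positivity, fun q _ χ hprim hχ2 hχ => ?_⟩
  have hq : (1 : ℝ) ≤ q := by exact_mod_cast Nat.one_le_iff_ne_zero.mpr (NeZero.ne q)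
  have h := hcore χ.LFunction (linCoeff χ ·) (C * q) (differentiable_LFunction hχ)
    (fun n => linCoeff_nonneg hχ2 n) (linCoeff_one χ)
    (abscissaOfAbsConv_le_one fun s hs => LSeriesSummable_linCoeff χ hs)
    (fun s hs => LSeries_linCoeff χ hs) (one_le_mul_of_one_le_of_one_le hC hq)
    (fun s hs => hL q χ hχ s (mem_sphere_two hs).1 (mem_sphere_two hs).2.1 (mem_sphere_two hs).2.2)
    (hL q χ hχ 1 (by norm_num) (by norm_num) (by norm_num)) (1 - η) (by linarith) (by linarith)
  have hpos := re_LFunction_pos hχ hχ2 (β := 1 - η) (by linarith) (by linarith)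
    (hno q χ hprim hχ2 hχ)
  have hle : (riemannZeta ((1 - η : ℝ) : ℂ) * χ.LFunction ((1 - η : ℝ) : ℂ)).re ≤ 0 := by
    rw [Complex.mul_re, LFunction_im_eq_zero hχ hχ2 (by linarith)]
    nlinarith
  have h1 : 1 / 2 ≤ ‖χ.LFunction 1‖ * (K * (C * q) ^ (6 * η)) / η := by
    rw [sub_sub_cancel] at h
    linarith
  rw [Real.mul_rpow (by linarith) (by linarith), le_div_iff₀ hη] at h1
  have hqe : 0 < (q : ℝ) ^ (6 * η) := by positivity
  rw [Real.rpow_neg (by linarith), div_mul_eq_mul_div, div_le_iff₀ (by positivity),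
    ← div_eq_mul_inv, div_le_iff₀ hqe]
  linarith

/-- The case where some real `L`-function vanishes near `1`. -/
lemma siegel_of_zero {ε η : ℝ} (hε : 0 < ε) (hε1 : ε ≤ 1)
    (hηε : 18 * η ≤ ε / 2) {q₁ : ℕ} [NeZero q₁] {χ₁ : DirichletCharacter ℂ q₁}
    (hprim₁ : χ₁.IsPrimitive) (hχ₁2 : χ₁ ^ 2 = 1) (hχ₁ : χ₁ ≠ 1) {β : ℝ} (hβ : 1 - η ≤ β)
    (hβ1 : β < 1) (hzero : χ₁.LFunction β = 0) :
    ∃ c : ℝ, 0 < c ∧ ∀ (q : ℕ) [NeZero q] (χ : DirichletCharacter ℂ q), χ.IsPrimitive → χ ^ 2 = 1 →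
      χ ≠ 1 → q ≠ q₁ → c * (q : ℝ) ^ (-ε) ≤ ‖χ.LFunction 1‖ := by
  obtain ⟨K, hK, hcore⟩ := exists_half_sub_le_re_zeta_mul
  obtain ⟨C, hC, hL⟩ := exists_norm_LFunction_le_near
  obtain ⟨C₂, hC₂, hL₂⟩ := exists_norm_LFunction_le (ε := ε / 12) (by positivity) (by linarith)
  obtain ⟨C₃, hC₃, hlog⟩ := exists_log_le_rpow (ε := ε / 6) (by positivity)
  have hδ : 0 < 1 - β := by linarith
  set W : ℝ := K * (C ^ (3 : ℕ)) ^ (6 * (1 - β)) * (C₂ * 2) ^ 2 * C₃ with hW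
  have hq₁ : (1 : ℝ) ≤ q₁ := by exact_mod_cast Nat.one_le_iff_ne_zero.mpr (NeZero.ne q₁)
  have hWpos : 0 < W := by positivity
  refine ⟨(1 - β) / (2 * W) * (q₁ : ℝ) ^ (-ε), by positivity, fun q _ χ hprim hχ2 hχ hne => ?_⟩
  have hq : (1 : ℝ) ≤ q := by exact_mod_cast Nat.one_le_iff_ne_zero.mpr (NeZero.ne q)
  set N := q₁ * q with hN
  have hd₁ : q₁ ∣ N := dvd_mul_right _ _
  have hd : q ∣ N := dvd_mul_left _ _
  have hNr : (N : ℝ) = q₁ * q := by rw [hN]; push_cast; rfl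
  have hN1 : (1 : ℝ) ≤ N := by rw [hNr]; exact one_le_mul_of_one_le_of_one_le hq₁ hq
  set ψ₁ := changeLevel hd₁ χ₁ with hψ₁
  set ψ := changeLevel hd χ with hψ
  have h1ne : ψ₁ ≠ 1 := fun h => hχ₁ ((changeLevel_eq_one_iff hd₁).mp h)
  have hψne : ψ ≠ 1 := fun h => hχ ((changeLevel_eq_one_iff hd).mp h)
  have h1sq : ψ₁ ^ 2 = 1 := by rw [hψ₁, ← map_pow, hχ₁2, map_one]
  have hψsq : ψ ^ 2 = 1 := by rw [hψ, ← map_pow, hχ2, map_one]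
  have hprod : ψ₁ * ψ ≠ 1 := by
    intro h
    have h2 : ψ₁ = ψ := by
      have : ψ₁ * ψ * ψ = ψ := by rw [h, one_mul]
      rwa [mul_assoc, ← sq, hψsq, mul_one] at this
    have h3 := congrArg conductor h2
    rw [hψ₁, hψ, conductor_changeLevel, conductor_changeLevel] at h3
    rw [hprim₁, hprim] at h3
    exact hne h3.symm
  set P : ℂ → ℂ := fun s => ψ₁.LFunction s * ψ.LFunction s * (ψ₁ * ψ).LFunction s with hP
  have hPd : Differentiable ℂ P := ((differentiable_LFunction h1ne).mul
    (differentiable_LFunction hψne)).mul (differentiable_LFunction hprod)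
  have hPB : ∀ s : ℂ, 1 / 2 ≤ s.re → s.re ≤ 4 → |s.im| ≤ 2 → ‖P s‖ ≤ (C * N) ^ 3 := by
    intro s h1 h2 h3
    rw [hP, norm_mul, norm_mul, pow_succ, sq]
    gcongr
    · exact hL N _ h1ne s h1 h2 h3
    · exact hL N _ hψne s h1 h2 h3
    · exact hL N _ hprod s h1 h2 h3
  have h := hcore P (quadCoeff ψ₁ ψ ·) ((C * N) ^ 3) hPd
    (fun n => quadCoeff_nonneg h1sq hψsq n) (quadCoeff_one ψ₁ ψ)
    (abscissaOfAbsConv_le_one fun s hs => LSeriesSummable_quadCoeff ψ₁ ψ hs)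
    (fun s hs => LSeries_quadCoeff ψ₁ ψ hs)
    (one_le_pow₀ (one_le_mul_of_one_le_of_one_le hC hN1))
    (fun s hs => hPB s (mem_sphere_two hs).1 (mem_sphere_two hs).2.1 (mem_sphere_two hs).2.2)
    (hPB 1 (by norm_num) (by norm_num) (by norm_num)) β (by linarith) hβ1
  have hPβ : P β = 0 := by
    simp only [hP]
    rw [hψ₁, LFunction_changeLevel hd₁ χ₁ (Or.inl hχ₁), hzero]
    ring
  rw [hPβ, mul_zero, Complex.zero_re] at h
  have hP1 : ‖P 1‖ ≤ (C₂ * 2) ^ 2 * C₃ * (N : ℝ) ^ (ε / 2) * ‖χ.LFunction 1‖ := by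
    have e1 : ∀ θ : DirichletCharacter ℂ N, θ ≠ 1 → ‖θ.LFunction 1‖ ≤ C₂ * 2 * (N : ℝ) ^ (ε / 6) := by
      intro θ hθ
      refine (hL₂ N θ hθ 1 (by simp; positivity) (by norm_num)).trans ?_
      rw [Complex.one_im, abs_zero, zero_add, show 2 * (ε / 12) = ε / 6 by ring,
        Real.mul_rpow (by linarith) (by norm_num)]
      have : (2 : ℝ) ^ (ε / 6) ≤ 2 ^ (1 : ℝ) :=
        Real.rpow_le_rpow_of_exponent_le (by norm_num) (by linarith)
      rw [Real.rpow_one] at this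
      calc C₂ * ((N : ℝ) ^ (ε / 6) * 2 ^ (ε / 6)) ≤ C₂ * ((N : ℝ) ^ (ε / 6) * 2) := by gcongr
        _ = _ := by ring
    have e2 : ‖ψ.LFunction 1‖ ≤ ‖χ.LFunction 1‖ * (C₃ * (N : ℝ) ^ (ε / 6)) :=
      (norm_LFunction_changeLevel_one_le hd hχ).trans
        (mul_le_mul_of_nonneg_left (hlog N (NeZero.ne N)) (norm_nonneg _))
    calc ‖P 1‖ ≤ (C₂ * 2 * (N : ℝ) ^ (ε / 6)) * (‖χ.LFunction 1‖ * (C₃ * (N : ℝ) ^ (ε / 6))) *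
          (C₂ * 2 * (N : ℝ) ^ (ε / 6)) := by
          simp only [hP]
          rw [norm_mul, norm_mul]
          gcongr
          · exact e1 _ h1ne
          · exact e1 _ hprod
      _ = (C₂ * 2) ^ 2 * C₃ * ((N : ℝ) ^ (ε / 6) * (N : ℝ) ^ (ε / 6) * (N : ℝ) ^ (ε / 6)) *
          ‖χ.LFunction 1‖ := by ring
      _ = _ := by
          rw [← Real.rpow_add (by linarith), ← Real.rpow_add (by linarith)]
          congr 3
          ring
  have hB : ((C * N) ^ 3) ^ (6 * (1 - β)) ≤ (C ^ 3) ^ (6 * (1 - β)) * (N : ℝ) ^ (ε / 2) := by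
    rw [mul_pow, Real.mul_rpow (by positivity) (by positivity)]
    gcongr
    rw [← Real.rpow_natCast, ← Real.rpow_mul (by linarith)]
    exact Real.rpow_le_rpow_of_exponent_le hN1 (by push_cast; linarith)
  have hfin : 1 / 2 ≤ W * (N : ℝ) ^ ε * ‖χ.LFunction 1‖ / (1 - β) := by
    refine (by linarith : 1 / 2 ≤ ‖P 1‖ * (K * ((C * N) ^ 3) ^ (6 * (1 - β))) / (1 - β)).trans ?_
    refine div_le_div_of_nonneg_right ?_ hδ.le
    calc ‖P 1‖ * (K * ((C * N) ^ 3) ^ (6 * (1 - β)))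
        ≤ ((C₂ * 2) ^ 2 * C₃ * (N : ℝ) ^ (ε / 2) * ‖χ.LFunction 1‖) *
          (K * ((C ^ 3) ^ (6 * (1 - β)) * (N : ℝ) ^ (ε / 2))) := by gcongr
      _ = W * ((N : ℝ) ^ (ε / 2) * (N : ℝ) ^ (ε / 2)) * ‖χ.LFunction 1‖ := by rw [hW]; ring
      _ = _ := by
          rw [← Real.rpow_add (by linarith), add_halves]
  rw [le_div_iff₀ hδ] at hfin
  have hNe : 0 < (N : ℝ) ^ ε := by positivity
  rw [mul_assoc, ← Real.mul_rpow (by linarith) (by linarith), ← hNr, Real.rpow_neg (by linarith),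
    div_mul_eq_mul_div, div_le_iff₀ (by positivity), ← div_eq_mul_inv, div_le_iff₀ hNe]
  linarith

/-- **Siegel's theorem.** -/
theorem exists_le_norm_LFunction_one {ε : ℝ} (hε : 0 < ε) :
    ∃ c : ℝ, 0 < c ∧ ∀ (q : ℕ) [NeZero q] (χ : DirichletCharacter ℂ q), χ.IsPrimitive → χ ^ 2 = 1 →
      χ ≠ 1 → c * (q : ℝ) ^ (-ε) ≤ ‖χ.LFunction 1‖ := by
  obtain ⟨η₀, hη₀, hζ⟩ := exists_re_zeta_neg
  set ε₁ := min ε 1 with hε₁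
  have hε₁0 : 0 < ε₁ := lt_min hε one_pos
  have hmono : ∀ (q : ℕ) [NeZero q], (q : ℝ) ^ (-ε) ≤ (q : ℝ) ^ (-ε₁) := fun q _ =>
    Real.rpow_le_rpow_of_exponent_le
      (by exact_mod_cast Nat.one_le_iff_ne_zero.mpr (NeZero.ne q)) (neg_le_neg (min_le_left _ _))
  set η := min η₀ (ε₁ / 36) with hη
  have hη0 : 0 < η := lt_min hη₀ (by positivity)
  have hηε : η ≤ ε₁ / 36 := min_le_right _ _
  have hε₁1 : ε₁ ≤ 1 := min_le_right _ _
  by_cases hno : ∀ (q : ℕ) [NeZero q] (χ : DirichletCharacter ℂ q), χ.IsPrimitive → χ ^ 2 = 1 →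
      χ ≠ 1 → ∀ σ : ℝ, 1 - η ≤ σ → σ < 1 → χ.LFunction σ ≠ 0
  · obtain ⟨c, hc, h⟩ := siegel_of_no_zero hη0 (by linarith)
      (hζ _ (by linarith [min_le_left η₀ (ε₁ / 36)]) (by linarith)) hno
    refine ⟨c, hc, fun q _ χ h1 h2 h3 => le_trans ?_ (h q χ h1 h2 h3)⟩
    refine mul_le_mul_of_nonneg_left ?_ hc.le
    refine (hmono q).trans (Real.rpow_le_rpow_of_exponent_le
      (by exact_mod_cast Nat.one_le_iff_ne_zero.mpr (NeZero.ne q)) (by linarith))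
  · push Not at hno
    obtain ⟨q₁, _, χ₁, hprim₁, hsq₁, hχ₁, β, hβ, hβ1, hzero⟩ := hno
    obtain ⟨c, hc, h⟩ := siegel_of_zero hε₁0 hε₁1 (by linarith) hprim₁ hsq₁ hχ₁ hβ hβ1
      hzero
    obtain ⟨c', hc', h'⟩ : ∃ c' : ℝ, 0 < c' ∧ ∀ χ : DirichletCharacter ℂ q₁, χ ≠ 1 →
        c' ≤ ‖χ.LFunction 1‖ := by
      have hfin : Finite {χ : DirichletCharacter ℂ q₁ // χ ≠ 1} := inferInstance
      have : Nonempty {χ : DirichletCharacter ℂ q₁ // χ ≠ 1} := ⟨⟨χ₁, hχ₁⟩⟩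
      obtain ⟨χ₀, h₀⟩ := Finite.exists_min
        (fun χ : {χ : DirichletCharacter ℂ q₁ // χ ≠ 1} => ‖χ.1.LFunction 1‖)
      exact ⟨_, norm_pos_iff.mpr (LFunction_apply_one_ne_zero χ₀.2), fun χ hχ => h₀ ⟨χ, hχ⟩⟩
    refine ⟨min c c', lt_min hc hc', fun q _ χ h1 h2 h3 => ?_⟩
    rcases eq_or_ne q q₁ with rfl | hne
    · refine le_trans ?_ (h' χ h3)
      have : (q : ℝ) ^ (-ε) ≤ 1 := Real.rpow_le_one_of_one_le_of_nonpos
        (by exact_mod_cast Nat.one_le_iff_ne_zero.mpr (NeZero.ne q)) (by linarith)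
      calc min c c' * (q : ℝ) ^ (-ε) ≤ c' * 1 := by
            gcongr
            exact min_le_right _ _
        _ = c' := mul_one _
    · refine le_trans ?_ (h q χ h1 h2 h3 hne)
      exact mul_le_mul (min_le_left _ _) (hmono q) (by positivity) hc.le

end SiegelTheorem

section LowerBounds

open Complex DirichletCharacter

/-- The size parameter `(Q (|Im s| + 2)) ^ (2 η)` in which bounds for `L`-functions are stated. -/
noncomputable def growth (η Q : ℝ) (s : ℂ) : ℝ := (Q * (|s.im| + 2)) ^ (2 * η)

lemma one_le_growth {η Q : ℝ} (hη : 0 < η) (hQ : 1 ≤ Q) (s : ℂ) : 1 ≤ growth η Q s :=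
  Real.one_le_rpow (by nlinarith [abs_nonneg s.im]) (by positivity)

lemma growth_le_two_mul {η Q : ℝ} (hη : 0 < η) (hη2 : η ≤ 1 / 2) (hQ : 1 ≤ Q) {s w : ℂ}
    (h : |s.im| ≤ 2 * |w.im| + 2) : growth η Q s ≤ 2 * growth η Q w := by
  unfold growth
  calc (Q * (|s.im| + 2)) ^ (2 * η) ≤ (2 * (Q * (|w.im| + 2))) ^ (2 * η) := by
        refine Real.rpow_le_rpow (by positivity) ?_ (by positivity)
        nlinarith
    _ = 2 ^ (2 * η) * (Q * (|w.im| + 2)) ^ (2 * η) :=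
        Real.mul_rpow (by norm_num) (by positivity)
    _ ≤ 2 ^ (1 : ℝ) * (Q * (|w.im| + 2)) ^ (2 * η) := by
        gcongr
        · norm_num
        · linarith
    _ = _ := by rw [Real.rpow_one]

lemma abs_im_le_of_norm_sub_le {s w : ℂ} {r : ℝ} (h : ‖s - w‖ ≤ r) : |s.im| ≤ |w.im| + r := by
  have h1 := (abs_im_le_norm (s - w)).trans h
  rw [sub_im] at h1
  have := abs_sub_abs_le_abs_sub s.im w.im
  linarith

lemma abs_re_sub_le_of_norm_sub_le {s w : ℂ} {r : ℝ} (h : ‖s - w‖ ≤ r) : |s.re - w.re| ≤ r := by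
  simpa using (abs_re_le_norm (s - w)).trans h

lemma norm_deriv_le_growth {η C Q : ℝ} (hη : 0 < η) (hη2 : η ≤ 1 / 2) (hC : 0 < C) (hQ : 1 ≤ Q)
    {F : ℂ → ℂ} (hF : DifferentiableOn ℂ F {s | 0 < s.re})
    (hU : ∀ s : ℂ, 1 - η ≤ s.re → s.re ≤ 4 → ‖F s‖ ≤ C * growth η Q s) {s : ℂ}
    (h1 : 1 - η / 2 ≤ s.re) (h2 : s.re ≤ 3) : ‖deriv F s‖ ≤ 4 * C / η * growth η Q s := by
  have hs : ∀ z ∈ Metric.closedBall s (η / 2), 1 - η ≤ z.re ∧ z.re ≤ 4 ∧ |z.im| ≤ |s.im| + η / 2 := by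
    intro z hz
    have hz' : ‖z - s‖ ≤ η / 2 := mem_closedBall_iff_norm.mp hz
    have := abs_le.mp (abs_re_sub_le_of_norm_sub_le hz')
    exact ⟨by linarith, by linarith, abs_im_le_of_norm_sub_le hz'⟩
  have hd : DiffContOnCl ℂ F (Metric.ball s (η / 2)) := by
    refine DifferentiableOn.diffContOnCl (hF.mono ?_)
    rw [closure_ball _ (by positivity)]
    intro z hz
    have := (hs z hz).1
    simp only [Set.mem_ofPred_eq]
    linarith
  refine (norm_deriv_le_of_forall_mem_sphere_norm_le (C := C * (2 * growth η Q s)) (by positivity)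
    hd fun z hz => ?_).trans_eq (by field_simp; ring)
  obtain ⟨h3, h4, h5⟩ := hs z (Metric.sphere_subset_closedBall hz)
  refine (hU z h3 h4).trans ?_
  gcongr
  exact growth_le_two_mul hη hη2 hQ (by linarith [abs_nonneg s.im])

lemma convex_strip (a b d : ℝ) : Convex ℝ {z : ℂ | a ≤ z.re ∧ z.re ≤ b ∧ |z.im| ≤ d} := by
  have : {z : ℂ | a ≤ z.re ∧ z.re ≤ b ∧ |z.im| ≤ d} =
      {z : ℂ | a ≤ z.re} ∩ ({z : ℂ | z.re ≤ b} ∩ ({z : ℂ | -d ≤ z.im} ∩ {z : ℂ | z.im ≤ d})) := by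
    ext z
    simp [abs_le]
  rw [this]
  exact (convex_halfSpace_re_ge a).inter ((convex_halfSpace_re_le b).inter
    ((convex_halfSpace_im_ge (-d)).inter (convex_halfSpace_im_le d)))

lemma norm_sub_le_growth {η C Q : ℝ} (hη : 0 < η) (hη2 : η ≤ 1 / 2) (hC : 0 < C) (hQ : 1 ≤ Q)
    {F : ℂ → ℂ} (hF : DifferentiableOn ℂ F {s | 0 < s.re})
    (hU : ∀ s : ℂ, 1 - η ≤ s.re → s.re ≤ 4 → ‖F s‖ ≤ C * growth η Q s) {s w v : ℂ}
    (h1 : 1 - η / 2 ≤ s.re) (h2 : s.re ≤ 3) (h1' : 1 - η / 2 ≤ w.re) (h2' : w.re ≤ 3)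
    (h3 : |s.im| ≤ 2 * |v.im| + 2) (h3' : |w.im| ≤ 2 * |v.im| + 2) :
    ‖F s - F w‖ ≤ 8 * C / η * growth η Q v * ‖s - w‖ := by
  refine (convex_strip (1 - η / 2) 3 (2 * |v.im| + 2)).norm_image_sub_le_of_norm_deriv_le
    (fun z hz => ?_) (fun z hz => ?_) ⟨h1', h2', h3'⟩ ⟨h1, h2, h3⟩
  · refine hF.differentiableAt ((isOpen_lt continuous_const continuous_re).mem_nhds ?_)
    simp only [Set.mem_ofPred_eq]
    linarith [hz.1]
  · refine (norm_deriv_le_growth hη hη2 hC hQ hF hU hz.1 hz.2.1).trans ?_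
    calc 4 * C / η * growth η Q z ≤ 4 * C / η * (2 * growth η Q v) := by
          gcongr
          exact growth_le_two_mul hη hη2 hQ hz.2.2
      _ = _ := by ring

/-- A lower bound coming from the `3-4-1` inequality, moved from `Re s = σ' > 1` to the line. -/
lemma le_norm_of_three_four_one {η C Q A : ℝ} (hη : 0 < η) (hη2 : η ≤ 1 / 2) (hC : 1 ≤ C)
    (hQ : 1 ≤ Q) (hA : 1 ≤ A)
    {F : ℂ → ℂ} (hF : DifferentiableOn ℂ F {s | 0 < s.re})
    (hU : ∀ s : ℂ, 1 - η ≤ s.re → s.re ≤ 4 → ‖F s‖ ≤ C * growth η Q s) {s : ℂ}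
    (h1 : 1 < s.re) (h2 : s.re ≤ 2)
    (h341 : ∀ σ : ℝ, s.re ≤ σ → σ ≤ 2 →
      (σ - 1) ^ 3 ≤ (A * growth η Q s ^ 2) ^ 4 * ‖F (σ + s.im * I)‖ ^ 4) :
    (η / (16 * C * A)) ^ 3 / (2 * A) ≤ growth η Q s ^ 11 * ‖F s‖ := by
  set P := growth η Q s with hP
  have hP1 : 1 ≤ P := one_le_growth hη hQ s
  set δ := η / (16 * C * A * P ^ 3) with hδ
  have hδ0 : 0 < δ := by positivity
  have hδ1 : δ ≤ 1 := by
    rw [hδ, div_le_one (by positivity)]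
    have : 1 ≤ C * A * P ^ 3 := one_le_mul_of_one_le_of_one_le
      (one_le_mul_of_one_le_of_one_le hC hA) (one_le_pow₀ hP1)
    nlinarith
  have hδ4 : δ ^ 4 ≤ 1 := pow_le_one₀ hδ0.le hδ1
  have hgoal : (η / (16 * C * A)) ^ 3 / (2 * A) = P ^ 11 * (δ ^ 3 / (2 * A * P ^ 2)) := by
    rw [hδ]
    field_simp
  rw [hgoal]
  gcongr
  set σ := max s.re (1 + δ ^ 4) with hσ
  have hσ1 : s.re ≤ σ := le_max_left _ _
  have hσ2 : σ ≤ 2 := max_le h2 (by linarith)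
  have hσ3 : δ ^ 4 ≤ σ - 1 := by linarith [le_max_right s.re (1 + δ ^ 4)]
  have hσs : σ - s.re ≤ δ ^ 4 := by
    rcases max_cases s.re (1 + δ ^ 4) with h | h <;> rw [hσ, h.1] <;> nlinarith [pow_pos hδ0 4]
  have hlow : δ ^ 3 ≤ A * P ^ 2 * ‖F (σ + s.im * I)‖ := by
    refine le_of_pow_le_pow_left₀ (n := 4) (by norm_num) (by positivity) ?_
    calc (δ ^ 3) ^ 4 = (δ ^ 4) ^ 3 := by ring
      _ ≤ (σ - 1) ^ 3 := by gcongr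
      _ ≤ _ := (h341 σ hσ1 hσ2).trans_eq (by ring)
  have hdiff : ‖F (σ + s.im * I) - F s‖ ≤ 8 * C / η * P * δ ^ 4 := by
    refine (norm_sub_le_growth hη hη2 (by linarith) hQ hF hU (v := s) ?_ ?_ ?_ ?_ ?_ ?_).trans ?_
    · simp; linarith
    · simp; linarith
    · linarith
    · linarith
    · simp; linarith [abs_nonneg s.im]
    · linarith [abs_nonneg s.im]
    · have : (σ + s.im * I - s : ℂ) = ((σ - s.re : ℝ) : ℂ) := by
        apply Complex.ext <;> simp
      rw [this, norm_real, Real.norm_eq_abs, abs_of_nonneg (by linarith)]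
      gcongr
  have hdiff2 : 8 * C / η * P * δ ^ 4 = δ ^ 3 / (2 * A * P ^ 2) := by
    rw [pow_succ δ 3]
    nth_rewrite 2 [hδ]
    field_simp
    ring
  have htri : ‖F (σ + s.im * I)‖ ≤ ‖F s‖ + ‖F (σ + s.im * I) - F s‖ := by
    simpa using norm_add_le (F s) (F (σ + s.im * I) - F s)
  have hlow' : δ ^ 3 / (A * P ^ 2) ≤ ‖F (σ + s.im * I)‖ := by
    rw [div_le_iff₀ (by positivity)]
    linarith
  have hhalf : δ ^ 3 / (A * P ^ 2) = 2 * (δ ^ 3 / (2 * A * P ^ 2)) := by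
    field_simp
  linarith

/-- If `F` is bounded above and below near `Re s = 1`, its logarithmic derivative is
under control in small discs. -/
lemma norm_logDeriv_le_growth {η C Q c : ℝ} {k : ℕ} (hη : 0 < η) (hη2 : η ≤ 1 / 2) (hC : 1 ≤ C)
    (hQ : 1 ≤ Q) (hc : 0 < c) (hc1 : c ≤ 1)
    {F : ℂ → ℂ} (hF : DifferentiableOn ℂ F {s | 0 < s.re})
    (hU : ∀ s : ℂ, 1 - η ≤ s.re → s.re ≤ 4 → ‖F s‖ ≤ C * growth η Q s)
    (hL : ∀ s : ℂ, 1 < s.re → s.re ≤ 2 → c ≤ growth η Q s ^ k * ‖F s‖) {s z : ℂ}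
    (h1 : 1 < s.re) (h2 : s.re ≤ 2)
    (hz : ‖z - s‖ ≤ c * η / (16 * C) / growth η Q s ^ (k + 1)) :
    F z ≠ 0 ∧ ‖deriv F z / F z‖ ≤ 16 * C / (c * η) * growth η Q s ^ (k + 1) := by
  set P := growth η Q s with hP
  have hP1 : 1 ≤ P := one_le_growth hη hQ s
  have hr : c * η / (16 * C) / P ^ (k + 1) ≤ η / 2 := by
    rw [div_div, div_le_iff₀ (by positivity)]
    have : 1 ≤ C * P ^ (k + 1) := one_le_mul_of_one_le_of_one_le hC (one_le_pow₀ hP1)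
    nlinarith
  have hre := abs_le.mp (abs_re_sub_le_of_norm_sub_le (hz.trans hr))
  have him := abs_im_le_of_norm_sub_le (hz.trans hr)
  have him' : |z.im| ≤ 2 * |s.im| + 2 := by linarith [abs_nonneg s.im]
  have hdiff := norm_sub_le_growth hη hη2 (by linarith) hQ hF hU (s := z) (w := s) (v := s)
    (by linarith) (by linarith) (by linarith) (by linarith) him' (by linarith [abs_nonneg s.im])
  have hdiff' : ‖F z - F s‖ ≤ c / (2 * P ^ k) := by
    refine (hdiff.trans (mul_le_mul_of_nonneg_left hz (by positivity))).trans_eq ?_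
    rw [← hP, pow_succ]
    field_simp
    norm_num
  have hs : c / P ^ k ≤ ‖F s‖ := by
    rw [div_le_iff₀ (by positivity)]
    linarith [hL s h1 h2]
  have htri : ‖F s‖ ≤ ‖F z‖ + ‖F z - F s‖ := by
    rw [← norm_neg (F z - F s)]
    simpa using norm_add_le (F z) (-(F z - F s))
  have hhalf : c / P ^ k = 2 * (c / (2 * P ^ k)) := by field_simp
  have hlow : c / (2 * P ^ k) ≤ ‖F z‖ := by linarith
  have hpos : 0 < c / (2 * P ^ k) := by positivity
  refine ⟨norm_pos_iff.mp (hpos.trans_le hlow), ?_⟩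
  rw [norm_div, div_le_iff₀ (hpos.trans_le hlow)]
  have hd := norm_deriv_le_growth hη hη2 (by linarith) hQ hF hU (s := z) (by linarith) (by linarith)
  calc ‖deriv F z‖ ≤ 4 * C / η * (2 * P) := hd.trans (by
        gcongr
        exact growth_le_two_mul hη hη2 hQ him')
    _ = 16 * C / (c * η) * P ^ (k + 1) * (c / (2 * P ^ k)) := by
        rw [pow_succ]
        field_simp
        norm_num
    _ ≤ _ := by gcongr

end LowerBounds

section LowerBoundsL

open Complex DirichletCharacter

lemma exists_norm_LFunction_le_growth {η : ℝ} (hη : 0 < η) (hη2 : η ≤ 1 / 2) :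
    ∃ C : ℝ, 1 ≤ C ∧ ∀ (q : ℕ) [NeZero q] (χ : DirichletCharacter ℂ q), χ ≠ 1 →
      ∀ s : ℂ, 1 - η ≤ s.re → s.re ≤ 4 → ‖χ.LFunction s‖ ≤ C * growth η q s := by
  obtain ⟨C, hC, h⟩ := exists_norm_LFunction_le hη hη2
  refine ⟨max 1 C, le_max_left _ _, fun q _ χ hχ s h1 h2 => (h q χ hχ s h1 h2).trans ?_⟩
  unfold growth
  gcongr
  exact le_max_right _ _

lemma norm_LFunctionTrivChar_le {q : ℕ} [NeZero q] {s : ℂ} (hs : 1 < s.re) :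
    ‖LFunctionTrivChar q s‖ ≤ ‖riemannZeta s‖ * (2 * Real.log q + 1) := by
  have hs1 : s ≠ 1 := fun h => by simp [h] at hs
  rw [LFunctionTrivChar_eq_mul_riemannZeta hs1, norm_mul, mul_comm]
  gcongr
  rw [norm_prod]
  refine (Finset.prod_le_prod (fun _ _ => norm_nonneg _) fun p hp => ?_).trans
    ((prod_one_add_inv_le q).trans (prod_primeFactors_le q (NeZero.ne q)))
  have hp0 : 0 < p := (Nat.prime_of_mem_primeFactors hp).pos
  refine (norm_sub_le _ _).trans ?_
  rw [norm_one, norm_natCast_cpow_of_pos hp0, neg_re, ← Real.rpow_neg_one]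
  gcongr
  exact_mod_cast hp0

lemma norm_riemannZeta_le {η C κ : ℝ} (hη : 0 < η) (hη2 : η ≤ 1 / 2) (hC : 1 ≤ C) (hκ : 0 < κ)
    (hκ1 : κ ≤ 1)
    (hZ : ∀ s : ℂ, 1 - η ≤ s.re → s.re ≤ 4 → ‖zetaOne s‖ ≤ C * (|s.im| + 2) ^ (1 + 2 * η)) {s : ℂ}
    (h1 : 1 < s.re) (h2 : s.re ≤ 2) (hκs : κ ≤ ‖s - 1‖) :
    ‖riemannZeta s‖ ≤ 9 * C / κ * growth η 1 s := by
  have hs1 : s ≠ 1 := fun h => by simp [h] at h1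
  have hsn : 0 < ‖s - 1‖ := norm_pos_iff.mpr (sub_ne_zero.mpr hs1)
  have hz := hZ s (by linarith) (by linarith)
  rw [zetaOne_of_ne hs1, norm_mul, Real.rpow_add (by positivity), Real.rpow_one] at hz
  have hg : (|s.im| + 2) ^ (2 * η) = growth η 1 s := by rw [growth, one_mul]
  rw [hg] at hz
  have hG : 1 ≤ growth η 1 s := one_le_growth hη le_rfl s
  have him : |s.im| ≤ ‖s - 1‖ := by simpa using abs_im_le_norm (s - 1)
  have hkey : |s.im| + 2 ≤ 9 / κ * ‖s - 1‖ := by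
    rw [div_mul_eq_mul_div, le_div_iff₀ hκ]
    nlinarith [abs_nonneg s.im]
  refine le_of_mul_le_mul_left (hz.trans ?_) hsn
  calc C * ((|s.im| + 2) * growth η 1 s) ≤ C * (9 / κ * ‖s - 1‖ * growth η 1 s) := by gcongr
    _ = _ := by ring

lemma norm_LFunction_product_ge_one' {q : ℕ} [NeZero q] (χ : DirichletCharacter ℂ q) {σ : ℝ}
    (hσ : 1 < σ) (t : ℝ) :
    1 ≤ ‖LFunctionTrivChar q σ‖ ^ 3 * ‖χ.LFunction (σ + t * I)‖ ^ 4 *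
      ‖(χ ^ 2).LFunction (σ + (2 * t : ℝ) * I)‖ := by
  have h := norm_LFunction_product_ge_one χ (x := σ - 1) (by linarith) t
  rw [norm_mul, norm_mul, norm_pow, norm_pow] at h
  have e1 : (1 + ((σ - 1 : ℝ) : ℂ)) = σ := by push_cast; ring
  have e2 : (σ + I * t : ℂ) = σ + t * I := by ring
  have e3 : (σ + 2 * I * t : ℂ) = σ + (2 * t : ℝ) * I := by push_cast; ring
  rw [e1, e2, e3] at h
  exact h

lemma growth_mono_level {η Q Q' : ℝ} (hη : 0 < η) (hQ : 0 ≤ Q) (h : Q ≤ Q') (s : ℂ) :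
    growth η Q s ≤ growth η Q' s := by
  unfold growth
  gcongr

lemma rpow_le_growth {η Q : ℝ} (hη : 0 < η) (hQ : 0 ≤ Q) (s : ℂ) :
    Q ^ (2 * η) ≤ growth η Q s := by
  unfold growth
  gcongr
  nlinarith [abs_nonneg s.im]

theorem exists_le_norm_LFunction {η : ℝ} (hη : 0 < η) (hη2 : η ≤ 1 / 2) :
    ∃ c : ℝ, 0 < c ∧ c ≤ 1 ∧ ∀ (q : ℕ) [NeZero q] (χ : DirichletCharacter ℂ q), χ.IsPrimitive →
      χ ≠ 1 → ∀ s : ℂ, 1 < s.re → s.re ≤ 2 → c ≤ growth η q s ^ 11 * ‖χ.LFunction s‖ := by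
  obtain ⟨C, hC, hU⟩ := exists_norm_LFunction_le_growth hη hη2
  obtain ⟨CZ', hCZ', hZ'⟩ := exists_norm_zetaOne_le hη hη2
  obtain ⟨C₁', hC₁', hlog'⟩ := exists_log_le_rpow (ε := 2 * η) (by positivity)
  obtain ⟨cS, hcS, hS⟩ := exists_le_norm_LFunction_one (ε := 2 * η) (by positivity)
  set CZ := max 1 CZ' with hCZ
  have hCZ1 : 1 ≤ CZ := le_max_left _ _
  set C₁ := max 1 C₁' with hC₁
  have hC₁1 : 1 ≤ C₁ := le_max_left _ _
  have hZ : ∀ s : ℂ, 1 - η ≤ s.re → s.re ≤ 4 → ‖zetaOne s‖ ≤ CZ * (|s.im| + 2) ^ (1 + 2 * η) :=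
    fun s h1 h2 => (hZ' s h1 h2).trans (by gcongr; exact le_max_right _ _)
  have hlog : ∀ (q : ℕ) [NeZero q] (s : ℂ), 2 * Real.log q + 1 ≤ C₁ * growth η q s :=
    fun q _ s => (hlog' q (NeZero.ne q)).trans (by
      gcongr
      · exact le_max_right _ _
      · exact rpow_le_growth hη (Nat.cast_nonneg q) s)
  set κ := min 1 (cS * η / (16 * C)) with hκ
  have hκ0 : 0 < κ := lt_min one_pos (by positivity)
  have hκ1 : κ ≤ 1 := min_le_left _ _
  set A := max (54 * CZ * C₁) (36 * CZ * C₁ / κ) * (2 * C) with hA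
  have hA54 : 54 * CZ * C₁ ≤ A := by
    have := le_max_left (54 * CZ * C₁) (36 * CZ * C₁ / κ)
    have h0 : 0 < 54 * CZ * C₁ := by positivity
    nlinarith
  have hA36 : 36 * CZ * C₁ / κ ≤ A := by
    have := le_max_right (54 * CZ * C₁) (36 * CZ * C₁ / κ)
    have h0 : 0 < 36 * CZ * C₁ / κ := by positivity
    nlinarith
  have hCZC₁ : 1 ≤ CZ * C₁ := one_le_mul_of_one_le_of_one_le hCZ1 hC₁1
  have hA2C : 2 * C ≤ A := by
    have := le_max_left (54 * CZ * C₁) (36 * CZ * C₁ / κ)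
    nlinarith
  have hA1 : 1 ≤ A := by nlinarith
  refine ⟨min 1 (min ((η / (16 * C * A)) ^ 3 / (2 * A)) (cS / 2)),
    lt_min one_pos (lt_min (by positivity) (by positivity)), min_le_left _ _, ?_⟩
  intro q _ χ hprim hχ s h1 h2
  have hq1 : (1 : ℝ) ≤ q := by exact_mod_cast Nat.one_le_iff_ne_zero.mpr (NeZero.ne q)
  have hF : DifferentiableOn ℂ χ.LFunction {s | 0 < s.re} :=
    (differentiable_LFunction hχ).differentiableOn
  have hUχ := hU q χ hχ
  set P := growth η q s with hP
  have hP1 : 1 ≤ P := one_le_growth hη hq1 s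
  refine (min_le_right _ _).trans ?_
  by_cases hcase : χ ^ 2 = 1 ∧ ‖s - 1‖ * P ^ 2 ≤ κ
  · -- close to `1`, Siegel's theorem applies
    refine (min_le_right _ _).trans ?_
    have hd := norm_sub_le_growth hη hη2 (by linarith) hq1 hF hUχ (s := s) (w := 1) (v := s)
      (by linarith) (by linarith) (by simp; linarith) (by simp)
      (by linarith [abs_nonneg s.im]) (by simp; linarith [abs_nonneg s.im])
    rw [← hP] at hd
    have hs := hS q χ hprim hcase.1 hχ
    have hqP : (q : ℝ) ^ (2 * η) ≤ P := rpow_le_growth hη (by linarith) s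
    have hq0 : 0 < (q : ℝ) ^ (2 * η) := by positivity
    rw [Real.rpow_neg (by linarith), ← div_eq_mul_inv, div_le_iff₀ hq0] at hs
    have hs' : cS ≤ ‖χ.LFunction 1‖ * P := hs.trans (by gcongr)
    have htri : ‖χ.LFunction 1‖ ≤ ‖χ.LFunction s‖ + ‖χ.LFunction s - χ.LFunction 1‖ := by
      rw [← norm_neg (χ.LFunction s - χ.LFunction 1)]
      simpa using norm_add_le (χ.LFunction s) (-(χ.LFunction s - χ.LFunction 1))
    have hdP : ‖χ.LFunction s - χ.LFunction 1‖ * P ≤ cS / 2 := by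
      calc ‖χ.LFunction s - χ.LFunction 1‖ * P ≤ 8 * C / η * P * ‖s - 1‖ * P := by gcongr
        _ = 8 * C / η * (‖s - 1‖ * P ^ 2) := by ring
        _ ≤ 8 * C / η * (cS * η / (16 * C)) := by
            gcongr
            exact hcase.2.trans (min_le_right _ _)
        _ = cS / 2 := by field_simp; norm_num
    have h3 : cS / 2 ≤ P * ‖χ.LFunction s‖ := by nlinarith
    refine h3.trans ?_
    gcongr
    exact le_self_pow₀ hP1 (by norm_num)
  · refine (min_le_left _ _).trans ?_
    refine le_norm_of_three_four_one hη hη2 hC hq1 hA1 hF hUχ h1 h2 fun σ hσ1 hσ2 => ?_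
    rw [← hP]
    have hσ : 1 < σ := by linarith
    have hx : 0 < σ - 1 := by linarith
    have h341 := norm_LFunction_product_ge_one' χ hσ s.im
    have hfst : ‖LFunctionTrivChar q σ‖ * (σ - 1) ≤ A * P := by
      have hzr := norm_riemannZeta_le (s := (σ : ℂ)) (κ := σ - 1) hη hη2 hCZ1 hx (by linarith) hZ
        (by simpa) (by simpa) (by
          rw [show (σ - 1 : ℂ) = ((σ - 1 : ℝ) : ℂ) by push_cast; rfl, norm_real, Real.norm_eq_abs,
            abs_of_pos hx])
      have hg : growth η 1 (σ : ℂ) ≤ 2 := by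
        simp only [growth, ofReal_im, abs_zero, zero_add, one_mul]
        calc (2 : ℝ) ^ (2 * η) ≤ 2 ^ (1 : ℝ) := by gcongr <;> linarith
          _ = 2 := Real.rpow_one 2
      calc ‖LFunctionTrivChar q σ‖ * (σ - 1)
          ≤ (9 * CZ / (σ - 1) * 2) * (C₁ * P) * (σ - 1) := by
            gcongr
            refine (norm_LFunctionTrivChar_le (by simpa)).trans ?_
            gcongr
            · exact hzr.trans (by gcongr)
            · exact hlog q s
        _ = 18 * CZ * C₁ * P := by field_simp; norm_num
        _ ≤ A * P := by gcongr; nlinarith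
    have hthd : ‖(χ ^ 2).LFunction (σ + (2 * s.im : ℝ) * I)‖ ≤ A * P ^ 4 := by
      set w : ℂ := σ + (2 * s.im : ℝ) * I with hw
      have hwre : w.re = σ := by simp [hw]
      have hwim : w.im = 2 * s.im := by simp [hw]
      have hgw : growth η q w ≤ 2 * P := growth_le_two_mul hη hη2 hq1 (by
        rw [hwim, abs_mul, abs_two]; linarith)
      by_cases hχ2 : χ ^ 2 = 1
      · have hbig : κ < ‖s - 1‖ * P ^ 2 := by
          by_contra! h
          exact hcase ⟨hχ2, h⟩
        have hws : ‖s - 1‖ ≤ ‖w - 1‖ := by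
          rw [← abs_of_nonneg (norm_nonneg (s - 1)), ← abs_of_nonneg (norm_nonneg (w - 1)),
            ← sq_le_sq, Complex.sq_norm, Complex.sq_norm, normSq_apply, normSq_apply]
          simp only [sub_re, one_re, sub_im, one_im, sub_zero, hwre, hwim]
          nlinarith [sq_nonneg s.im]
        have hκw : κ / P ^ 2 ≤ ‖w - 1‖ := by
          rw [div_le_iff₀ (by positivity)]
          exact hbig.le.trans (by gcongr)
        have hzr := norm_riemannZeta_le (s := w) (κ := κ / P ^ 2) hη hη2 hCZ1 (by positivity)
          (by rw [div_le_one (by positivity)]; exact hκ1.trans (one_le_pow₀ hP1)) hZ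
          (by rw [hwre]; exact hσ) (by rw [hwre]; exact hσ2) hκw
        rw [hχ2]
        calc ‖LFunctionTrivChar q w‖ ≤ (9 * CZ / (κ / P ^ 2) * (2 * P)) * (C₁ * P) := by
              refine (norm_LFunctionTrivChar_le (by rw [hwre]; exact hσ)).trans ?_
              gcongr
              · refine hzr.trans ?_
                gcongr
                exact (growth_mono_level hη zero_le_one hq1 w).trans hgw
              · exact hlog q s
          _ = 18 * CZ * C₁ / κ * P ^ 4 := by field_simp; norm_num
          _ ≤ A * P ^ 4 := by
              gcongr
              refine le_trans ?_ hA36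
              gcongr
              norm_num
      · calc ‖(χ ^ 2).LFunction w‖ ≤ C * (2 * P) := (hU q _ hχ2 w (by rw [hwre]; linarith)
              (by rw [hwre]; linarith)).trans (by gcongr)
          _ ≤ A * P := by nlinarith
          _ ≤ A * P ^ 4 := by gcongr; exact le_self_pow₀ hP1 (by norm_num)
    set X := ‖χ.LFunction (σ + s.im * I)‖ with hX
    calc (σ - 1) ^ 3 ≤ (σ - 1) ^ 3 * (‖LFunctionTrivChar q σ‖ ^ 3 * X ^ 4 *
          ‖(χ ^ 2).LFunction (σ + (2 * s.im : ℝ) * I)‖) := le_mul_of_one_le_right (by positivity) h341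
      _ = (‖LFunctionTrivChar q σ‖ * (σ - 1)) ^ 3 * X ^ 4 *
          ‖(χ ^ 2).LFunction (σ + (2 * s.im : ℝ) * I)‖ := by ring
      _ ≤ (A * P) ^ 3 * X ^ 4 * (A * P ^ 4) := by gcongr
      _ = A ^ 4 * P ^ 7 * X ^ 4 := by ring
      _ ≤ A ^ 4 * P ^ 8 * X ^ 4 := by gcongr; norm_num [hP1]
      _ = _ := by ring

end LowerBoundsL

section LowerBoundsZeta

open Complex DirichletCharacter

/-- `(s - 1) ζ(s) / (s + 1)`, which has the growth of an `L`-function and no pole. -/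
noncomputable def zetaReg (s : ℂ) : ℂ := zetaOne s / (s + 1)

lemma add_one_ne_zero_of_re_pos {s : ℂ} (hs : 0 < s.re) : s + 1 ≠ 0 := fun h => by
  have := congrArg re h
  simp at this
  linarith

lemma differentiableOn_zetaReg : DifferentiableOn ℂ zetaReg {s | 0 < s.re} :=
  differentiable_zetaOne.differentiableOn.div (by fun_prop)
    fun _ hs => add_one_ne_zero_of_re_pos hs

lemma abs_im_add_two_le {s : ℂ} (hs : 0 < s.re) : |s.im| + 2 ≤ 3 * ‖s + 1‖ := by
  have h1 : |s.im| ≤ ‖s + 1‖ := by simpa using abs_im_le_norm (s + 1)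
  have h2 : 1 ≤ ‖s + 1‖ := by
    have := re_le_norm (s + 1)
    simp at this
    linarith
  linarith

lemma exists_norm_zetaReg_le_growth {η : ℝ} (hη : 0 < η) (hη2 : η ≤ 1 / 2) :
    ∃ C : ℝ, 1 ≤ C ∧ ∀ s : ℂ, 1 - η ≤ s.re → s.re ≤ 4 → ‖zetaReg s‖ ≤ C * growth η 1 s := by
  obtain ⟨C, hC, h⟩ := exists_norm_zetaOne_le hη hη2
  refine ⟨max 1 (3 * C), le_max_left _ _, fun s h1 h2 => ?_⟩
  have hs : 0 < s.re := by linarith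
  have h3 := abs_im_add_two_le hs
  have h4 : 0 < ‖s + 1‖ := norm_pos_iff.mpr (add_one_ne_zero_of_re_pos hs)
  rw [zetaReg, norm_div, div_le_iff₀ h4]
  have hz := h s h1 h2
  rw [Real.rpow_add (by positivity), Real.rpow_one] at hz
  have hg : (|s.im| + 2) ^ (2 * η) = growth η 1 s := by rw [growth, one_mul]
  rw [hg] at hz
  have hG : 1 ≤ growth η 1 s := one_le_growth hη le_rfl s
  calc ‖zetaOne s‖ ≤ C * ((3 * ‖s + 1‖) * growth η 1 s) := hz.trans (by gcongr)
    _ = 3 * C * growth η 1 s * ‖s + 1‖ := by ring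
    _ ≤ _ := by
        gcongr
        exact le_max_right _ _

lemma zetaOne_ne_zero_of_one_le_re {s : ℂ} (hs : 1 ≤ s.re) : zetaOne s ≠ 0 := by
  rcases eq_or_ne s 1 with rfl | h
  · simp [zetaOne_one]
  · rw [zetaOne_of_ne h]
    exact mul_ne_zero (sub_ne_zero.mpr h) (riemannZeta_ne_zero_of_one_le_re hs)

lemma exists_le_norm_zetaReg_near :
    ∃ c : ℝ, 0 < c ∧ ∀ s : ℂ, 1 ≤ s.re → s.re ≤ 2 → |s.im| ≤ 1 → c ≤ ‖zetaReg s‖ := by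
  have hK : IsCompact (Set.Icc (1 : ℝ) 2 ×ℂ Set.Icc (-1 : ℝ) 1) := isCompact_Icc.reProdIm isCompact_Icc
  have hne : (Set.Icc (1 : ℝ) 2 ×ℂ Set.Icc (-1 : ℝ) 1).Nonempty :=
    ⟨1, by simp [mem_reProdIm]⟩
  have hsub : Set.Icc (1 : ℝ) 2 ×ℂ Set.Icc (-1 : ℝ) 1 ⊆ {s | 0 < s.re} := fun s hs => by
    have := (mem_reProdIm.mp hs).1.1
    simp only [Set.mem_ofPred_eq]
    linarith
  obtain ⟨s₀, hs₀, hmin⟩ := hK.exists_isMinOn hne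
    (differentiableOn_zetaReg.continuousOn.mono hsub).norm
  refine ⟨‖zetaReg s₀‖, norm_pos_iff.mpr ?_, fun s h1 h2 h3 => hmin ?_⟩
  · exact div_ne_zero (zetaOne_ne_zero_of_one_le_re (mem_reProdIm.mp hs₀).1.1)
      (add_one_ne_zero_of_re_pos (hsub hs₀))
  · exact mem_reProdIm.mpr ⟨⟨h1, h2⟩, abs_le.mp h3⟩

theorem exists_le_norm_zetaReg {η : ℝ} (hη : 0 < η) (hη2 : η ≤ 1 / 2) :
    ∃ c : ℝ, 0 < c ∧ c ≤ 1 ∧ ∀ s : ℂ, 1 < s.re → s.re ≤ 2 →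
      c ≤ growth η 1 s ^ 11 * ‖zetaReg s‖ := by
  obtain ⟨C, hC, hU⟩ := exists_norm_zetaReg_le_growth hη hη2
  obtain ⟨CZ', hCZ', hZ'⟩ := exists_norm_zetaOne_le hη hη2
  obtain ⟨c₀, hc₀, hnear⟩ := exists_le_norm_zetaReg_near
  set CZ := max 1 CZ' with hCZ
  have hCZ1 : 1 ≤ CZ := le_max_left _ _
  have hZ : ∀ s : ℂ, 1 - η ≤ s.re → s.re ≤ 4 → ‖zetaOne s‖ ≤ CZ * (|s.im| + 2) ^ (1 + 2 * η) :=
    fun s h1 h2 => (hZ' s h1 h2).trans (by gcongr; exact le_max_right _ _)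
  set A := 54 * CZ with hA
  have hA1 : 1 ≤ A := by linarith
  refine ⟨min 1 (min ((η / (16 * C * A)) ^ 3 / (2 * A)) c₀),
    lt_min one_pos (lt_min (by positivity) hc₀), min_le_left _ _, ?_⟩
  intro s h1 h2
  set P := growth η 1 s with hP
  have hP1 : 1 ≤ P := one_le_growth hη le_rfl s
  refine (min_le_right _ _).trans ?_
  rcases le_or_gt |s.im| 1 with him | him
  · refine (min_le_right _ _).trans ((hnear s h1.le h2 him).trans ?_)
    exact le_mul_of_one_le_left (norm_nonneg _) (one_le_pow₀ hP1)
  · refine (min_le_left _ _).trans ?_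
    refine le_norm_of_three_four_one hη hη2 hC le_rfl hA1 differentiableOn_zetaReg hU h1 h2
      fun σ hσ1 hσ2 => ?_
    rw [← hP]
    have hσ : 1 < σ := by linarith
    have hx : 0 < σ - 1 := by linarith
    have h341 := norm_LFunction_product_ge_one' (1 : DirichletCharacter ℂ 1) hσ s.im
    rw [LFunctionTrivChar, one_pow, LFunction_modOne_eq] at h341
    have hfst : ‖riemannZeta σ‖ * (σ - 1) ≤ 18 * CZ := by
      have hzr := norm_riemannZeta_le (s := (σ : ℂ)) (κ := σ - 1) hη hη2 hCZ1 hx (by linarith) hZ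
        (by simpa) (by simpa) (by
          rw [show (σ - 1 : ℂ) = ((σ - 1 : ℝ) : ℂ) by push_cast; rfl, norm_real, Real.norm_eq_abs,
            abs_of_pos hx])
      have hg : growth η 1 (σ : ℂ) ≤ 2 := by
        simp only [growth, ofReal_im, abs_zero, zero_add, one_mul]
        calc (2 : ℝ) ^ (2 * η) ≤ 2 ^ (1 : ℝ) := by gcongr <;> linarith
          _ = 2 := Real.rpow_one 2
      calc ‖riemannZeta σ‖ * (σ - 1) ≤ (9 * CZ / (σ - 1) * 2) * (σ - 1) := by
            gcongr
            exact hzr.trans (by gcongr)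
        _ = 18 * CZ := by field_simp; norm_num
    have hthd : ‖riemannZeta (σ + (2 * s.im : ℝ) * I)‖ ≤ 18 * CZ * P := by
      set w : ℂ := σ + (2 * s.im : ℝ) * I with hw
      have hwre : w.re = σ := by simp [hw]
      have hwim : w.im = 2 * s.im := by simp [hw]
      have hgw : growth η 1 w ≤ 2 * P := growth_le_two_mul hη hη2 le_rfl (by
        rw [hwim, abs_mul, abs_two]; linarith)
      have h1w : (1 : ℝ) ≤ ‖w - 1‖ := by
        have := abs_im_le_norm (w - 1)
        rw [sub_im, one_im, sub_zero, hwim, abs_mul, abs_two] at this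
        linarith
      calc ‖riemannZeta w‖ ≤ 9 * CZ / 1 * (2 * P) := (norm_riemannZeta_le hη hη2 hCZ1 one_pos le_rfl
            hZ (by rw [hwre]; exact hσ) (by rw [hwre]; exact hσ2) h1w).trans (by gcongr)
        _ = _ := by ring
    have hsnd : ‖riemannZeta (σ + s.im * I)‖ ≤ 3 * ‖zetaReg (σ + s.im * I)‖ := by
      set w : ℂ := σ + s.im * I with hw
      have hwre : w.re = σ := by simp [hw]
      have hwim : w.im = s.im := by simp [hw]
      have hw1 : w ≠ 1 := fun h => by
        rw [h, one_re] at hwre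
        linarith
      have h1w : (1 : ℝ) ≤ ‖w - 1‖ := by
        have := abs_im_le_norm (w - 1)
        rw [sub_im, one_im, sub_zero, hwim] at this
        linarith
      have h2w : ‖w + 1‖ ≤ 3 * ‖w - 1‖ := by
        calc ‖w + 1‖ = ‖(w - 1) + 2‖ := by congr 1; ring
          _ ≤ ‖w - 1‖ + 2 := (norm_add_le _ _).trans (by simp)
          _ ≤ _ := by linarith
      have hw0 : 0 < ‖w + 1‖ := norm_pos_iff.mpr (add_one_ne_zero_of_re_pos (by rw [hwre]; linarith))
      rw [zetaReg, norm_div, zetaOne_of_ne hw1, norm_mul, mul_div_assoc', le_div_iff₀ hw0]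
      calc ‖riemannZeta w‖ * ‖w + 1‖ ≤ ‖riemannZeta w‖ * (3 * ‖w - 1‖) := by gcongr
        _ = _ := by ring
    set X := ‖zetaReg (σ + s.im * I)‖ with hX
    calc (σ - 1) ^ 3 ≤ (σ - 1) ^ 3 * (‖riemannZeta σ‖ ^ 3 * ‖riemannZeta (σ + s.im * I)‖ ^ 4 *
          ‖riemannZeta (σ + (2 * s.im : ℝ) * I)‖) := le_mul_of_one_le_right (by positivity) h341
      _ = (‖riemannZeta σ‖ * (σ - 1)) ^ 3 * ‖riemannZeta (σ + s.im * I)‖ ^ 4 *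
          ‖riemannZeta (σ + (2 * s.im : ℝ) * I)‖ := by ring
      _ ≤ (18 * CZ) ^ 3 * (3 * X) ^ 4 * (18 * CZ * P) := by gcongr
      _ = (54 * CZ) ^ 4 * P ^ 1 * X ^ 4 := by ring
      _ ≤ (54 * CZ) ^ 4 * P ^ 8 * X ^ 4 := by gcongr; norm_num [hP1]
      _ = _ := by rw [hA]; ring

end LowerBoundsZeta

section Decay

open Complex MeasureTheory

lemma iteratedDeriv_vertical {h : ℂ → ℂ} {σ : ℝ} (hh : ∀ t : ℝ, AnalyticAt ℂ h (σ + t * I)) (k : ℕ) :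
    (iteratedDeriv k fun t : ℝ => h (σ + t * I)) =
        (fun t : ℝ => I ^ k * iteratedDeriv k h (σ + t * I)) ∧
      Differentiable ℝ (iteratedDeriv k fun t : ℝ => h (σ + t * I)) := by
  have hderiv : ∀ (k : ℕ) (t : ℝ), HasDerivAt (fun t : ℝ => I ^ k * iteratedDeriv k h (σ + t * I))
      (I ^ (k + 1) * iteratedDeriv (k + 1) h (σ + t * I)) t := by
    intro k t
    have h1 : HasDerivAt (iteratedDeriv k h) (iteratedDeriv (k + 1) h (σ + t * I)) (σ + t * I) := by
      have := ((hh t).iterated_deriv k).differentiableAt.hasDerivAt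
      rw [iteratedDeriv_succ, iteratedDeriv_eq_iterate]
      exact this
    have h2 : HasDerivAt (fun t : ℝ => (σ + t * I : ℂ)) I t := by
      simpa using ((hasDerivAt_id t).ofReal_comp.mul_const I).const_add (σ : ℂ)
    refine ((h1.comp_of_eq t h2 rfl).const_mul (I ^ k)).congr_deriv ?_
    ring
  induction k with
  | zero =>
    have : iteratedDeriv 0 (fun t : ℝ => h (σ + t * I)) =
        fun t : ℝ => I ^ 0 * iteratedDeriv 0 h (σ + t * I) := by
      ext t
      simp [iteratedDeriv_zero]
    exact ⟨this, this ▸ fun t => (hderiv 0 t).differentiableAt⟩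
  | succ k ih =>
    have : iteratedDeriv (k + 1) (fun t : ℝ => h (σ + t * I)) =
        fun t : ℝ => I ^ (k + 1) * iteratedDeriv (k + 1) h (σ + t * I) := by
      rw [iteratedDeriv_succ, ih.1]
      ext t
      exact (hderiv k t).deriv
    exact ⟨this, this ▸ fun t => (hderiv (k + 1) t).differentiableAt⟩

lemma integrable_one_add_sq_rpow : Integrable fun t : ℝ => (1 + t ^ 2) ^ (-(3 / 4) : ℝ) := by
  have := integrable_rpow_neg_one_add_norm_sq (E := ℝ) (μ := volume) (r := 3 / 2) (by simp; norm_num)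
  simp only [Real.norm_eq_abs, sq_abs] at this
  rwa [show (-(3 / 2) / 2 : ℝ) = -(3 / 4) by norm_num] at this

lemma growth_pow_div_le {η Q : ℝ} {n : ℕ} (hQ : 1 ≤ Q) (hn : 2 * η * n ≤ 1 / 2) (s : ℂ) :
    growth η Q s ^ n / (1 + s.im ^ 2) ≤
      8 * Q ^ (2 * η * n) * (1 + s.im ^ 2) ^ (-(3 / 4) : ℝ) := by
  set y : ℝ := 1 + s.im ^ 2 with hy
  have hy1 : 1 ≤ y := by nlinarith [sq_nonneg s.im]
  have hsq : |s.im| + 2 ≤ (8 * y) ^ (1 / 2 : ℝ) := by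
    rw [← Real.sqrt_eq_rpow]
    apply Real.le_sqrt_of_sq_le
    nlinarith [sq_nonneg (|s.im| - 2), sq_abs s.im]
  have h1 : growth η Q s ^ n = Q ^ (2 * η * n) * (|s.im| + 2) ^ (2 * η * n) := by
    rw [growth, ← Real.rpow_natCast, ← Real.rpow_mul (by positivity),
      Real.mul_rpow (by positivity) (by positivity)]
  have h2 : (|s.im| + 2) ^ (2 * η * n) ≤ 8 * y ^ (1 / 4 : ℝ) := by
    calc (|s.im| + 2) ^ (2 * η * n) ≤ (|s.im| + 2) ^ (1 / 2 : ℝ) :=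
          Real.rpow_le_rpow_of_exponent_le (by linarith [abs_nonneg s.im]) hn
      _ ≤ ((8 * y) ^ (1 / 2 : ℝ)) ^ (1 / 2 : ℝ) := by gcongr
      _ = (8 * y) ^ (1 / 4 : ℝ) := by
          rw [← Real.rpow_mul (by positivity)]
          norm_num
      _ = 8 ^ (1 / 4 : ℝ) * y ^ (1 / 4 : ℝ) := Real.mul_rpow (by norm_num) (by positivity)
      _ ≤ 8 ^ (1 : ℝ) * y ^ (1 / 4 : ℝ) := by
          gcongr
          · norm_num
          · norm_num
      _ = _ := by rw [Real.rpow_one]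
  rw [h1, div_le_iff₀ (by positivity)]
  have h3 : y ^ (-(3 / 4) : ℝ) * y = y ^ (1 / 4 : ℝ) := by
    nth_rewrite 2 [← Real.rpow_one y]
    rw [← Real.rpow_add (by positivity)]
    norm_num
  calc Q ^ (2 * η * n) * (|s.im| + 2) ^ (2 * η * n) ≤ Q ^ (2 * η * n) * (8 * y ^ (1 / 4 : ℝ)) := by
        gcongr
    _ = _ := by rw [← h3]; ring

/-- Fourier decay along a vertical line for a function controlled in small discs. -/
lemma norm_fourier_vertical_le {η ρ M Q : ℝ} {k m : ℕ} (hη : 0 < η) (hQ : 1 ≤ Q)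
    (hρ : 0 < ρ) (hM : 0 ≤ M) (hn : 2 * η * (m * (k + 1) : ℕ) ≤ 1 / 2) {h : ℂ → ℂ}
    {σ : ℝ}
    (hh : ∀ s z : ℂ, s.re = σ → ‖z - s‖ ≤ ρ / growth η Q s ^ m →
      DifferentiableAt ℂ h z ∧ ‖h z‖ ≤ M * growth η Q s ^ m / (1 + s.im ^ 2)) (u : ℝ) :
    |u| ^ k * ‖∫ t : ℝ, h (σ + t * I) * cexp (u * t * I)‖ ≤
      (k.factorial * M / ρ ^ k * 8 * ∫ t : ℝ, (1 + t ^ 2) ^ (-(3 / 4) : ℝ)) *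
        Q ^ (2 * η * (m * (k + 1) : ℕ)) := by
  have hline : ∀ t : ℝ, ((σ : ℂ) + t * I).re = σ ∧ ((σ : ℂ) + t * I).im = t := fun t => by simp
  have hG : ∀ s : ℂ, 1 ≤ growth η Q s := fun s => one_le_growth hη hQ s
  have hpos : ∀ s : ℂ, 0 < ρ / growth η Q s ^ m := fun s =>
    div_pos hρ (pow_pos (one_pos.trans_le (hG s)) m)
  have han : ∀ t : ℝ, AnalyticAt ℂ h (σ + t * I) := fun t => by
    refine DifferentiableOn.analyticAt (s := Metric.closedBall (σ + t * I : ℂ)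
      (ρ / growth η Q (σ + t * I) ^ m)) (fun z hz => ?_) (Metric.closedBall_mem_nhds _ (hpos _))
    exact (hh _ z (hline t).1 (mem_closedBall_iff_norm.mp hz)).1.differentiableWithinAt
  have hbound : ∀ j ≤ k, ∀ t : ℝ, ‖iteratedDeriv j (fun t : ℝ => h (σ + t * I)) t‖ ≤
      j.factorial * M / ρ ^ j * (8 * Q ^ (2 * η * (m * (k + 1) : ℕ)) *
        (1 + t ^ 2) ^ (-(3 / 4) : ℝ)) := by
    intro j hj t
    rw [(iteratedDeriv_vertical han j).1, norm_mul, norm_pow, norm_I, one_pow, one_mul]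
    set s : ℂ := σ + t * I with hs
    have hd : DiffContOnCl ℂ h (Metric.ball s (ρ / growth η Q s ^ m)) := by
      refine DifferentiableOn.diffContOnCl fun z hz => ?_
      rw [closure_ball _ (hpos s).ne'] at hz
      exact (hh s z (hline t).1 (mem_closedBall_iff_norm.mp hz)).1.differentiableWithinAt
    refine (norm_iteratedDeriv_le_of_forall_mem_sphere_norm_le j (hpos s) hd fun z hz =>
      (hh s z (hline t).1 (mem_sphere_iff_norm.mp hz).le).2).trans ?_
    have hg0 : 0 < growth η Q s := one_pos.trans_le (hG s)
    have hkey := growth_pow_div_le hQ hn s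
    rw [(hline t).2] at hkey ⊢
    calc j.factorial * (M * growth η Q s ^ m / (1 + t ^ 2)) / (ρ / growth η Q s ^ m) ^ j
        = j.factorial * M / ρ ^ j * (growth η Q s ^ (m * (j + 1)) / (1 + t ^ 2)) := by
          rw [div_pow, ← pow_mul, mul_add, mul_one, pow_add]
          field_simp
      _ ≤ j.factorial * M / ρ ^ j * (growth η Q s ^ (m * (k + 1)) / (1 + t ^ 2)) := by
          gcongr
          exact hG s
      _ ≤ _ := by gcongr
  have hcd : ContDiff ℝ k fun t : ℝ => h (σ + t * I) := by
    have := contDiff_of_differentiable_iteratedDeriv (𝕜 := ℝ) (n := (k : ℕ∞))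
      fun j _ => (iteratedDeriv_vertical han j).2
    exact_mod_cast this
  have hintg : ∀ j ≤ k, Integrable (iteratedDeriv j fun t : ℝ => h (σ + t * I)) := fun j hj =>
    ((integrable_one_add_sq_rpow.const_mul _).const_mul _).mono'
      ((iteratedDeriv_vertical han j).2.continuous.aestronglyMeasurable)
      (ae_of_all _ (hbound j hj))
  refine (norm_integral_mul_exp_le hcd hintg u).trans ?_
  refine (integral_mono_of_nonneg (ae_of_all _ fun _ => norm_nonneg _)
    ((integrable_one_add_sq_rpow.const_mul _).const_mul _) (ae_of_all _ (hbound k le_rfl))).trans_eq ?_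
  rw [integral_const_mul, integral_const_mul]
  ring

/-- The logarithmically weighted summatory function. -/
noncomputable def logSum (a : ℕ → ℂ) (x : ℝ) : ℂ :=
  ∑ n ∈ Finset.Icc 1 ⌊x⌋₊, a n * Real.log (x / n)

lemma tsum_mul_max_log {a : ℕ → ℂ} {x : ℝ} (hx : 0 < x) :
    ∑' n, a n * (2 * Real.pi * ((max (Real.log (x / n)) 0 : ℝ) : ℂ)) =
      2 * Real.pi * logSum a x := by
  rw [tsum_eq_sum (s := Finset.Icc 1 ⌊x⌋₊), logSum, Finset.mul_sum]
  · refine Finset.sum_congr rfl fun n hn => ?_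
    rw [Finset.mem_Icc] at hn
    have hn0 : (0 : ℝ) < n := by exact_mod_cast hn.1
    have : 0 ≤ Real.log (x / n) := by
      refine Real.log_nonneg ?_
      rw [le_div_iff₀ hn0, one_mul]
      exact (Nat.le_floor_iff hx.le).mp hn.2
    rw [max_eq_left this]
    ring
  · intro n hn
    have : Real.log (x / n) ≤ 0 := by
      rcases Nat.eq_zero_or_pos n with rfl | hn0
      · simp
      · have hxn : x < n := by
          rw [Finset.mem_Icc, not_and, not_le] at hn
          exact Nat.lt_of_floor_lt (hn hn0)
        refine Real.log_nonpos (by positivity) ?_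
        rw [div_le_one (by positivity)]
        exact hxn.le
    rw [max_eq_right this]
    simp

/-- Perron's formula with a logarithmic weight. -/
lemma logSum_eq_integral {a : ℕ → ℂ} (ha0 : a 0 = 0) {σ x : ℝ} (hσ : 0 < σ) (hx : 0 < x)
    (ha : LSeriesSummable a σ) :
    2 * Real.pi * logSum a x = ∫ t : ℝ, LSeries a (σ + t * I) *
      cexp (Real.log x * (σ + t * I)) / (σ + t * I) ^ 2 := by
  have hne : ∀ t : ℝ, (σ + t * I : ℂ) ≠ 0 := fun t h => by
    have := congrArg re h
    simp at this
    linarith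
  set F : ℕ → ℝ → ℂ := fun n t =>
    a n * (cexp ((Real.log (x / n) : ℝ) * (σ + t * I)) / (σ + t * I) ^ 2) with hF
  have hterm : ∀ n t, F n t = LSeries.term a (σ + t * I) n *
      (cexp (Real.log x * (σ + t * I)) / (σ + t * I) ^ 2) := by
    intro n t
    rcases Nat.eq_zero_or_pos n with rfl | hn
    · simp [hF, ha0]
    · have hn0 : (n : ℂ) ≠ 0 := by exact_mod_cast hn.ne'
      have hnr : (0 : ℝ) < n := by exact_mod_cast hn
      rw [LSeries.term_of_ne_zero hn.ne', cpow_def_of_ne_zero hn0]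
      simp only [hF]
      rw [Real.log_div hx.ne' hnr.ne', ← natCast_log, ofReal_sub, sub_mul, Complex.exp_sub]
      ring
  have hnorm : ∀ n t, ‖F n t‖ = ‖a n‖ * Real.exp (Real.log (x / n) * σ) *
      ‖1 / ((σ : ℂ) + t * I) ^ 2‖ := by
    intro n t
    simp only [hF, norm_mul, norm_div, Complex.norm_exp, norm_one]
    have : (((Real.log (x / n) : ℝ) : ℂ) * (σ + t * I)).re = Real.log (x / n) * σ := by simp
    rw [this]
    ring
  have hkint := integrable_one_div_sq_vertical hσ
  have hmeas : ∀ n, Continuous (F n) := fun n => by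
    simp only [hF]
    refine continuous_const.mul (Continuous.div (by fun_prop) (by fun_prop) fun t => ?_)
    exact pow_ne_zero 2 (hne t)
  have hFint : ∀ n, Integrable (F n) := fun n =>
    (hkint.norm.const_mul (‖a n‖ * Real.exp (Real.log (x / n) * σ))).mono'
      (hmeas n).aestronglyMeasurable (ae_of_all _ fun t => (hnorm n t).le)
  have hsum : Summable fun n => ∫ t, ‖F n t‖ := by
    simp_rw [hnorm, integral_const_mul]
    refine Summable.mul_right _ ?_
    have h1 := (summable_norm_iff.mpr ha).mul_left (Real.exp (Real.log x * σ))
    refine h1.congr fun n => ?_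
    rcases Nat.eq_zero_or_pos n with rfl | hn
    · simp [ha0]
    · have hnr : (0 : ℝ) < n := by exact_mod_cast hn
      rw [LSeries.norm_term_eq, if_neg hn.ne', ofReal_re, Real.log_div hx.ne' hnr.ne', sub_mul,
        Real.exp_sub, Real.rpow_def_of_pos hnr]
      ring
  have hkey := (hasSum_integral_of_summable_integral_norm hFint hsum).tsum_eq
  rw [← tsum_mul_max_log hx]
  have hleft : ∀ n, ∫ t, F n t =
      a n * (2 * Real.pi * ((max (Real.log (x / n)) 0 : ℝ) : ℂ)) := fun n => by
    simp only [hF]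
    rw [integral_const_mul, integral_exp_div_sq hσ]
  simp_rw [hleft] at hkey
  rw [hkey]
  refine integral_congr_ae (ae_of_all _ fun t => ?_)
  simp only [hterm]
  rw [tsum_mul_right, LSeries, mul_div_assoc]

/-- Bound for logarithmically weighted sums in terms of the Fourier transform along
the line `Re s = 1 + 1 / (1 + log x)`. -/
lemma norm_logSum_le {a : ℕ → ℂ} (ha0 : a 0 = 0) {h : ℂ → ℂ} {x : ℝ} (hx : 1 ≤ x)
    (ha : LSeriesSummable a ((1 + 1 / (1 + Real.log x) : ℝ) : ℂ))
    (hh : ∀ t : ℝ, h ((1 + 1 / (1 + Real.log x) : ℝ) + t * I) =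
      LSeries a ((1 + 1 / (1 + Real.log x) : ℝ) + t * I) /
        ((1 + 1 / (1 + Real.log x) : ℝ) + t * I) ^ 2) :
    ‖logSum a x‖ ≤ 3 * x *
      ‖∫ t : ℝ, h ((1 + 1 / (1 + Real.log x) : ℝ) + t * I) * cexp (Real.log x * t * I)‖ := by
  have hl : 0 ≤ Real.log x := Real.log_nonneg hx
  set σ : ℝ := 1 + 1 / (1 + Real.log x) with hσ
  have hσ0 : 0 < σ := by positivity
  have h1 := logSum_eq_integral ha0 hσ0 (x := x) (by linarith) ha
  have h2 : ∀ t : ℝ, LSeries a (σ + t * I) * cexp (Real.log x * (σ + t * I)) / (σ + t * I) ^ 2 =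
      (Real.exp (Real.log x * σ) : ℂ) * (h (σ + t * I) * cexp (Real.log x * t * I)) := by
    intro t
    rw [hh, mul_add, Complex.exp_add]
    push_cast
    rw [← mul_assoc (Real.log x : ℂ)]
    ring
  simp_rw [h2] at h1
  rw [integral_const_mul] at h1
  have h3 := congrArg norm h1
  rw [norm_mul, norm_mul, norm_mul, norm_real, norm_real, Real.norm_eq_abs, Real.norm_eq_abs,
    abs_of_pos Real.pi_pos, Real.abs_exp, Complex.norm_two] at h3
  have h4 : Real.exp (Real.log x * σ) ≤ 3 * x := by
    rw [hσ, mul_add, mul_one, Real.exp_add, Real.exp_log (by linarith), mul_comm]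
    gcongr
    refine (Real.exp_le_exp.mpr (?_ : Real.log x * (1 / (1 + Real.log x)) ≤ 1)).trans
      (Real.exp_one_lt_d9.le.trans (by norm_num))
    rw [mul_one_div, div_le_one (by positivity)]
    linarith
  calc ‖logSum a x‖ ≤ 2 * Real.pi * ‖logSum a x‖ :=
        le_mul_of_one_le_left (norm_nonneg _) (by linarith [Real.pi_gt_three])
    _ ≤ _ := by rw [h3]; gcongr

end Decay

section SiegelWalfisz

open Complex DirichletCharacter ArithmeticFunction

lemma norm_div_sq_le {s z : ℂ} (hs : 1 ≤ s.re) (hz : ‖z - s‖ ≤ 1 / 2) (w : ℂ) :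
    z ≠ 0 ∧ ‖w / z ^ 2‖ ≤ 4 * ‖w‖ / (1 + s.im ^ 2) := by
  have h1 : 1 + s.im ^ 2 ≤ ‖s‖ ^ 2 := by
    rw [Complex.sq_norm, normSq_apply]
    nlinarith
  have h2 : 1 ≤ ‖s‖ := hs.trans (re_le_norm s)
  have h3 : ‖s‖ ≤ 2 * ‖z‖ := by
    have : ‖s‖ ≤ ‖z‖ + ‖z - s‖ := by
      rw [← norm_neg (z - s)]
      simpa using norm_add_le z (-(z - s))
    linarith
  have h4 : 0 < ‖z‖ := by linarith
  refine ⟨norm_pos_iff.mp h4, ?_⟩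
  rw [norm_div, norm_pow, div_le_div_iff₀ (by positivity) (by positivity)]
  have h5 : 1 + s.im ^ 2 ≤ 4 * ‖z‖ ^ 2 := h1.trans (by nlinarith)
  nlinarith [norm_nonneg w]

lemma one_le_rpow_log {x A : ℝ} {k : ℕ} (hx : 1 ≤ Real.log x) (hk : A + 1 ≤ k) :
    Real.log x * (Real.log x ^ k)⁻¹ ≤ Real.log x ^ (-A) := by
  have h0 : 0 < Real.log x := by linarith
  rw [← Real.rpow_natCast, ← Real.rpow_neg h0.le]
  nth_rewrite 1 [← Real.rpow_one (Real.log x)]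
  rw [← Real.rpow_add h0]
  exact Real.rpow_le_rpow_of_exponent_le hx (by linarith)

/-- The sequence `χ Λ`. -/
noncomputable def twist {q : ℕ} (χ : DirichletCharacter ℂ q) (n : ℕ) : ℂ := χ n * (Λ n : ℝ)

lemma twist_zero {q : ℕ} (χ : DirichletCharacter ℂ q) : twist χ 0 = 0 := by simp [twist]

lemma LSeriesSummable_twist {q : ℕ} (χ : DirichletCharacter ℂ q) {s : ℂ} (hs : 1 < s.re) :
    LSeriesSummable (twist χ) s :=
  LSeriesSummable_twist_vonMangoldt χ hs

lemma LSeries_twist {q : ℕ} [NeZero q] (χ : DirichletCharacter ℂ q) {s : ℂ} (hs : 1 < s.re) :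
    LSeries (twist χ) s = -(deriv χ.LFunction s / χ.LFunction s) := by
  rw [deriv_LFunction_eq_deriv_LSeries χ hs, LFunction_eq_LSeries χ hs, ← neg_div]
  exact LSeries_twist_vonMangoldt_eq χ hs

/-- Bounds in discs of radius a small power of `Q (|t| + 2)` give savings of
powers of `log x`. -/
lemma exists_norm_logSum_le_of_disc (A : ℝ) {B : ℝ} (hB : 0 < B) :
    ∃ η : ℝ, 0 < η ∧ η ≤ 1 / 2 ∧ ∀ ρ M : ℝ, 0 < ρ → 0 < M → ∃ C : ℝ, 0 < C ∧
      ∀ (a : ℕ → ℂ) (h : ℂ → ℂ) (x Q : ℝ), 1 ≤ Q → Q ≤ Real.log x ^ B → 1 ≤ Real.log x → 1 ≤ x →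
        a 0 = 0 → (∀ s : ℂ, 1 < s.re → LSeriesSummable a s) →
        (∀ s : ℂ, 1 < s.re → h s = LSeries a s / s ^ 2) →
        (∀ s z : ℂ, 1 < s.re → s.re ≤ 2 → ‖z - s‖ ≤ ρ / growth η Q s ^ 12 →
          DifferentiableAt ℂ h z ∧ ‖h z‖ ≤ M * growth η Q s ^ 12 / (1 + s.im ^ 2)) →
        ‖logSum a x‖ ≤ C * x * Real.log x ^ (-A) := by
  set k : ℕ := ⌈A + 1⌉₊ with hk
  have hkA : A + 1 ≤ k := Nat.le_ceil _
  set η : ℝ := 1 / (48 * (k + 1) * (1 + B)) with hη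
  have hη0 : 0 < η := by positivity
  have hη2 : η ≤ 1 / 2 := by
    rw [hη, div_le_div_iff₀ (by positivity) (by positivity)]
    have : (0 : ℝ) ≤ k := Nat.cast_nonneg k
    nlinarith [mul_nonneg this hB.le]
  have hexp : 2 * η * ((12 * (k + 1) : ℕ) : ℝ) = 1 / (2 * (1 + B)) := by
    rw [hη]
    push_cast
    field_simp
    norm_num
  have hexp2 : 1 / (2 * (1 + B)) ≤ 1 / 2 := by
    rw [div_le_div_iff₀ (by positivity) (by positivity)]
    linarith
  refine ⟨η, hη0, hη2, fun ρ M hρ0 hM0 => ?_⟩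
  set K : ℝ := k.factorial * M / ρ ^ k * 8 * ∫ t : ℝ, (1 + t ^ 2) ^ (-(3 / 4) : ℝ) with hK
  have hK0 : 0 ≤ K := mul_nonneg (by positivity)
    (MeasureTheory.integral_nonneg fun t => by positivity)
  refine ⟨3 * K + 1, by positivity, fun a h x Q hQ1 hQ hlog hx ha0 hsum hser hdisc => ?_⟩
  have hlog0 : 0 < Real.log x := by linarith
  set σ : ℝ := 1 + 1 / (1 + Real.log x) with hσ
  have hσ1 : 1 < σ := by
    have : 0 < 1 / (1 + Real.log x) := by positivity
    linarith
  have hσ2 : σ ≤ 2 := by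
    have : 1 / (1 + Real.log x) ≤ 1 := by
      rw [div_le_one (by positivity)]
      linarith
    linarith
  have hline : ∀ t : ℝ, (1 : ℝ) < ((σ : ℂ) + t * I).re := fun t => by simpa using hσ1
  have hdecay := norm_fourier_vertical_le (k := k) (m := 12) hη0 hQ1 hρ0 hM0.le
    (by rw [hexp]; exact hexp2) (fun s z hs hz => hdisc s z (hs.symm ▸ hσ1) (hs.symm ▸ hσ2) hz)
    (Real.log x)
  rw [hexp, ← hK, abs_of_pos hlog0] at hdecay
  have hqlog : Q ^ (1 / (2 * (1 + B))) ≤ Real.log x := by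
    calc Q ^ (1 / (2 * (1 + B))) ≤ (Real.log x ^ B) ^ (1 / (2 * (1 + B))) := by gcongr
      _ = Real.log x ^ (B * (1 / (2 * (1 + B)))) := by rw [← Real.rpow_mul hlog0.le]
      _ ≤ Real.log x ^ (1 : ℝ) := by
          refine Real.rpow_le_rpow_of_exponent_le hlog ?_
          rw [mul_one_div, div_le_one (by positivity)]
          linarith
      _ = _ := Real.rpow_one _
  refine (norm_logSum_le (h := h) ha0 hx (hsum _ (by rw [ofReal_re]; exact hσ1))
    fun t => hser _ (hline t)).trans ?_
  have hI : ‖∫ t : ℝ, h (σ + t * I) * cexp (Real.log x * t * I)‖ ≤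
      K * (Real.log x * (Real.log x ^ k)⁻¹) := by
    rw [← mul_assoc, ← div_eq_mul_inv, le_div_iff₀ (by positivity), mul_comm]
    exact hdecay.trans (by gcongr)
  calc 3 * x * ‖∫ t : ℝ, h (σ + t * I) * cexp (Real.log x * t * I)‖
      ≤ 3 * x * (K * Real.log x ^ (-A)) := by
        gcongr
        exact hI.trans (by gcongr; exact one_le_rpow_log hlog hkA)
    _ = 3 * K * x * Real.log x ^ (-A) := by ring
    _ ≤ _ := by gcongr; linarith

/-- The **Siegel–Walfisz theorem** for primitive characters, with a logarithmic weight. -/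
theorem siegel_walfisz (A : ℝ) {B : ℝ} (hB : 0 < B) :
    ∃ C : ℝ, 0 < C ∧ ∀ (x : ℝ) (q : ℕ) [NeZero q] (χ : DirichletCharacter ℂ q), 2 ≤ x →
      χ.IsPrimitive → χ ≠ 1 → (q : ℝ) ≤ Real.log x ^ B →
      ‖logSum (twist χ) x‖ ≤ C * x * Real.log x ^ (-A) := by
  obtain ⟨η, hη0, hη2, hmain⟩ := exists_norm_logSum_le_of_disc A hB
  obtain ⟨C, hC, hU⟩ := exists_norm_LFunction_le_growth hη0 hη2
  obtain ⟨c, hc, hc1, hL⟩ := exists_le_norm_LFunction hη0 hη2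
  set ρ : ℝ := c * η / (16 * C) with hρ
  have hρ0 : 0 < ρ := by positivity
  have hρ1 : ρ ≤ 1 / 2 := by
    rw [hρ, div_le_iff₀ (by positivity)]
    nlinarith
  set M : ℝ := 4 * (16 * C / (c * η)) with hM
  have hM0 : 0 < M := by positivity
  obtain ⟨K, hK, hbound⟩ := hmain ρ M hρ0 hM0
  refine ⟨K, hK, fun x q _ χ hx hprim hχ hq => ?_⟩
  have hq1 : (1 : ℝ) ≤ q := by exact_mod_cast Nat.one_le_iff_ne_zero.mpr (NeZero.ne q)
  have hlog0 : 0 < Real.log x := Real.log_pos (by linarith)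
  have hlog : 1 ≤ Real.log x := by
    by_contra! h
    have := Real.rpow_lt_one hlog0.le h hB
    linarith
  have hF : Differentiable ℂ χ.LFunction := differentiable_LFunction hχ
  refine hbound (twist χ) (fun z => -(deriv χ.LFunction z / χ.LFunction z) / z ^ 2) x q hq1 hq hlog
    (by linarith) (twist_zero χ) (fun s hs => LSeriesSummable_twist χ hs)
    (fun s hs => by rw [LSeries_twist χ hs]) fun s z hs1 hs2 hz => ?_
  have hld := norm_logDeriv_le_growth hη0 hη2 hC hq1 hc hc1 hF.differentiableOn (hU q χ hχ)
    (fun s => hL q χ hprim hχ s) hs1 hs2 hz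
  have hP : 1 ≤ growth η q s := one_le_growth hη0 hq1 s
  have hz2 : ‖z - s‖ ≤ 1 / 2 := (hz.trans (div_le_self hρ0.le (one_le_pow₀ hP))).trans hρ1
  obtain ⟨hz0, hdiv⟩ := norm_div_sq_le hs1.le hz2 (-(deriv χ.LFunction z / χ.LFunction z))
  refine ⟨?_, hdiv.trans ?_⟩
  · exact (((hF.analyticAt z).deriv.differentiableAt.div hF.differentiableAt hld.1).neg).div
      (by fun_prop) (pow_ne_zero 2 hz0)
  · rw [norm_neg]
    refine div_le_div_of_nonneg_right ?_ (by positivity)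
    calc 4 * ‖deriv χ.LFunction z / χ.LFunction z‖
        ≤ 4 * (16 * C / (c * η) * growth η q s ^ 12) := by gcongr; exact hld.2
      _ = _ := by rw [hM]; ring

lemma exists_norm_dslope_zetaOne_le {η : ℝ} (hη : 0 < η) (hη2 : η ≤ 1 / 2) :
    ∃ C : ℝ, 1 ≤ C ∧ ∀ s : ℂ, 1 - η ≤ s.re → s.re ≤ 4 → ‖dslope zetaOne 1 s‖ ≤ C * growth η 1 s := by
  obtain ⟨C, hC, h⟩ := exists_norm_zetaOne_le hη hη2
  have hK : IsCompact (Set.Icc (0 : ℝ) 4 ×ℂ Set.Icc (-1 : ℝ) 1) := isCompact_Icc.reProdIm isCompact_Icc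
  have hcont : Continuous (dslope zetaOne 1) :=
    continuous_iff_continuousAt.mpr fun s => (continuousOn_dslope univ_mem).mpr
      ⟨differentiable_zetaOne.continuous.continuousOn, differentiable_zetaOne 1⟩ |>.continuousAt
        univ_mem
  obtain ⟨C', hC'⟩ := hK.exists_bound_of_continuousOn hcont.continuousOn
  refine ⟨max 1 (max C' (3 * C + 1)), le_max_left _ _, fun s h1 h2 => ?_⟩
  have hP : 1 ≤ growth η 1 s := one_le_growth hη le_rfl s
  rcases le_or_gt |s.im| 1 with him | him
  · calc ‖dslope zetaOne 1 s‖ ≤ C' :=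
          hC' s (mem_reProdIm.mpr ⟨⟨by linarith, h2⟩, abs_le.mp him⟩)
      _ ≤ max 1 (max C' (3 * C + 1)) := (le_max_left _ _).trans (le_max_right _ _)
      _ ≤ _ := le_mul_of_one_le_right (by positivity) hP
  · have hs1 : s ≠ 1 := fun h => by norm_num [h] at him
    have h3 : |s.im| ≤ ‖s - 1‖ := by simpa using abs_im_le_norm (s - 1)
    have h4 : 0 < ‖s - 1‖ := by linarith
    have hz := h s h1 h2
    rw [Real.rpow_add (by positivity), Real.rpow_one] at hz
    have hg : (|s.im| + 2) ^ (2 * η) = growth η 1 s := by rw [growth, one_mul]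
    rw [hg] at hz
    rw [dslope_of_ne _ hs1, slope_def_field, norm_div, div_le_iff₀ h4, zetaOne_one]
    calc ‖zetaOne s - 1‖ ≤ ‖zetaOne s‖ + 1 := (norm_sub_le _ _).trans (by simp)
      _ ≤ C * ((3 * ‖s - 1‖) * growth η 1 s) + 1 * ‖s - 1‖ * growth η 1 s := by
          refine add_le_add (hz.trans ?_) ?_
          · gcongr
            linarith
          · nlinarith
      _ = (3 * C + 1) * growth η 1 s * ‖s - 1‖ := by ring
      _ ≤ _ := by
          gcongr
          exact (le_max_right _ _).trans (le_max_right _ _)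

/-- The sequence `Λ - 1` (vanishing at `0`). -/
noncomputable def vonMangoldtSubOne (n : ℕ) : ℂ := if n = 0 then 0 else (Λ n : ℝ) - 1

lemma vonMangoldtSubOne_eq {n : ℕ} (hn : n ≠ 0) :
    vonMangoldtSubOne n = ((fun n : ℕ => ((Λ n : ℝ) : ℂ)) - 1) n := by
  simp [vonMangoldtSubOne, hn]

lemma LSeriesSummable_vonMangoldtSubOne {s : ℂ} (hs : 1 < s.re) :
    LSeriesSummable vonMangoldtSubOne s :=
  (LSeriesSummable_congr s fun hn => vonMangoldtSubOne_eq hn).mpr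
    ((LSeriesSummable_vonMangoldt hs).sub (LSeriesSummable_one_iff.mpr hs))

lemma LSeries_vonMangoldtSubOne {s : ℂ} (hs : 1 < s.re) :
    LSeries vonMangoldtSubOne s =
      -(deriv zetaReg s / zetaReg s) - 1 / (s + 1) - dslope zetaOne 1 s := by
  have hs1 : s ≠ 1 := fun h => by simp [h] at hs
  have hs1' : s - 1 ≠ 0 := sub_ne_zero.mpr hs1
  have hsp : s + 1 ≠ 0 := add_one_ne_zero_of_re_pos (by linarith)
  have hζ : riemannZeta s ≠ 0 := riemannZeta_ne_zero_of_one_le_re hs.le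
  have hev : zetaReg =ᶠ[nhds s] fun z => (z - 1) * riemannZeta z / (z + 1) := by
    filter_upwards [isOpen_ne.mem_nhds hs1] with z hz
    rw [zetaReg, zetaOne_of_ne hz]
  have hd : HasDerivAt (fun z => (z - 1) * riemannZeta z / (z + 1))
      (((1 * riemannZeta s + (s - 1) * deriv riemannZeta s) * (s + 1) -
        (s - 1) * riemannZeta s * 1) / (s + 1) ^ 2) s :=
    (((hasDerivAt_id s).sub_const 1).mul (differentiableAt_riemannZeta hs1).hasDerivAt).div
      ((hasDerivAt_id s).add_const 1) hsp
  rw [LSeries_congr (fun hn => vonMangoldtSubOne_eq hn) s,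
    LSeries_sub (LSeriesSummable_vonMangoldt hs) (LSeriesSummable_one_iff.mpr hs),
    LSeries_vonMangoldt_eq_deriv_riemannZeta_div hs, LSeries_one_eq_riemannZeta hs,
    hev.deriv_eq, hd.deriv, hev.eq_of_nhds, dslope_of_ne _ hs1, slope_def_field, zetaOne_one,
    zetaOne_of_ne hs1]
  field_simp
  ring

/-- The prime number theorem with a logarithmic weight, for `Λ - 1`. -/
theorem exists_norm_logSum_vonMangoldtSubOne_le (A : ℝ) :
    ∃ C : ℝ, 0 < C ∧ ∀ x : ℝ, 1 ≤ Real.log x → 1 ≤ x →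
      ‖logSum vonMangoldtSubOne x‖ ≤ C * x * Real.log x ^ (-A) := by
  obtain ⟨η, hη0, hη2, hmain⟩ := exists_norm_logSum_le_of_disc A one_pos
  obtain ⟨C, hC, hU⟩ := exists_norm_zetaReg_le_growth hη0 hη2
  obtain ⟨c, hc, hc1, hL⟩ := exists_le_norm_zetaReg hη0 hη2
  obtain ⟨D, hD, hDU⟩ := exists_norm_dslope_zetaOne_le hη0 hη2
  set ρ : ℝ := c * η / (16 * C) with hρ
  have hρ0 : 0 < ρ := by positivity
  have hρη : ρ ≤ η / 2 := by
    rw [hρ, div_le_iff₀ (by positivity)]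
    nlinarith [mul_le_mul hc1 hC zero_le_one zero_le_one]
  set M : ℝ := 4 * (16 * C / (c * η) + 1 + 2 * D) with hM
  have hM0 : 0 < M := by positivity
  obtain ⟨K, hK, hbound⟩ := hmain ρ M hρ0 hM0
  refine ⟨K, hK, fun x hlog hx => ?_⟩
  refine hbound vonMangoldtSubOne
    (fun z => (-(deriv zetaReg z / zetaReg z) - 1 / (z + 1) - dslope zetaOne 1 z) / z ^ 2) x 1
    le_rfl (by rwa [Real.rpow_one]) hlog hx (by simp [vonMangoldtSubOne])
    (fun s hs => LSeriesSummable_vonMangoldtSubOne hs)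
    (fun s hs => by rw [LSeries_vonMangoldtSubOne hs]) fun s z hs1 hs2 hz => ?_
  have hld := norm_logDeriv_le_growth hη0 hη2 hC le_rfl hc hc1 differentiableOn_zetaReg hU
    (fun s => hL s) hs1 hs2 hz
  have hP : 1 ≤ growth η 1 s := one_le_growth hη0 le_rfl s
  have hz1 : ‖z - s‖ ≤ η / 2 := (hz.trans (div_le_self hρ0.le (one_le_pow₀ hP))).trans hρη
  have hre := abs_le.mp (abs_re_sub_le_of_norm_sub_le hz1)
  have him := abs_im_le_of_norm_sub_le hz1
  have hz0 : 0 < z.re := by linarith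
  have hreg : AnalyticAt ℂ zetaReg z := differentiableOn_zetaReg.analyticAt
    ((isOpen_lt continuous_const continuous_re).mem_nhds hz0)
  have hds : DifferentiableAt ℂ (dslope zetaOne 1) z :=
    ((Complex.differentiableOn_dslope univ_mem).mpr
      differentiable_zetaOne.differentiableOn).differentiableAt univ_mem
  have hzp : z + 1 ≠ 0 := add_one_ne_zero_of_re_pos hz0
  obtain ⟨hzne, hdiv⟩ := norm_div_sq_le hs1.le (hz1.trans (by linarith))
    (-(deriv zetaReg z / zetaReg z) - 1 / (z + 1) - dslope zetaOne 1 z)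
  refine ⟨?_, hdiv.trans ?_⟩
  · exact ((((hreg.deriv.differentiableAt.div hreg.differentiableAt hld.1).neg).sub
      ((differentiableAt_const _).div (by fun_prop) hzp)).sub hds).div
      (by fun_prop) (pow_ne_zero 2 hzne)
  · refine div_le_div_of_nonneg_right ?_ (by positivity)
    have h1 : ‖1 / (z + 1)‖ ≤ 1 * growth η 1 s ^ 12 := by
      have : 1 ≤ ‖z + 1‖ := by
        have := re_le_norm (z + 1)
        simp at this
        linarith
      rw [norm_div, norm_one, one_mul]
      exact (div_le_one_of_le₀ this (norm_nonneg _)).trans (one_le_pow₀ hP)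
    have h2 : ‖dslope zetaOne 1 z‖ ≤ 2 * D * growth η 1 s ^ 12 := by
      calc ‖dslope zetaOne 1 z‖ ≤ D * growth η 1 z := hDU z (by linarith) (by linarith)
        _ ≤ D * (2 * growth η 1 s) := by
            gcongr
            exact growth_le_two_mul hη0 hη2 le_rfl (by linarith [abs_nonneg s.im])
        _ ≤ D * (2 * growth η 1 s ^ 12) := by
            gcongr
            exact le_self_pow₀ hP (by norm_num)
        _ = _ := by ring
    have h3 : ‖-(deriv zetaReg z / zetaReg z) - 1 / (z + 1) - dslope zetaOne 1 z‖ ≤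
        16 * C / (c * η) * growth η 1 s ^ 12 + 1 * growth η 1 s ^ 12 + 2 * D * growth η 1 s ^ 12 :=
      (norm_sub_le _ _).trans (add_le_add ((norm_sub_le _ _).trans
        (add_le_add (by rw [norm_neg]; exact hld.2) h1)) h2)
    calc _ ≤ 4 * (16 * C / (c * η) * growth η 1 s ^ 12 + 1 * growth η 1 s ^ 12 +
          2 * D * growth η 1 s ^ 12) := by gcongr
      _ = _ := by rw [hM]; ring

end SiegelWalfisz

section PrimeNumberTheorem

open Complex ArithmeticFunction

lemma rpow_le_exp {b t : ℝ} (hb : 0 < b) (ht : 0 ≤ t) : t ^ b ≤ b ^ b * Real.exp t := by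
  have h1 : t / b ≤ Real.exp (t / b) := by linarith [Real.add_one_le_exp (t / b)]
  calc t ^ b = (b * (t / b)) ^ b := by rw [mul_div_cancel₀ _ hb.ne']
    _ = b ^ b * (t / b) ^ b := Real.mul_rpow hb.le (by positivity)
    _ ≤ b ^ b * Real.exp (t / b) ^ b := by gcongr
    _ = _ := by rw [← Real.exp_mul, div_mul_cancel₀ _ hb.ne']

lemma log_rpow_le {b x : ℝ} (hb : 0 < b) (hx : 1 ≤ x) : Real.log x ^ b ≤ b ^ b * x := by
  have := rpow_le_exp hb (Real.log_nonneg hx)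
  rwa [Real.exp_log (by linarith)] at this

lemma log_factorial_le (n : ℕ) (hn : 1 ≤ n) :
    Real.log n.factorial ≤ n * Real.log n - n + Real.log n + 1 := by
  induction n, hn using Nat.le_induction with
  | base => simp
  | succ n hn ih =>
    have hn0 : (0 : ℝ) < n := by exact_mod_cast hn
    have h1 : Real.log (n / (n + 1)) ≤ n / (n + 1) - 1 := Real.log_le_sub_one_of_pos (by positivity)
    rw [Real.log_div (by positivity) (by positivity)] at h1
    have h2 : (n + 1 : ℝ) * (n / (n + 1) - 1) = -1 := by field_simp; ring
    have h3 := mul_le_mul_of_nonneg_left h1 (show (0 : ℝ) ≤ n + 1 by positivity)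
    rw [h2] at h3
    rw [Nat.factorial_succ]
    push_cast
    rw [Real.log_mul (by positivity) (by positivity)]
    linarith

lemma le_log_factorial (n : ℕ) (hn : 1 ≤ n) :
    n * Real.log n - n ≤ Real.log n.factorial := by
  have hn0 : (0 : ℝ) < n := by exact_mod_cast hn
  have h := Real.pow_div_factorial_le_exp (n : ℝ) hn0.le n
  have h2 := Real.log_le_log (by positivity) h
  rw [Real.log_exp, Real.log_div (by positivity) (by positivity), Real.log_pow] at h2
  linarith

lemma sum_log_div (x : ℝ) (hx : 1 ≤ x) :
    |∑ n ∈ Finset.Icc 1 ⌊x⌋₊, Real.log (x / n) - x| ≤ Real.log x + 2 := by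
  set N := ⌊x⌋₊ with hN
  have hN1 : 1 ≤ N := Nat.le_floor (by simpa using hx)
  have hN0 : (0 : ℝ) < N := by exact_mod_cast hN1
  have hNx : (N : ℝ) ≤ x := Nat.floor_le (by linarith)
  have hxN : x < N + 1 := Nat.lt_floor_add_one x
  have hsum : ∑ n ∈ Finset.Icc 1 N, Real.log (x / n) = N * Real.log x - Real.log N.factorial := by
    rw [← Finset.prod_Ico_id_eq_factorial, Finset.Ico_add_one_right_eq_Icc]
    push_cast
    rw [Real.log_prod (fun i hi => by
      have := (Finset.mem_Icc.mp hi).1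
      positivity)]
    rw [show (N : ℝ) * Real.log x = ∑ n ∈ Finset.Icc 1 N, Real.log x by simp,
      ← Finset.sum_sub_distrib]
    refine Finset.sum_congr rfl fun n hn => ?_
    have := (Finset.mem_Icc.mp hn).1
    exact Real.log_div (by linarith) (by positivity)
  have h1 := log_factorial_le N hN1
  have h2 := le_log_factorial N hN1
  have h3 : Real.log N ≤ Real.log x := Real.log_le_log hN0 hNx
  have h4 : Real.log (x / N) ≤ x / N - 1 := Real.log_le_sub_one_of_pos (by positivity)
  rw [Real.log_div (by positivity) (by positivity)] at h4
  have h5 := mul_le_mul_of_nonneg_left h4 hN0.le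
  rw [mul_sub, mul_sub, mul_div_cancel₀ _ hN0.ne'] at h5
  have h6 := mul_le_mul_of_nonneg_left h3 hN0.le
  have h7 : 0 ≤ Real.log x := Real.log_nonneg hx
  rw [hsum, abs_le]
  constructor <;> linarith

/-- The prime number theorem with a logarithmic weight. -/
theorem exists_abs_sum_vonMangoldt_log_le (A : ℝ) : ∃ C : ℝ, 0 < C ∧ ∀ x : ℝ, 1 ≤ Real.log x →
    1 ≤ x → |∑ n ∈ Finset.Icc 1 ⌊x⌋₊, Λ n * Real.log (x / n) - x| ≤
      C * x * Real.log x ^ (-A) := by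
  obtain ⟨C, hC, h⟩ := exists_norm_logSum_vonMangoldtSubOne_le (max A 0)
  set b : ℝ := 1 + max A 0 with hb
  have hb0 : 0 < b := by positivity
  refine ⟨C + 3 * b ^ b, by positivity, fun x hlog hx => ?_⟩
  have hl : 0 < Real.log x := by linarith
  have h1 : ‖logSum vonMangoldtSubOne x‖ =
      |∑ n ∈ Finset.Icc 1 ⌊x⌋₊, Λ n * Real.log (x / n) -
        ∑ n ∈ Finset.Icc 1 ⌊x⌋₊, Real.log (x / n)| := by
    rw [← Finset.sum_sub_distrib, ← Real.norm_eq_abs, ← norm_real, logSum]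
    push_cast
    congr 1
    refine Finset.sum_congr rfl fun n hn => ?_
    rw [vonMangoldtSubOne, if_neg (by have := (Finset.mem_Icc.mp hn).1; omega)]
    ring
  have h2 := h x hlog hx
  have h3 := sum_log_div x hx
  have h4 : Real.log x + 2 ≤ 3 * b ^ b * x * Real.log x ^ (-(max A 0)) := by
    have h5 := log_rpow_le hb0 hx
    have h6 : Real.log x ≤ b ^ b * x * Real.log x ^ (-(max A 0)) := by
      calc Real.log x = Real.log x ^ b * Real.log x ^ (-(max A 0)) := by
            rw [← Real.rpow_add hl, hb]
            norm_num
        _ ≤ _ := by gcongr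
    linarith
  have h7 : Real.log x ^ (-(max A 0)) ≤ Real.log x ^ (-A) :=
    Real.rpow_le_rpow_of_exponent_le hlog (neg_le_neg (le_max_left _ _))
  rw [h1] at h2
  calc _ ≤ C * x * Real.log x ^ (-(max A 0)) + 3 * b ^ b * x * Real.log x ^ (-(max A 0)) := by
        refine le_trans ?_ (add_le_add h2 (h3.trans h4))
        refine le_trans (le_of_eq ?_) (abs_add_le _ _)
        congr 1
        ring
    _ = (C + 3 * b ^ b) * x * Real.log x ^ (-(max A 0)) := by ring
    _ ≤ _ := by gcongr

end PrimeNumberTheorem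

section AdditiveLargeSieve

open Complex MeasureTheory

/-- The exponential sum `∑_{n ≤ N} aₙ e(n t)`. -/
noncomputable def trigSum (a : ℕ → ℂ) (N : ℕ) (t : ℝ) : ℂ :=
  ∑ n ∈ Finset.Icc 1 N, a n * cexp (2 * Real.pi * I * n * t)

lemma continuous_trigSum (a : ℕ → ℂ) (N : ℕ) : Continuous (trigSum a N) := by
  unfold trigSum
  fun_prop

lemma hasDerivAt_trigSum (a : ℕ → ℂ) (N : ℕ) (t : ℝ) :
    HasDerivAt (trigSum a N) (trigSum (fun n => 2 * Real.pi * I * n * a n) N t) t := by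
  unfold trigSum
  refine HasDerivAt.fun_sum fun n _ => ?_
  have h1 : HasDerivAt (fun t : ℝ => 2 * Real.pi * I * n * (t : ℂ)) (2 * Real.pi * I * n) t := by
    simpa using (hasDerivAt_id t).ofReal_comp.const_mul (2 * Real.pi * I * n : ℂ)
  refine (h1.cexp.const_mul (a n)).congr_deriv ?_
  ring

lemma integral_exp_int (k : ℤ) :
    ∫ t : ℝ in (0 : ℝ)..1, cexp (2 * Real.pi * I * k * t) = if k = 0 then 1 else 0 := by
  split_ifs with hk
  · simp [hk]
  · have hc : (2 * Real.pi * I * k : ℂ) ≠ 0 := by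
      have : (k : ℂ) ≠ 0 := by exact_mod_cast hk
      simp [Real.pi_ne_zero, this]
    rw [integral_exp_mul_complex hc]
    have : cexp (2 * Real.pi * I * k) = 1 := by
      rw [mul_comm]
      exact exp_int_mul_two_pi_mul_I k
    simp [this]

lemma integral_norm_trigSum_sq (a : ℕ → ℂ) (N : ℕ) :
    ∫ t : ℝ in (0 : ℝ)..1, ‖trigSum a N t‖ ^ 2 = ∑ n ∈ Finset.Icc 1 N, ‖a n‖ ^ 2 := by
  have h : ∀ t : ℝ, ((‖trigSum a N t‖ ^ 2 : ℝ) : ℂ) = ∑ n ∈ Finset.Icc 1 N,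
      ∑ m ∈ Finset.Icc 1 N, a n * (starRingEnd ℂ) (a m) *
        cexp (2 * Real.pi * I * ((n - m : ℤ) : ℂ) * t) := by
    intro t
    rw [ofReal_pow, ← Complex.mul_conj', trigSum, map_sum, Finset.sum_mul_sum]
    refine Finset.sum_congr rfl fun n _ => Finset.sum_congr rfl fun m _ => ?_
    rw [map_mul, ← Complex.exp_conj]
    have : (2 * Real.pi * I * ((n - m : ℤ) : ℂ) * t : ℂ) =
        2 * Real.pi * I * n * t + (starRingEnd ℂ) (2 * Real.pi * I * m * t) := by
      have : (starRingEnd ℂ) 2 = 2 := conj_ofNat 2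
      simp [this]
      ring
    rw [this, Complex.exp_add]
    ring
  have h2 : ((∫ t : ℝ in (0 : ℝ)..1, ‖trigSum a N t‖ ^ 2 : ℝ) : ℂ) =
      ((∑ n ∈ Finset.Icc 1 N, ‖a n‖ ^ 2 : ℝ) : ℂ) := by
    rw [← intervalIntegral.integral_ofReal]
    simp_rw [h]
    rw [intervalIntegral.integral_finsetSum fun n _ =>
      Continuous.intervalIntegrable (by fun_prop) _ _, ofReal_sum]
    refine Finset.sum_congr rfl fun n hn => ?_
    rw [intervalIntegral.integral_finsetSum fun n _ =>
      Continuous.intervalIntegrable (by fun_prop) _ _]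
    simp_rw [intervalIntegral.integral_const_mul, integral_exp_int]
    rw [Finset.sum_eq_single n]
    · simp [Complex.mul_conj']
    · intro m _ hmn
      rw [if_neg (by omega), mul_zero]
    · exact fun h => absurd hn h
  exact_mod_cast h2

/-- Gallagher's inequality. -/
lemma norm_sq_le_integral {S S' : ℝ → ℂ} (hS : ∀ t, HasDerivAt S (S' t) t) (hS' : Continuous S')
    {δ c : ℝ} (hδ : 0 < δ) (hc : 0 < c) (α : ℝ) :
    ‖S α‖ ^ 2 ≤ ∫ t in α..(α + δ), ((δ⁻¹ + c) * ‖S t‖ ^ 2 + c⁻¹ * ‖S' t‖ ^ 2) := by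
  have hSc : Continuous S := continuous_iff_continuousAt.mpr fun t => (hS t).continuousAt
  set G : ℝ → ℝ := fun t => c * ‖S t‖ ^ 2 + c⁻¹ * ‖S' t‖ ^ 2 with hG
  have hGc : Continuous G := by fun_prop
  have hG0 : ∀ t, 0 ≤ G t := fun t => by positivity
  have hle : α ≤ α + δ := by linarith
  have hpt : ∀ t ∈ Set.Icc α (α + δ), ‖S α‖ ^ 2 ≤ ‖S t‖ ^ 2 + ∫ u in α..(α + δ), G u := by
    intro t ht
    have hd : ∀ u, HasDerivAt (fun u => ‖S u‖ ^ 2) (2 * inner ℝ (S u) (S' u)) u :=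
      fun u => (hS u).norm_sq
    have h1 : ∫ u in α..t, 2 * inner ℝ (S u) (S' u) = ‖S t‖ ^ 2 - ‖S α‖ ^ 2 :=
      intervalIntegral.integral_eq_sub_of_hasDerivAt (fun u _ => hd u)
        (Continuous.intervalIntegrable (by fun_prop) _ _)
    have h2 : -(∫ u in α..t, 2 * inner ℝ (S u) (S' u)) ≤ ∫ u in α..t, G u := by
      rw [← intervalIntegral.integral_neg]
      refine intervalIntegral.integral_mono_on ht.1
        (Continuous.intervalIntegrable (by fun_prop) _ _) (hGc.intervalIntegrable _ _) fun u _ => ?_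
      have h3 := abs_le.mp (abs_real_inner_le_norm (S u) (S' u))
      have h4 : 2 * (‖S u‖ * ‖S' u‖) ≤ G u := by
        have h5 : 0 ≤ c⁻¹ * (c * ‖S u‖ - ‖S' u‖) ^ 2 := by positivity
        have h6 : c⁻¹ * (c * ‖S u‖ - ‖S' u‖) ^ 2 = G u - 2 * (‖S u‖ * ‖S' u‖) := by
          simp only [hG]
          field_simp
          ring
        linarith
      linarith [h3.1]
    have h3 : ∫ u in α..t, G u ≤ ∫ u in α..(α + δ), G u :=
      intervalIntegral.integral_mono_interval le_rfl ht.1 ht.2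
        (ae_of_all _ hG0) (hGc.intervalIntegrable _ _)
    linarith
  have h4 := intervalIntegral.integral_mono_on hle (intervalIntegrable_const (μ := volume))
    (Continuous.intervalIntegrable (by fun_prop) _ _) hpt
  rw [intervalIntegral.integral_const, intervalIntegral.integral_add
    (Continuous.intervalIntegrable (by fun_prop) _ _) intervalIntegrable_const,
    intervalIntegral.integral_const, add_sub_cancel_left, smul_eq_mul, smul_eq_mul] at h4
  have h5 := mul_le_mul_of_nonneg_left h4 (inv_pos.mpr hδ).le
  rw [inv_mul_cancel_left₀ hδ.ne', mul_add, inv_mul_cancel_left₀ hδ.ne',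
    ← intervalIntegral.integral_const_mul, ← intervalIntegral.integral_add
    (Continuous.intervalIntegrable (by fun_prop) _ _) (hGc.intervalIntegrable _ _)] at h5
  refine h5.trans_eq (intervalIntegral.integral_congr fun t _ => ?_)
  simp only [hG]
  ring

/-- The reduced residues `b / q` with `q ≤ Q`. -/
def fareySet (Q : ℕ) : Finset (Σ _ : ℕ, ℕ) :=
  (Finset.Icc 1 Q).sigma fun q => (Finset.range q).filter fun b => b.Coprime q

lemma fareySet_separated {Q : ℕ} {p r : Σ _ : ℕ, ℕ} (hp : p ∈ fareySet Q) (hr : r ∈ fareySet Q)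
    (h : (p.2 : ℝ) / p.1 < r.2 / r.1) : (p.2 : ℝ) / p.1 + ((Q : ℝ) ^ 2)⁻¹ ≤ r.2 / r.1 := by
  simp only [fareySet, Finset.mem_sigma, Finset.mem_Icc, Finset.mem_filter] at hp hr
  have h1 : (0 : ℝ) < p.1 := by exact_mod_cast hp.1.1
  have h2 : (0 : ℝ) < r.1 := by exact_mod_cast hr.1.1
  have h3 : (p.1 : ℝ) ≤ Q := by exact_mod_cast hp.1.2
  have h4 : (r.1 : ℝ) ≤ Q := by exact_mod_cast hr.1.2
  rw [div_lt_div_iff₀ h1 h2] at h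
  have h5 : (p.2 * r.1 + 1 : ℝ) ≤ r.2 * p.1 := by exact_mod_cast h
  have h6 : ((Q : ℝ) ^ 2)⁻¹ ≤ ((p.1 : ℝ) * r.1)⁻¹ := by
    rw [sq]
    gcongr
  have h7 : (r.2 : ℝ) / r.1 - p.2 / p.1 = (r.2 * p.1 - p.2 * r.1) * ((p.1 : ℝ) * r.1)⁻¹ := by
    field_simp
  have h8 : 1 * ((p.1 : ℝ) * r.1)⁻¹ ≤ (r.2 * p.1 - p.2 * r.1) * ((p.1 : ℝ) * r.1)⁻¹ := by
    gcongr
    linarith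
  linarith

lemma fareySet_injOn (Q : ℕ) :
    Set.InjOn (fun p : Σ _ : ℕ, ℕ => (p.2 : ℝ) / p.1) (fareySet Q) := by
  rintro ⟨q, b⟩ hp ⟨r, c⟩ hr h
  simp only [fareySet, Finset.mem_coe, Finset.mem_sigma, Finset.mem_Icc, Finset.mem_filter] at hp hr h
  have h1 : (0 : ℝ) < q := by exact_mod_cast hp.1.1
  have h2 : (0 : ℝ) < r := by exact_mod_cast hr.1.1
  rw [div_eq_div_iff h1.ne' h2.ne'] at h
  have h3 : b * r = c * q := by exact_mod_cast h
  have h4 : q ∣ r := hp.2.2.symm.dvd_of_dvd_mul_left (h3 ▸ dvd_mul_left q c)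
  have h5 : r ∣ q := hr.2.2.symm.dvd_of_dvd_mul_left (h3 ▸ dvd_mul_left r b)
  obtain rfl : q = r := Nat.dvd_antisymm h4 h5
  obtain rfl : b = c := Nat.eq_of_mul_eq_mul_right hp.1.1 h3
  rfl

/-- The additive large sieve inequality at Farey fractions. -/
theorem sum_norm_trigSum_sq_le (a : ℕ → ℂ) (N Q : ℕ) (hN : 1 ≤ N) (hQ : 1 ≤ Q) :
    ∑ p ∈ fareySet Q, ‖trigSum a N (p.2 / p.1)‖ ^ 2 ≤
      ((Q : ℝ) ^ 2 + 4 * Real.pi * N) * ∑ n ∈ Finset.Icc 1 N, ‖a n‖ ^ 2 := by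
  have hN0 : (0 : ℝ) < N := by exact_mod_cast hN
  have hQ0 : (0 : ℝ) < Q := by exact_mod_cast hQ
  set δ : ℝ := ((Q : ℝ) ^ 2)⁻¹ with hδ
  have hδ0 : 0 < δ := by positivity
  set c : ℝ := 2 * Real.pi * N with hc
  have hc0 : 0 < c := by positivity
  set b : ℕ → ℂ := fun n => 2 * Real.pi * I * n * a n with hb
  have hbc := continuous_trigSum b N
  have hac := continuous_trigSum a N
  set H : ℝ → ℝ := fun t => (δ⁻¹ + c) * ‖trigSum a N t‖ ^ 2 + c⁻¹ * ‖trigSum b N t‖ ^ 2 with hH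
  have hHc : Continuous H := by fun_prop
  have hH0 : ∀ t, 0 ≤ H t := fun t => by positivity
  set J : (Σ _ : ℕ, ℕ) → Set ℝ := fun p => Set.Ioc ((p.2 : ℝ) / p.1) (p.2 / p.1 + δ) with hJ
  have hdisj : (fareySet Q : Set (Σ _ : ℕ, ℕ)).PairwiseDisjoint J := by
    intro p hp r hr hpr
    have hne : (p.2 : ℝ) / p.1 ≠ r.2 / r.1 := fun h => hpr (fareySet_injOn Q hp hr h)
    rw [Function.onFun, Set.disjoint_left]
    rintro t ht1 ht2
    rcases lt_or_gt_of_ne hne with h | h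
    · linarith [fareySet_separated hp hr h, ht1.2, ht2.1]
    · linarith [fareySet_separated hr hp h, ht2.2, ht1.1]
  have hsub : (⋃ p ∈ fareySet Q, J p) ⊆ Set.Ioc 0 1 := by
    refine Set.iUnion₂_subset fun p hp => Set.Ioc_subset_Ioc (by positivity) ?_
    have hp' := hp
    simp only [fareySet, Finset.mem_sigma, Finset.mem_Icc, Finset.mem_filter, Finset.mem_range] at hp'
    have h1 : (0 : ℝ) < p.1 := by exact_mod_cast hp'.1.1
    have h2 : (p.1 : ℝ) ≤ Q := by exact_mod_cast hp'.1.2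
    have h3 : (p.2 + 1 : ℝ) ≤ p.1 := by exact_mod_cast hp'.2.1
    have h4 : δ ≤ (p.1 : ℝ)⁻¹ := by
      have : (1 : ℝ) ≤ Q := by exact_mod_cast hQ
      rw [hδ]
      gcongr
      nlinarith
    have h5 : (p.2 : ℝ) / p.1 + (p.1 : ℝ)⁻¹ ≤ 1 := by
      rw [← one_div, ← add_div, div_le_one h1]
      exact h3
    linarith
  calc ∑ p ∈ fareySet Q, ‖trigSum a N (p.2 / p.1)‖ ^ 2 ≤ ∑ p ∈ fareySet Q, ∫ t in J p, H t := by
        refine Finset.sum_le_sum fun p _ => ?_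
        refine (norm_sq_le_integral (hasDerivAt_trigSum a N) hbc hδ0 hc0 _).trans_eq ?_
        rw [intervalIntegral.integral_of_le (by linarith)]
    _ = ∫ t in ⋃ p ∈ fareySet Q, J p, H t := by
        rw [integral_biUnion_finset _ (fun _ _ => measurableSet_Ioc) hdisj]
        exact fun p _ => hHc.integrableOn_Ioc
    _ ≤ ∫ t in Set.Ioc 0 1, H t :=
        setIntegral_mono_set hHc.integrableOn_Ioc (ae_of_all _ hH0) hsub.eventuallyLE
    _ = (δ⁻¹ + c) * ∑ n ∈ Finset.Icc 1 N, ‖a n‖ ^ 2 + c⁻¹ * ∑ n ∈ Finset.Icc 1 N, ‖b n‖ ^ 2 := by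
        rw [← intervalIntegral.integral_of_le zero_le_one, intervalIntegral.integral_add
          (Continuous.intervalIntegrable (by fun_prop) _ _)
          (Continuous.intervalIntegrable (by fun_prop) _ _),
          intervalIntegral.integral_const_mul, intervalIntegral.integral_const_mul,
          integral_norm_trigSum_sq, integral_norm_trigSum_sq]
    _ ≤ (δ⁻¹ + c) * ∑ n ∈ Finset.Icc 1 N, ‖a n‖ ^ 2 +
          c⁻¹ * (c ^ 2 * ∑ n ∈ Finset.Icc 1 N, ‖a n‖ ^ 2) := by
        gcongr
        rw [Finset.mul_sum]
        refine Finset.sum_le_sum fun n hn => ?_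
        have hn' : (n : ℝ) ≤ N := by exact_mod_cast (Finset.mem_Icc.mp hn).2
        rw [← mul_pow]
        gcongr
        simp only [hb, norm_mul, norm_real, norm_I, Complex.norm_two, Real.norm_eq_abs,
          abs_of_pos Real.pi_pos, mul_one, norm_natCast]
        rw [hc]
        gcongr
    _ = _ := by
        rw [hδ, inv_inv]
        field_simp
        rw [hc]
        ring

end AdditiveLargeSieve

section MultiplicativeLargeSieve

open Complex DirichletCharacter

open scoped Classical in
/-- The primitive Dirichlet characters modulo `q`. -/
noncomputable def primChars (q : ℕ) : Finset (DirichletCharacter ℂ q) :=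
  Finset.univ.filter fun χ => χ.IsPrimitive

lemma mem_primChars {q : ℕ} {χ : DirichletCharacter ℂ q} : χ ∈ primChars q ↔ χ.IsPrimitive := by
  simp [primChars]

lemma conj_apply_of_isUnit {q : ℕ} (χ : DirichletCharacter ℂ q) {a : ZMod q} (ha : IsUnit a) :
    (starRingEnd ℂ) (χ a) = χ a⁻¹ := by
  have h1 : ‖χ a‖ = 1 := by
    obtain ⟨u, rfl⟩ := ha
    exact χ.unit_norm_eq_one u
  rw [← Complex.inv_eq_conj h1]
  refine inv_eq_of_mul_eq_one_right ?_
  rw [← map_mul, ZMod.mul_inv_of_unit a ha, map_one]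

lemma inv_apply_eq_conj {q : ℕ} (χ : DirichletCharacter ℂ q) (a : ZMod q) :
    χ⁻¹ a = (starRingEnd ℂ) (χ a) := by
  rw [← MulChar.star_eq_inv]
  rfl

lemma gaussSum_stdAddChar_norm_sq {q : ℕ} [NeZero q] {χ : DirichletCharacter ℂ q}
    (hχ : χ.IsPrimitive) : ‖gaussSum χ ZMod.stdAddChar‖ ^ 2 = q := by
  have h1 := congrFun (ZMod.dft_dft (fun a => χ a)) (-1)
  have h2 : ∀ k : ZMod q, ZMod.dft (fun a => χ a) k = χ⁻¹ (-k) * gaussSum χ ZMod.stdAddChar :=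
    fun k => hχ.fourierTransform_eq_inv_mul_gaussSum k
  rw [ZMod.dft_apply] at h1
  simp_rw [h2] at h1
  have h3 : (starRingEnd ℂ) (gaussSum χ ZMod.stdAddChar) =
      ∑ j : ZMod q, ZMod.stdAddChar (-(j * -1)) * χ⁻¹ (-j) := by
    rw [gaussSum, map_sum]
    refine Fintype.sum_equiv (Equiv.neg _) _ _ fun j => ?_
    rw [map_mul, inv_apply_eq_conj, ← AddChar.map_neg_eq_conj]
    simp [mul_comm]
  have h4 : (‖gaussSum χ ZMod.stdAddChar‖ ^ 2 : ℂ) = q := by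
    rw [← Complex.mul_conj', h3, Finset.mul_sum]
    simp only [neg_neg, map_one, smul_eq_mul, mul_one] at h1
    rw [← h1]
    refine Finset.sum_congr rfl fun j _ => ?_
    simp
    ring
  exact_mod_cast h4

lemma sum_norm_sum_char_sq {q : ℕ} [NeZero q] (g : ZMod q → ℂ) :
    ∑ χ : DirichletCharacter ℂ q, ‖∑ b, χ b * g b‖ ^ 2 =
      q.totient * ∑ b : ZMod q, if IsUnit b then ‖g b‖ ^ 2 else 0 := by
  have h : ((∑ χ : DirichletCharacter ℂ q, ‖∑ b, χ b * g b‖ ^ 2 : ℝ) : ℂ) =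
      ((q.totient * ∑ b : ZMod q, if IsUnit b then ‖g b‖ ^ 2 else 0 : ℝ) : ℂ) := by
    have h1 : ∀ χ : DirichletCharacter ℂ q, ((‖∑ b, χ b * g b‖ ^ 2 : ℝ) : ℂ) =
        ∑ b, ∑ c, (if IsUnit c then χ c⁻¹ * χ b else 0) * (g b * (starRingEnd ℂ) (g c)) := by
      intro χ
      rw [ofReal_pow, ← Complex.mul_conj', map_sum, Finset.sum_mul_sum]
      refine Finset.sum_congr rfl fun b _ => Finset.sum_congr rfl fun c _ => ?_
      split_ifs with hc
      · rw [map_mul, conj_apply_of_isUnit χ hc]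
        ring
      · rw [map_mul, χ.map_nonunit hc]
        simp
    rw [ofReal_sum]
    simp_rw [h1]
    rw [Finset.sum_comm]
    simp_rw [Finset.sum_comm (s := (Finset.univ : Finset (DirichletCharacter ℂ q))),
      ← Finset.sum_mul]
    push_cast
    rw [Finset.mul_sum]
    refine Finset.sum_congr rfl fun b _ => ?_
    rw [Finset.sum_eq_single b]
    · split_ifs with hb
      · rw [sum_char_inv_mul_char_eq ℂ hb, if_pos rfl, Complex.mul_conj']
        push_cast
        ring
      · simp
    · intro c _ hcb
      split_ifs with hc
      · rw [sum_char_inv_mul_char_eq ℂ hc, if_neg hcb, zero_mul]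
      · simp
    · simp
  exact_mod_cast h

lemma stdAddChar_mul_natCast {q : ℕ} [NeZero q] (b n : ℕ) :
    ZMod.stdAddChar ((b : ZMod q) * (n : ZMod q)) = cexp (2 * Real.pi * I * n * ((b / q : ℝ) : ℂ)) := by
  have := ZMod.stdAddChar_coe (N := q) ((b * n : ℕ) : ℤ)
  push_cast at this
  rw [this]
  congr 1
  push_cast
  ring

lemma mul_sum_primChars_le {q : ℕ} [NeZero q] (a : ℕ → ℂ) (N : ℕ) :
    (q : ℝ) * ∑ χ ∈ primChars q, ‖∑ n ∈ Finset.Icc 1 N, a n * χ⁻¹ n‖ ^ 2 ≤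
      q.totient * ∑ b ∈ (Finset.range q).filter fun b => b.Coprime q,
        ‖trigSum a N (b / q)‖ ^ 2 := by
  set S : ZMod q → ℂ := fun b => ∑ n ∈ Finset.Icc 1 N, a n * ZMod.stdAddChar (b * (n : ZMod q)) with hS
  have h1 : ∀ χ ∈ primChars q, (q : ℝ) * ‖∑ n ∈ Finset.Icc 1 N, a n * χ⁻¹ n‖ ^ 2 =
      ‖∑ b, χ b * S b‖ ^ 2 := by
    intro χ hχ
    rw [mem_primChars] at hχ
    rw [← gaussSum_stdAddChar_norm_sq hχ, ← mul_pow, ← norm_mul, Finset.mul_sum]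
    congr 2
    simp_rw [hS, Finset.mul_sum]
    rw [Finset.sum_comm]
    refine Finset.sum_congr rfl fun n _ => ?_
    have := gaussSum_mulShift_of_isPrimitive (ZMod.stdAddChar (N := q)) hχ (n : ZMod q)
    rw [mul_left_comm, mul_comm (gaussSum _ _), ← this, gaussSum, Finset.mul_sum]
    refine Finset.sum_congr rfl fun b _ => ?_
    rw [AddChar.mulShift_apply, mul_comm (n : ZMod q)]
    ring
  have h2 : (∑ b : ZMod q, if IsUnit b then ‖S b‖ ^ 2 else 0) =
      ∑ b ∈ (Finset.range q).filter fun b => b.Coprime q, ‖trigSum a N (b / q)‖ ^ 2 := by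
    rw [← Finset.sum_filter]
    symm
    refine Finset.sum_bij' (fun b _ => (b : ZMod q)) (fun b _ => b.val) ?_ ?_ ?_ ?_ ?_
    · intro b hb
      simp only [Finset.mem_filter, Finset.mem_univ, true_and]
      exact (ZMod.isUnit_iff_coprime b q).mpr (Finset.mem_filter.mp hb).2
    · intro b hb
      simp only [Finset.mem_filter, Finset.mem_range]
      refine ⟨ZMod.val_lt b, (ZMod.isUnit_iff_coprime _ q).mp ?_⟩
      rw [ZMod.natCast_zmod_val]
      exact (Finset.mem_filter.mp hb).2
    · intro b hb
      exact ZMod.val_cast_of_lt (Finset.mem_range.mp (Finset.mem_filter.mp hb).1)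
    · intro b _
      exact ZMod.natCast_zmod_val b
    · intro b _
      simp only [hS, trigSum, stdAddChar_mul_natCast]
  rw [Finset.mul_sum, Finset.sum_congr rfl h1, ← h2, ← sum_norm_sum_char_sq]
  exact Finset.sum_le_sum_of_subset_of_nonneg (Finset.subset_univ _)
    fun _ _ _ => by positivity

/-- The multiplicative large sieve inequality. -/
theorem large_sieve (a : ℕ → ℂ) (N Q : ℕ) (hN : 1 ≤ N) (hQ : 1 ≤ Q) :
    ∑ q ∈ Finset.Icc 1 Q, (q : ℝ) / q.totient *
        ∑ χ ∈ primChars q, ‖∑ n ∈ Finset.Icc 1 N, a n * χ n‖ ^ 2 ≤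
      ((Q : ℝ) ^ 2 + 4 * Real.pi * N) * ∑ n ∈ Finset.Icc 1 N, ‖a n‖ ^ 2 := by
  have h := sum_norm_trigSum_sq_le (fun n => (starRingEnd ℂ) (a n)) N Q hN hQ
  simp only [RCLike.norm_conj] at h
  refine le_trans ?_ h
  rw [fareySet, Finset.sum_sigma]
  refine Finset.sum_le_sum fun q hq => ?_
  have hq1 := (Finset.mem_Icc.mp hq).1
  have : NeZero q := ⟨by omega⟩
  have hφ : (0 : ℝ) < q.totient := by exact_mod_cast Nat.totient_pos.mpr hq1
  have h1 := mul_sum_primChars_le (q := q) (fun n => (starRingEnd ℂ) (a n)) N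
  rw [div_mul_eq_mul_div, div_le_iff₀ hφ, mul_comm _ (q.totient : ℝ)]
  refine le_trans (le_of_eq ?_) h1
  congr 1
  refine Finset.sum_congr rfl fun χ _ => ?_
  rw [← RCLike.norm_conj, map_sum]
  congr 2
  refine Finset.sum_congr rfl fun n _ => ?_
  rw [map_mul, inv_apply_eq_conj]

end MultiplicativeLargeSieve

section Bilinear

open Complex MeasureTheory

/-- A bilinear character sum with a logarithmic weight. -/
noncomputable def bilin {q : ℕ} (χ : DirichletCharacter ℂ q) (c d : ℕ → ℂ) (M N : ℕ) (x : ℝ) : ℂ :=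
  ∑ m ∈ Finset.Icc 1 M, ∑ k ∈ Finset.Icc 1 N,
    c m * χ m * (d k * χ k) * ((max (Real.log (x / (m * k))) 0 : ℝ) : ℂ)

/-- The Dirichlet polynomial with coefficients `c` twisted by `χ`. -/
noncomputable def dirPoly {q : ℕ} (χ : DirichletCharacter ℂ q) (c : ℕ → ℂ) (M : ℕ) (s : ℂ) : ℂ :=
  ∑ m ∈ Finset.Icc 1 M, c m * cexp (-(Real.log m * s)) * χ m

lemma continuous_dirPoly {q : ℕ} (χ : DirichletCharacter ℂ q) (c : ℕ → ℂ) (M : ℕ) :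
    Continuous (dirPoly χ c M) := by
  unfold dirPoly
  fun_prop

lemma norm_exp_neg_log_mul_le {s : ℂ} (hs : 0 ≤ s.re) (m : ℕ) :
    ‖cexp (-(Real.log m * s))‖ ≤ 1 := by
  rw [Complex.norm_exp, Real.exp_le_one_iff]
  have : 0 ≤ Real.log m * s.re := mul_nonneg (Real.log_natCast_nonneg m) hs
  rw [neg_re, re_ofReal_mul]
  linarith

lemma norm_dirPoly_le {q : ℕ} (χ : DirichletCharacter ℂ q) (c : ℕ → ℂ) (M : ℕ) {s : ℂ}
    (hs : 0 ≤ s.re) : ‖dirPoly χ c M s‖ ≤ ∑ m ∈ Finset.Icc 1 M, ‖c m‖ := by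
  refine norm_sum_le_of_le _ fun m _ => ?_
  rw [norm_mul, norm_mul]
  calc _ ≤ ‖c m‖ * 1 * 1 := by
        gcongr
        · exact norm_exp_neg_log_mul_le hs m
        · exact χ.norm_le_one _
    _ = _ := by ring

lemma integral_norm_one_div_sq {σ : ℝ} (hσ : 0 < σ) :
    ∫ t : ℝ, ‖1 / ((σ : ℂ) + t * I) ^ 2‖ = Real.pi / σ := by
  have h : ∀ t : ℝ, ‖1 / ((σ : ℂ) + t * I) ^ 2‖ = (σ ^ 2)⁻¹ * (1 + (t / σ) ^ 2)⁻¹ := by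
    intro t
    rw [norm_div, norm_one, norm_pow, Complex.sq_norm, normSq_add_mul_I, ← mul_inv, one_div]
    congr 1
    field_simp
  simp_rw [h]
  rw [integral_const_mul, Measure.integral_comp_div (fun u : ℝ => (1 + u ^ 2)⁻¹),
    integral_univ_inv_one_add_sq, abs_of_pos hσ, smul_eq_mul]
  field_simp

lemma integrable_dirPoly_mul {q : ℕ} (χ : DirichletCharacter ℂ q) (c d : ℕ → ℂ) (M N : ℕ) {σ : ℝ}
    (hσ : 0 < σ) : Integrable fun t : ℝ => ‖dirPoly χ c M (σ + t * I)‖ *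
      ‖dirPoly χ d N (σ + t * I)‖ * ‖1 / ((σ : ℂ) + t * I) ^ 2‖ := by
  have hre : ∀ t : ℝ, 0 ≤ ((σ : ℂ) + t * I).re := fun t => by simpa using hσ.le
  have h1 := continuous_dirPoly χ c M
  have h2 := continuous_dirPoly χ d N
  refine (integrable_one_div_sq_vertical hσ).norm.bdd_mul
    (c := (∑ m ∈ Finset.Icc 1 M, ‖c m‖) * ∑ m ∈ Finset.Icc 1 N, ‖d m‖)
    (Continuous.aestronglyMeasurable (by fun_prop)) (ae_of_all _ fun t => ?_)
  rw [norm_mul, norm_norm, norm_norm]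
  exact mul_le_mul (norm_dirPoly_le χ c M (hre t)) (norm_dirPoly_le χ d N (hre t))
    (norm_nonneg _) (Finset.sum_nonneg fun _ _ => norm_nonneg _)

lemma norm_bilin_le {q : ℕ} (χ : DirichletCharacter ℂ q) (c d : ℕ → ℂ) (M N : ℕ) {x : ℝ}
    (hlog : 0 < Real.log x) (hx : 0 < x) :
    ‖bilin χ c d M N x‖ ≤ Real.exp 1 / (2 * Real.pi) *
      ∫ t : ℝ, ‖dirPoly χ c M (((Real.log x)⁻¹ : ℝ) + t * I)‖ *
        ‖dirPoly χ d N (((Real.log x)⁻¹ : ℝ) + t * I)‖ *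
        ‖1 / ((((Real.log x)⁻¹ : ℝ) : ℂ) + t * I) ^ 2‖ := by
  set σ : ℝ := (Real.log x)⁻¹ with hσ
  have hσ0 : 0 < σ := by positivity
  have hne : ∀ t : ℝ, (σ + t * I : ℂ) ≠ 0 := fun t h => by
    have := congrArg re h
    simp at this
    linarith
  have hintg : ∀ u : ℝ, Integrable fun t : ℝ => cexp (u * ((σ : ℂ) + t * I)) / ((σ : ℂ) + t * I) ^ 2 := by
    intro u
    refine ((integrable_one_div_sq_vertical hσ0).norm.const_mul (Real.exp (u * σ))).mono'
      (Continuous.aestronglyMeasurable (Continuous.div (by fun_prop) (by fun_prop)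
        fun t => pow_ne_zero 2 (hne t))) (ae_of_all _ fun t => ?_)
    rw [norm_div, norm_div, norm_one, Complex.norm_exp]
    simp [div_eq_mul_inv]
  have h1 : 2 * Real.pi * bilin χ c d M N x = ∫ t : ℝ, dirPoly χ c M (σ + t * I) *
      dirPoly χ d N (σ + t * I) * (cexp (Real.log x * (σ + t * I)) / (σ + t * I) ^ 2) := by
    have h2 : ∀ t : ℝ, dirPoly χ c M (σ + t * I) *
        dirPoly χ d N (σ + t * I) * (cexp (Real.log x * (σ + t * I)) / (σ + t * I) ^ 2) =
        ∑ m ∈ Finset.Icc 1 M, ∑ k ∈ Finset.Icc 1 N, c m * χ m * (d k * χ k) *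
          (cexp ((Real.log (x / (m * k)) : ℝ) * (σ + t * I)) / (σ + t * I) ^ 2) := by
      intro t
      rw [dirPoly, dirPoly, Finset.sum_mul_sum, Finset.sum_mul]
      refine Finset.sum_congr rfl fun m hm => ?_
      rw [Finset.sum_mul]
      refine Finset.sum_congr rfl fun k hk => ?_
      have hm0 : (m : ℝ) ≠ 0 := by have := (Finset.mem_Icc.mp hm).1; positivity
      have hk0 : (k : ℝ) ≠ 0 := by have := (Finset.mem_Icc.mp hk).1; positivity
      rw [Real.log_div hx.ne' (mul_ne_zero hm0 hk0), Real.log_mul hm0 hk0, ofReal_sub, ofReal_add,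
        sub_mul, add_mul, Complex.exp_sub, Complex.exp_add, Complex.exp_neg, Complex.exp_neg]
      have h3 := Complex.exp_ne_zero (Real.log m * (σ + t * I))
      have h4 := Complex.exp_ne_zero (Real.log k * (σ + t * I))
      have h5 := hne t
      field_simp
    simp_rw [h2]
    rw [integral_finsetSum _ fun m _ => integrable_finsetSum _ fun k _ => (hintg _).const_mul _,
      bilin, Finset.mul_sum]
    refine Finset.sum_congr rfl fun m hm => ?_
    rw [integral_finsetSum _ fun k _ => (hintg _).const_mul _, Finset.mul_sum]
    refine Finset.sum_congr rfl fun k hk => ?_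
    rw [integral_const_mul, integral_exp_div_sq hσ0]
    ring
  have h2 := congrArg norm h1
  rw [norm_mul, norm_mul, norm_real, Complex.norm_two, Real.norm_eq_abs,
    abs_of_pos Real.pi_pos] at h2
  have h3 : ‖∫ t : ℝ, dirPoly χ c M (σ + t * I) *
      dirPoly χ d N (σ + t * I) * (cexp (Real.log x * (σ + t * I)) / (σ + t * I) ^ 2)‖ ≤
      ∫ t : ℝ, Real.exp 1 * (‖dirPoly χ c M (σ + t * I)‖ *
        ‖dirPoly χ d N (σ + t * I)‖ * ‖1 / ((σ : ℂ) + t * I) ^ 2‖) := by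
    refine norm_integral_le_of_norm_le ((integrable_dirPoly_mul χ c d M N hσ0).const_mul _)
      (ae_of_all _ fun t => le_of_eq ?_)
    have : (Real.log x * (σ + t * I) : ℂ).re = 1 := by
      rw [re_ofReal_mul]
      simp [hσ, hlog.ne']
    rw [norm_mul, norm_mul, norm_div, norm_div, norm_one, Complex.norm_exp, this]
    ring
  rw [← h2, integral_const_mul] at h3
  rw [div_mul_eq_mul_div, le_div_iff₀ (by positivity)]
  linarith

lemma sum_norm_dirPoly_sq_le (c : ℕ → ℂ) (M R : ℕ) (hM : 1 ≤ M) (hR : 1 ≤ R) {s : ℂ}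
    (hs : 0 ≤ s.re) :
    ∑ p ∈ (Finset.Ioc R (2 * R)).sigma primChars,
      (p.1 : ℝ) / p.1.totient * ‖dirPoly p.2 c M s‖ ^ 2 ≤
      (4 * (R : ℝ) ^ 2 + 4 * Real.pi * M) * ∑ n ∈ Finset.Icc 1 M, ‖c n‖ ^ 2 := by
  have h := large_sieve (fun n => c n * cexp (-(Real.log n * s))) M (2 * R) hM (by omega)
  rw [Finset.sum_sigma]
  calc _ ≤ ∑ q ∈ Finset.Icc 1 (2 * R), (q : ℝ) / q.totient *
        ∑ χ ∈ primChars q, ‖∑ n ∈ Finset.Icc 1 M, c n * cexp (-(Real.log n * s)) * χ n‖ ^ 2 := by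
        simp_rw [Finset.mul_sum]
        refine Finset.sum_le_sum_of_subset_of_nonneg (fun q hq => ?_) fun q _ _ => ?_
        · rw [Finset.mem_Ioc] at hq
          rw [Finset.mem_Icc]
          omega
        · exact Finset.sum_nonneg fun _ _ => by positivity
    _ ≤ _ := h
    _ ≤ ((2 * R : ℕ) ^ 2 + 4 * Real.pi * M) * ∑ n ∈ Finset.Icc 1 M, ‖c n‖ ^ 2 := by
        gcongr with n hn
        rw [norm_mul]
        exact mul_le_of_le_one_right (norm_nonneg _) (norm_exp_neg_log_mul_le hs n)
    _ = _ := by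
        push_cast
        ring

/-- The large sieve bound for bilinear character sums. -/
theorem sum_norm_bilin_le (c d : ℕ → ℂ) (M N R : ℕ) (hM : 1 ≤ M) (hN : 1 ≤ N) (hR : 1 ≤ R) {x : ℝ}
    (hlog : 0 < Real.log x) (hx : 0 < x) :
    ∑ q ∈ Finset.Ioc R (2 * R), (1 : ℝ) / q.totient * ∑ χ ∈ primChars q, ‖bilin χ c d M N x‖ ≤
      2 * Real.log x / R *
        (√((4 * (R : ℝ) ^ 2 + 4 * Real.pi * M) * ∑ n ∈ Finset.Icc 1 M, ‖c n‖ ^ 2) *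
          √((4 * (R : ℝ) ^ 2 + 4 * Real.pi * N) * ∑ n ∈ Finset.Icc 1 N, ‖d n‖ ^ 2)) := by
  set σ : ℝ := (Real.log x)⁻¹ with hσ
  have hσ0 : 0 < σ := by positivity
  have hR0 : (0 : ℝ) < R := by exact_mod_cast hR
  set P := (Finset.Ioc R (2 * R)).sigma primChars with hP
  set K : ℝ := √((4 * (R : ℝ) ^ 2 + 4 * Real.pi * M) * ∑ n ∈ Finset.Icc 1 M, ‖c n‖ ^ 2) *
    √((4 * (R : ℝ) ^ 2 + 4 * Real.pi * N) * ∑ n ∈ Finset.Icc 1 N, ‖d n‖ ^ 2) with hK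
  have hpt : ∀ t : ℝ, ∑ p ∈ P, (1 : ℝ) / p.1.totient * (‖dirPoly p.2 c M (σ + t * I)‖ *
      ‖dirPoly p.2 d N (σ + t * I)‖ * ‖1 / ((σ : ℂ) + t * I) ^ 2‖) ≤
      K / R * ‖1 / ((σ : ℂ) + t * I) ^ 2‖ := by
    intro t
    have hre : 0 ≤ ((σ : ℂ) + t * I).re := by simpa using hσ0.le
    set s : ℂ := (σ : ℂ) + t * I with hs
    have h1 : ∑ p ∈ P, (1 : ℝ) / p.1.totient * (‖dirPoly p.2 c M s‖ * ‖dirPoly p.2 d N s‖) ≤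
        K / R := by
      rw [le_div_iff₀ hR0, Finset.sum_mul]
      calc _ ≤ ∑ p ∈ P, (√((p.1 : ℝ) / p.1.totient) * ‖dirPoly p.2 c M s‖) *
            (√((p.1 : ℝ) / p.1.totient) * ‖dirPoly p.2 d N s‖) := by
            refine Finset.sum_le_sum fun p hp => ?_
            have hpR : (R : ℝ) ≤ p.1 := by
              have := (Finset.mem_Ioc.mp (Finset.mem_sigma.mp hp).1).1
              exact_mod_cast this.le
            rw [mul_mul_mul_comm, Real.mul_self_sqrt (by positivity)]
            calc _ = (R : ℝ) / p.1.totient * (‖dirPoly p.2 c M s‖ * ‖dirPoly p.2 d N s‖) := by ring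
              _ ≤ _ := by gcongr
        _ ≤ _ := Real.sum_mul_le_sqrt_mul_sqrt _ _ _
        _ ≤ K := by
            rw [hK]
            have hsq : ∀ p : Σ q : ℕ, DirichletCharacter ℂ q, ∀ y : ℝ,
                (√((p.1 : ℝ) / p.1.totient) * y) ^ 2 = (p.1 : ℝ) / p.1.totient * y ^ 2 :=
              fun p y => by rw [mul_pow, Real.sq_sqrt (by positivity)]
            simp_rw [hsq]
            gcongr
            · exact sum_norm_dirPoly_sq_le c M R hM hR hre
            · exact sum_norm_dirPoly_sq_le d N R hN hR hre
    calc _ = (∑ p ∈ P, (1 : ℝ) / p.1.totient * (‖dirPoly p.2 c M s‖ * ‖dirPoly p.2 d N s‖)) *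
          ‖1 / s ^ 2‖ := by
          rw [Finset.sum_mul]
          exact Finset.sum_congr rfl fun p _ => by ring
      _ ≤ _ := by gcongr
  have hintg : ∀ p : Σ q : ℕ, DirichletCharacter ℂ q, Integrable fun t : ℝ =>
      (1 : ℝ) / p.1.totient * (‖dirPoly p.2 c M (σ + t * I)‖ *
      ‖dirPoly p.2 d N (σ + t * I)‖ * ‖1 / ((σ : ℂ) + t * I) ^ 2‖) :=
    fun p => (integrable_dirPoly_mul p.2 c d M N hσ0).const_mul _
  calc _ = ∑ p ∈ P, (1 : ℝ) / p.1.totient * ‖bilin p.2 c d M N x‖ := by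
        rw [hP, Finset.sum_sigma]
        exact Finset.sum_congr rfl fun q _ => Finset.mul_sum _ _ _
    _ ≤ ∑ p ∈ P, Real.exp 1 / (2 * Real.pi) * ∫ t : ℝ, (1 : ℝ) / p.1.totient *
        (‖dirPoly p.2 c M (σ + t * I)‖ *
        ‖dirPoly p.2 d N (σ + t * I)‖ * ‖1 / ((σ : ℂ) + t * I) ^ 2‖) := by
        refine Finset.sum_le_sum fun p _ => ?_
        rw [integral_const_mul, mul_left_comm]
        exact mul_le_mul_of_nonneg_left (norm_bilin_le p.2 c d M N hlog hx) (by positivity)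
    _ = Real.exp 1 / (2 * Real.pi) * ∫ t : ℝ, ∑ p ∈ P, (1 : ℝ) / p.1.totient *
        (‖dirPoly p.2 c M (σ + t * I)‖ *
        ‖dirPoly p.2 d N (σ + t * I)‖ * ‖1 / ((σ : ℂ) + t * I) ^ 2‖) := by
        rw [← Finset.mul_sum, integral_finsetSum _ fun p _ => hintg p]
    _ ≤ Real.exp 1 / (2 * Real.pi) * ∫ t : ℝ, K / R * ‖1 / ((σ : ℂ) + t * I) ^ 2‖ := by
        refine mul_le_mul_of_nonneg_left ?_ (by positivity)
        exact integral_mono (integrable_finsetSum _ fun p _ => hintg p)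
          ((integrable_one_div_sq_vertical hσ0).norm.const_mul _) hpt
    _ = Real.exp 1 / 2 * (Real.log x / R * K) := by
        rw [integral_const_mul, integral_norm_one_div_sq hσ0, hσ]
        field_simp
    _ ≤ 2 * (Real.log x / R * K) := by
        have : Real.exp 1 / 2 ≤ 2 := by linarith [Real.exp_one_lt_d9]
        gcongr
    _ = _ := by ring

end Bilinear

section TypeI

open Complex

lemma charSum_succ {q : ℕ} (χ : DirichletCharacter ℂ q) (N : ℕ) :
    charSum χ (N + 1) = charSum χ N + χ ((N + 1 : ℕ) : ZMod q) := by
  rw [charSum, Finset.sum_range_succ, ← charSum]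

lemma sum_char_mul_eq {q : ℕ} (χ : DirichletCharacter ℂ q) (h : ℕ → ℂ) (N : ℕ) :
    ∑ k ∈ Finset.Icc 1 N, χ k * h k =
      charSum χ N * h N - ∑ k ∈ Finset.Ico 1 N, charSum χ k * (h (k + 1) - h k) := by
  induction N with
  | zero => simp [charSum]
  | succ N ih =>
    rw [Finset.sum_Icc_succ_top (by omega), ih, charSum_succ]
    rcases Nat.eq_zero_or_pos N with rfl | hN
    · simp [charSum]
    · rw [Finset.sum_Ico_succ_top hN]
      ring

lemma norm_sum_char_mul_le {q : ℕ} [NeZero q] {χ : DirichletCharacter ℂ q} (hχ : χ ≠ 1)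
    (h : ℕ → ℝ) (N : ℕ) :
    ‖∑ k ∈ Finset.Icc 1 N, χ k * (h k : ℂ)‖ ≤
      q * (|h N| + ∑ k ∈ Finset.Ico 1 N, |h (k + 1) - h k|) := by
  rw [sum_char_mul_eq χ (fun k => (h k : ℂ)), mul_add, Finset.mul_sum]
  refine (norm_sub_le _ _).trans (add_le_add ?_ (norm_sum_le_of_le _ fun k _ => ?_))
  · rw [norm_mul, norm_real, Real.norm_eq_abs]
    exact mul_le_mul_of_nonneg_right (norm_charSum_le hχ N) (abs_nonneg _)
  · rw [norm_mul, ← ofReal_sub, norm_real, Real.norm_eq_abs]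
    exact mul_le_mul_of_nonneg_right (norm_charSum_le hχ k) (abs_nonneg _)

lemma max_log_le {x : ℝ} (hx : 1 ≤ x) {n : ℝ} (hn : 1 ≤ n) :
    max (Real.log (x / n)) 0 ≤ Real.log x := by
  refine max_le ?_ (Real.log_nonneg hx)
  exact Real.log_le_log (by positivity) (div_le_self (by linarith) hn)

lemma norm_sum_char_mul_log_le {q : ℕ} [NeZero q] {χ : DirichletCharacter ℂ q} (hχ : χ ≠ 1)
    {g : ℕ → ℝ} {G x : ℝ} {X m : ℕ} (hx : 1 ≤ x) (hm : 1 ≤ m) (hX : (X : ℝ) ≤ x)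
    (hg0 : ∀ k, 0 ≤ g k) (hmono : ∀ k, 1 ≤ k → g k ≤ g (k + 1)) (hG : ∀ k ≤ X, g k ≤ G) :
    ‖∑ k ∈ Finset.Icc 1 X, χ k * ((g k * max (Real.log (x / (m * k))) 0 : ℝ) : ℂ)‖ ≤
      q * (3 * G * Real.log x) := by
  have hlog : 0 ≤ Real.log x := Real.log_nonneg hx
  have hm1 : (1 : ℝ) ≤ m := by exact_mod_cast hm
  have hG0 : 0 ≤ G := (hg0 0).trans (hG 0 (Nat.zero_le _))
  rcases Nat.eq_zero_or_pos X with rfl | hX1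
  · simpa using by positivity
  have hP : ∀ k : ℕ, 1 ≤ k → max (Real.log (x / (m * k))) 0 ≤ Real.log x := fun k hk =>
    max_log_le hx (one_le_mul_of_one_le_of_one_le hm1 (by exact_mod_cast hk))
  refine (norm_sum_char_mul_le hχ _ X).trans (mul_le_mul_of_nonneg_left ?_ (Nat.cast_nonneg q))
  have h1 : |g X * max (Real.log (x / (m * X))) 0| ≤ G * Real.log x := by
    rw [abs_of_nonneg (mul_nonneg (hg0 X) (le_max_right _ _))]
    exact mul_le_mul (hG X le_rfl) (hP X hX1) (le_max_right _ _) hG0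
  have h2 : ∀ k ∈ Finset.Ico 1 X, |g (k + 1) * max (Real.log (x / (m * (k + 1 : ℕ)))) 0 -
      g k * max (Real.log (x / (m * k))) 0| ≤
      (g (k + 1) - g k) * Real.log x + G * (Real.log ((k + 1 : ℕ) : ℝ) - Real.log k) := by
    intro k hk
    rw [Finset.mem_Ico] at hk
    have hk0 : (0 : ℝ) < k := by exact_mod_cast hk.1
    have hk1 : (0 : ℝ) < ((k + 1 : ℕ) : ℝ) := by positivity
    have h3 : |max (Real.log (x / (m * (k + 1 : ℕ)))) 0 - max (Real.log (x / (m * k))) 0| ≤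
        Real.log ((k + 1 : ℕ) : ℝ) - Real.log k := by
      refine (abs_max_sub_max_le_abs _ _ _).trans_eq ?_
      rw [Real.log_div (by positivity) (by positivity), Real.log_div (by positivity) (by positivity),
        Real.log_mul (by positivity) (by positivity), Real.log_mul (by positivity) (by positivity)]
      have : Real.log k ≤ Real.log ((k + 1 : ℕ) : ℝ) :=
        Real.log_le_log hk0 (by push_cast; linarith)
      rw [abs_of_nonpos (by linarith)]
      ring
    calc _ = |(g (k + 1) - g k) * max (Real.log (x / (m * (k + 1 : ℕ)))) 0 +
          g k * (max (Real.log (x / (m * (k + 1 : ℕ)))) 0 - max (Real.log (x / (m * k))) 0)| := by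
          congr 1
          ring
      _ ≤ _ := abs_add_le _ _
      _ ≤ _ := by
          rw [abs_mul, abs_mul, abs_of_nonneg (sub_nonneg.mpr (hmono k hk.1)), abs_of_nonneg (hg0 k),
            abs_of_nonneg (le_max_right (Real.log (x / (m * (k + 1 : ℕ)))) 0)]
          refine add_le_add (mul_le_mul_of_nonneg_left (hP _ (by omega))
            (sub_nonneg.mpr (hmono k hk.1))) ?_
          exact mul_le_mul (hG k hk.2.le) h3 (abs_nonneg _) hG0
  have h3 := Finset.sum_le_sum h2
  rw [Finset.sum_add_distrib, ← Finset.sum_mul, ← Finset.mul_sum,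
    Finset.sum_Ico_sub (fun k => g k) hX1,
    Finset.sum_Ico_sub (fun k => Real.log (k : ℝ)) hX1] at h3
  have h4 : (g X - g 1) * Real.log x ≤ G * Real.log x :=
    mul_le_mul_of_nonneg_right (by linarith [hg0 1, hG X le_rfl]) hlog
  have h5 : G * (Real.log X - Real.log (1 : ℕ)) ≤ G * Real.log x := by
    refine mul_le_mul_of_nonneg_left ?_ hG0
    have := Real.log_le_log (by exact_mod_cast hX1) hX
    simpa using this
  exact (add_le_add h1 (h3.trans (add_le_add h4 h5))).trans_eq (by ring)

lemma norm_bilin_typeI_le {q : ℕ} [NeZero q] {χ : DirichletCharacter ℂ q} (hχ : χ ≠ 1)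
    {f : ℕ → ℂ} {g : ℕ → ℝ} {F G x : ℝ} {X Y : ℕ} (hx : 1 ≤ x) (hX : (X : ℝ) ≤ x)
    (hF0 : 0 ≤ F) (hf0 : ∀ m, Y < m → f m = 0) (hf : ∀ m, 1 ≤ m → m ≤ X → ‖f m‖ ≤ F)
    (hg0 : ∀ k, 0 ≤ g k) (hmono : ∀ k, 1 ≤ k → g k ≤ g (k + 1)) (hG : ∀ k ≤ X, g k ≤ G) :
    ‖bilin χ f (fun k => (g k : ℂ)) X X x‖ ≤ Y * (F * (q * (3 * G * Real.log x))) := by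
  have hG0 : 0 ≤ G := (hg0 0).trans (hG 0 (Nat.zero_le _))
  have hB : 0 ≤ F * (q * (3 * G * Real.log x)) := by
    have := Real.log_nonneg hx
    positivity
  have h1 : ∀ m ∈ Finset.Icc 1 X, ‖∑ k ∈ Finset.Icc 1 X, f m * χ m * ((g k : ℂ) * χ k) *
      ((max (Real.log (x / (m * k))) 0 : ℝ) : ℂ)‖ ≤
      if m ∈ Finset.Icc 1 Y then F * (q * (3 * G * Real.log x)) else 0 := by
    intro m hm
    rw [Finset.mem_Icc] at hm
    split_ifs with h
    · have h2 : ∑ k ∈ Finset.Icc 1 X, f m * χ m * ((g k : ℂ) * χ k) *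
          ((max (Real.log (x / (m * k))) 0 : ℝ) : ℂ) = f m * χ m *
          ∑ k ∈ Finset.Icc 1 X, χ k * ((g k * max (Real.log (x / (m * k))) 0 : ℝ) : ℂ) := by
        rw [Finset.mul_sum]
        refine Finset.sum_congr rfl fun k _ => ?_
        push_cast
        ring
      rw [h2, norm_mul, norm_mul]
      refine mul_le_mul ?_ (norm_sum_char_mul_log_le hχ hx hm.1 hX hg0 hmono hG)
        (norm_nonneg _) hF0
      exact (mul_le_of_le_one_right (norm_nonneg _) (χ.norm_le_one _)).trans (hf m hm.1 hm.2)
    · rw [hf0 m (by rw [Finset.mem_Icc] at h; omega)]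
      simp
  refine (norm_sum_le_of_le _ h1).trans ?_
  rw [← Finset.sum_filter, Finset.sum_const, nsmul_eq_mul]
  refine mul_le_mul_of_nonneg_right ?_ hB
  have : (Finset.filter (fun m => m ∈ Finset.Icc 1 Y) (Finset.Icc 1 X)).card ≤ Y := by
    refine (Finset.card_le_card (t := Finset.Icc 1 Y) fun m hm => (Finset.mem_filter.mp hm).2).trans ?_
    simp
  exact_mod_cast this

end TypeI

section Dyadic

open Complex

lemma max_log_div_eq_zero {x n : ℝ} (hx : 0 ≤ x) (hn : x ≤ n) : max (Real.log (x / n)) 0 = 0 :=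
  max_eq_right (Real.log_nonpos (div_nonneg hx (hx.trans hn)) (div_le_one_of_le₀ hn (hx.trans hn)))

lemma sum_Icc_two_pow (F : ℕ → ℂ) (J : ℕ) :
    ∑ m ∈ Finset.Icc 1 (2 ^ J), F m =
      F 1 + ∑ j ∈ Finset.range J, ∑ m ∈ Finset.Ioc (2 ^ j) (2 ^ (j + 1)), F m := by
  induction J with
  | zero => simp
  | succ J ih =>
    rw [Finset.sum_range_succ, ← add_assoc, ← ih]
    have h1 : 1 ≤ 2 ^ J := Nat.one_le_two_pow
    have h2 : 2 ^ J ≤ 2 ^ (J + 1) := Nat.pow_le_pow_right (by norm_num) (by omega)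
    rw [← Finset.Ico_add_one_right_eq_Icc, ← Finset.Ico_add_one_right_eq_Icc,
      ← Finset.Ico_add_one_add_one_eq_Ioc, Finset.sum_Ico_consecutive _ (by omega) (by omega)]

lemma bilin_eq_sum_dyadic {q : ℕ} (χ : DirichletCharacter ℂ q) {f : ℕ → ℂ} (g : ℕ → ℂ) {x : ℝ}
    (hx : 0 ≤ x) (hf1 : f 1 = 0) {J : ℕ} (hJ : ⌊x⌋₊ ≤ 2 ^ J) :
    bilin χ f g ⌊x⌋₊ ⌊x⌋₊ x = ∑ j ∈ Finset.range J,
      bilin χ (fun m => if 2 ^ j < m then f m else 0) g (2 ^ (j + 1)) ⌊x / 2 ^ j⌋₊ x := by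
  set X := ⌊x⌋₊ with hX
  set F : ℕ → ℂ := fun m => ∑ k ∈ Finset.Icc 1 X, f m * χ m * (g k * χ k) *
    ((max (Real.log (x / (m * k))) 0 : ℝ) : ℂ) with hF
  have h1 : bilin χ f g X X x = ∑ m ∈ Finset.Icc 1 (2 ^ J), F m := by
    refine Finset.sum_subset (Finset.Icc_subset_Icc_right hJ) fun m _ hm => ?_
    refine Finset.sum_eq_zero fun k hk => ?_
    have hm1 : X < m := by
      simp only [Finset.mem_Icc] at *
      omega
    have hk1 : (1 : ℝ) ≤ k := by exact_mod_cast (Finset.mem_Icc.mp hk).1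
    have h3 : x < m := Nat.lt_of_floor_lt hm1
    rw [max_log_div_eq_zero hx (by nlinarith), ofReal_zero, mul_zero]
  rw [h1, sum_Icc_two_pow]
  have h2 : F 1 = 0 := by simp [hF, hf1]
  rw [h2, zero_add]
  refine Finset.sum_congr rfl fun j _ => ?_
  have hpow : (0 : ℝ) < 2 ^ j := by positivity
  have h3 : ∀ m ∈ Finset.Icc 1 (2 ^ (j + 1)), m ∉ Finset.Ioc (2 ^ j) (2 ^ (j + 1)) → ¬ 2 ^ j < m := by
    intro m hm hm2 hlt
    exact hm2 (Finset.mem_Ioc.mpr ⟨hlt, (Finset.mem_Icc.mp hm).2⟩)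
  unfold bilin
  refine Eq.trans ?_ (Finset.sum_subset (s₁ := Finset.Ioc (2 ^ j) (2 ^ (j + 1))) ?_ ?_)
  · refine Finset.sum_congr rfl fun m hm => ?_
    have hm1 := (Finset.mem_Ioc.mp hm).1
    have hmr : (2 : ℝ) ^ j ≤ m := by exact_mod_cast hm1.le
    simp only [hF, if_pos hm1]
    symm
    refine Finset.sum_subset (Finset.Icc_subset_Icc_right (Nat.floor_le_floor
      (div_le_self hx (one_le_pow₀ (by norm_num))))) fun k hk hk2 => ?_
    have hk1 : ⌊x / 2 ^ j⌋₊ < k := by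
      simp only [Finset.mem_Icc] at *
      omega
    have h4 : x / 2 ^ j < k := Nat.lt_of_floor_lt hk1
    rw [div_lt_iff₀ hpow] at h4
    have h5 : x ≤ m * k := by
      rw [mul_comm]
      exact h4.le.trans (mul_le_mul_of_nonneg_left hmr (Nat.cast_nonneg k))
    rw [max_log_div_eq_zero hx h5, ofReal_zero, mul_zero]
  · intro m hm
    rw [Finset.mem_Ioc] at hm
    rw [Finset.mem_Icc]
    omega
  · intro m hm hm2
    simp [if_neg (h3 m hm hm2)]

end Dyadic

section TypeII

open Complex

lemma typeII_numeric {R M N x u L : ℝ} (hR : 1 ≤ R) (hM : 0 ≤ M) (hN : 0 ≤ N) (hx : 0 < x)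
    (hu : 0 < u) (hL : 0 ≤ L) (hMN : M * N ≤ 2 * x) (hMu : M * u ≤ 2 * x) (hNu : N * u ≤ 2 * x) :
    √((4 * R ^ 2 + 4 * Real.pi * M) * (M * L ^ 2)) * √((4 * R ^ 2 + 4 * Real.pi * N) * N) ≤
      64 * L * R * (R * √x + x / √u + x / R) := by
  have key : ∀ y : ℝ, 0 ≤ y → √(4 * R ^ 2 + 4 * Real.pi * y) ≤ 2 * R + 4 * √y := by
    intro y hy
    refine Real.sqrt_le_iff.mpr ⟨by positivity, ?_⟩
    have h1 := Real.sq_sqrt hy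
    have h2 : 0 ≤ R * √y := by positivity
    nlinarith [Real.pi_le_four]
  rw [Real.sqrt_mul (by positivity), Real.sqrt_mul hM, Real.sqrt_sq hL, Real.sqrt_mul (by positivity)]
  set a := √M with ha
  set b := √N with hb
  set s := √x with hs
  set v := √u with hv
  have hs0 : 0 < s := Real.sqrt_pos.mpr hx
  have hv0 : 0 < v := Real.sqrt_pos.mpr hu
  have ha0 : 0 ≤ a := Real.sqrt_nonneg _
  have hb0 : 0 ≤ b := Real.sqrt_nonneg _
  have hxs : x = s ^ 2 := (Real.sq_sqrt hx.le).symm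
  have h1 : a * b ≤ 2 * s := by
    rw [ha, hb, ← Real.sqrt_mul hM]
    refine Real.sqrt_le_iff.mpr ⟨by positivity, ?_⟩
    nlinarith
  have h2 : a ≤ 2 * s / v := by
    rw [le_div_iff₀ hv0, ha, hv, ← Real.sqrt_mul hM]
    refine Real.sqrt_le_iff.mpr ⟨by positivity, ?_⟩
    nlinarith
  have h3 : b ≤ 2 * s / v := by
    rw [le_div_iff₀ hv0, hb, hv, ← Real.sqrt_mul hN]
    refine Real.sqrt_le_iff.mpr ⟨by positivity, ?_⟩
    nlinarith
  calc _ ≤ (2 * R + 4 * a) * (a * L) * ((2 * R + 4 * b) * b) := by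
        gcongr
        · exact key M hM
        · exact key N hN
    _ = L * ((a * b) * (4 * R ^ 2 + 8 * R * (a + b) + 16 * (a * b))) := by ring
    _ ≤ L * ((2 * s) * (4 * R ^ 2 + 8 * R * (2 * s / v + 2 * s / v) + 16 * (2 * s))) := by gcongr
    _ = L * R * (8 * (R * s) + 64 * (x / v) + 64 * (x / R)) := by
        rw [hxs]
        field_simp
        ring
    _ ≤ L * R * (64 * (R * s) + 64 * (x / v) + 64 * (x / R)) := by
        gcongr
        norm_num
    _ = _ := by ring

lemma sum_norm_bilin_dyadic_le {f g : ℕ → ℂ} {L x : ℝ} {R U : ℕ} (hR : 1 ≤ R) (hU : 1 ≤ U)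
    (hL : 0 ≤ L) (hf : ∀ m, ‖f m‖ ≤ L) (hg : ∀ k, ‖g k‖ ≤ 1) (hfU : ∀ m ≤ U, f m = 0)
    (hgU : ∀ k ≤ U, g k = 0) (hlog : 0 < Real.log x) (hx : 0 < x) (j : ℕ) :
    ∑ q ∈ Finset.Ioc R (2 * R), (1 : ℝ) / q.totient * ∑ χ ∈ primChars q,
      ‖bilin χ (fun m => if 2 ^ j < m then f m else 0) g (2 ^ (j + 1)) ⌊x / 2 ^ j⌋₊ x‖ ≤
      128 * L * Real.log x * (R * √x + x / √U + x / R) := by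
  have hR1 : (1 : ℝ) ≤ R := by exact_mod_cast hR
  have hU0 : (0 : ℝ) < U := by exact_mod_cast hU
  have hRHS : 0 ≤ 128 * L * Real.log x * (R * √x + x / √U + x / R) := by positivity
  set N := ⌊x / 2 ^ j⌋₊ with hN
  have hpow : (0 : ℝ) < 2 ^ j := by positivity
  have hNle : (N : ℝ) ≤ x / 2 ^ j := Nat.floor_le (by positivity)
  rw [le_div_iff₀ hpow] at hNle
  by_cases h1 : 2 ^ (j + 1) ≤ U
  · refine le_of_eq_of_le (Finset.sum_eq_zero fun q _ => ?_) hRHS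
    rw [Finset.sum_eq_zero, mul_zero]
    intro χ _
    rw [norm_eq_zero]
    refine Finset.sum_eq_zero fun m hm => Finset.sum_eq_zero fun k _ => ?_
    simp [hfU m ((Finset.mem_Icc.mp hm).2.trans h1)]
  by_cases h2 : N ≤ U
  · refine le_of_eq_of_le (Finset.sum_eq_zero fun q _ => ?_) hRHS
    rw [Finset.sum_eq_zero, mul_zero]
    intro χ _
    rw [norm_eq_zero]
    refine Finset.sum_eq_zero fun m _ => Finset.sum_eq_zero fun k hk => ?_
    simp [hgU k ((Finset.mem_Icc.mp hk).2.trans h2)]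
  push Not at h1 h2
  have h1' : (U : ℝ) ≤ 2 * 2 ^ j := by
    rw [pow_succ, mul_comm] at h1
    exact_mod_cast h1.le
  have h2' : (U : ℝ) ≤ N := by exact_mod_cast h2.le
  refine (sum_norm_bilin_le _ g (2 ^ (j + 1)) N R Nat.one_le_two_pow (by omega) hR hlog hx).trans ?_
  have hc : ∑ m ∈ Finset.Icc 1 (2 ^ (j + 1)), ‖if 2 ^ j < m then f m else 0‖ ^ 2 ≤
      2 * 2 ^ j * L ^ 2 := by
    have : ∀ m ∈ Finset.Icc 1 (2 ^ (j + 1)), ‖if 2 ^ j < m then f m else 0‖ ^ 2 ≤ L ^ 2 := by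
      intro m _
      split_ifs
      · exact pow_le_pow_left₀ (norm_nonneg _) (hf m) 2
      · simp
        positivity
    refine (Finset.sum_le_card_nsmul _ _ _ this).trans_eq ?_
    rw [Nat.card_Icc, nsmul_eq_mul, Nat.add_sub_cancel]
    push_cast
    ring
  have hd : ∑ k ∈ Finset.Icc 1 N, ‖g k‖ ^ 2 ≤ N := by
    refine (Finset.sum_le_card_nsmul _ _ 1 fun k _ => ?_).trans_eq (by simp)
    exact pow_le_one₀ (norm_nonneg _) (hg k)
  have hnum := typeII_numeric (M := 2 * 2 ^ j) (N := N) (u := U) hR1 (by positivity)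
    (Nat.cast_nonneg N) hx hU0 hL (by linarith)
    (by nlinarith) (by nlinarith [Nat.cast_nonneg (α := ℝ) N])
  have hM : ((2 ^ (j + 1) : ℕ) : ℝ) = 2 * 2 ^ j := by
    push_cast
    ring
  rw [hM]
  calc _ ≤ 2 * Real.log x / R * (√((4 * (R : ℝ) ^ 2 + 4 * Real.pi * (2 * 2 ^ j)) *
        (2 * 2 ^ j * L ^ 2)) * √((4 * (R : ℝ) ^ 2 + 4 * Real.pi * N) * N)) := by gcongr
    _ ≤ 2 * Real.log x / R * (64 * L * R * (R * √x + x / √U + x / R)) :=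
        mul_le_mul_of_nonneg_left hnum (by positivity)
    _ = _ := by
        field_simp
        ring

lemma sum_norm_bilin_typeII_le {f g : ℕ → ℂ} {L x : ℝ} {R U : ℕ} (hR : 1 ≤ R) (hU : 1 ≤ U)
    (hL : 0 ≤ L) (hf : ∀ m, ‖f m‖ ≤ L) (hg : ∀ k, ‖g k‖ ≤ 1) (hfU : ∀ m ≤ U, f m = 0)
    (hgU : ∀ k ≤ U, g k = 0) (hlog : 1 ≤ Real.log x) (hx : 1 ≤ x) :
    ∑ q ∈ Finset.Ioc R (2 * R), (1 : ℝ) / q.totient * ∑ χ ∈ primChars q,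
      ‖bilin χ f g ⌊x⌋₊ ⌊x⌋₊ x‖ ≤
      384 * L * Real.log x ^ 2 * (R * √x + x / √U + x / R) := by
  set J := Nat.clog 2 ⌊x⌋₊ with hJ
  have hJle : (J : ℝ) ≤ 3 * Real.log x := by
    have hX1 : 1 ≤ ⌊x⌋₊ := Nat.le_floor (by simpa using hx)
    rcases Nat.eq_zero_or_pos J with h | h
    · rw [h]
      push_cast
      linarith
    have h1 : 2 ^ (J - 1) < ⌊x⌋₊ := Nat.pow_lt_of_lt_clog (by omega)
    have h2 : (2 : ℝ) ^ (J - 1) ≤ x := by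
      have : ((2 ^ (J - 1) : ℕ) : ℝ) ≤ ⌊x⌋₊ := by exact_mod_cast h1.le
      push_cast at this
      exact this.trans (Nat.floor_le (by linarith))
    have h3 := Real.log_le_log (by positivity) h2
    rw [Real.log_pow, Nat.cast_sub h] at h3
    push_cast at h3
    have h4 := Real.log_two_gt_d9
    have hJ1 : (1 : ℝ) ≤ J := by exact_mod_cast h
    nlinarith
  have hB : 0 ≤ 128 * L * Real.log x * (R * √x + x / √U + x / R) := by positivity
  calc _ ≤ ∑ q ∈ Finset.Ioc R (2 * R), (1 : ℝ) / q.totient * ∑ χ ∈ primChars q,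
        ∑ j ∈ Finset.range J,
        ‖bilin χ (fun m => if 2 ^ j < m then f m else 0) g (2 ^ (j + 1)) ⌊x / 2 ^ j⌋₊ x‖ := by
        gcongr with q _ χ _
        rw [bilin_eq_sum_dyadic χ g (by linarith) (hfU 1 hU) (Nat.le_pow_clog (by norm_num) _)]
        exact norm_sum_le _ _
    _ = ∑ j ∈ Finset.range J, ∑ q ∈ Finset.Ioc R (2 * R), (1 : ℝ) / q.totient *
        ∑ χ ∈ primChars q,
        ‖bilin χ (fun m => if 2 ^ j < m then f m else 0) g (2 ^ (j + 1)) ⌊x / 2 ^ j⌋₊ x‖ := by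
        rw [Finset.sum_comm]
        refine Finset.sum_congr rfl fun q _ => ?_
        rw [Finset.sum_comm, Finset.mul_sum]
    _ ≤ ∑ j ∈ Finset.range J, 128 * L * Real.log x * (R * √x + x / √U + x / R) :=
        Finset.sum_le_sum fun j _ => sum_norm_bilin_dyadic_le hR hU hL hf hg hfU hgU
          (by linarith) (by linarith) j
    _ = J * (128 * L * Real.log x * (R * √x + x / √U + x / R)) := by simp
    _ ≤ 3 * Real.log x * (128 * L * Real.log x * (R * √x + x / √U + x / R)) := by gcongr
    _ = _ := by ring

end TypeII

section Vaughan

open Complex ArithmeticFunction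

/-- The restriction of an arithmetic function to the arguments at most `U`. -/
noncomputable def trunc (f : ArithmeticFunction ℝ) (U : ℕ) : ArithmeticFunction ℝ :=
  ⟨fun n => if n ≤ U then f n else 0, by simp⟩

lemma trunc_apply (f : ArithmeticFunction ℝ) (U n : ℕ) :
    trunc f U n = if n ≤ U then f n else 0 := rfl

lemma vaughan_identity {R : Type*} [CommRing R] {a z l m : R} (h1 : a * z = l) (h2 : m * z = 1)
    (a₁ m₁ : R) : a = a₁ + m₁ * l - m₁ * a₁ * z + (a - a₁) * z * (m - m₁) := by
  linear_combination m₁ * h1 - (a - a₁) * h2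

lemma logSum_mul {q : ℕ} (χ : DirichletCharacter ℂ q) (f g : ArithmeticFunction ℝ) {x : ℝ}
    (hx : 0 ≤ x) :
    logSum (fun n => χ n * (((f * g) n : ℝ) : ℂ)) x =
      bilin χ (fun m => ((f m : ℝ) : ℂ)) (fun k => ((g k : ℝ) : ℂ)) ⌊x⌋₊ ⌊x⌋₊ x := by
  unfold logSum bilin
  set X := ⌊x⌋₊ with hX
  set F : ℕ × ℕ → ℂ := fun p => (f p.1 : ℂ) * χ p.1 * ((g p.2 : ℂ) * χ p.2) *
    ((max (Real.log (x / (p.1 * p.2))) 0 : ℝ) : ℂ) with hF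
  rw [← Finset.sum_product' (f := fun m k => F (m, k))]
  set S := Finset.Icc 1 X ×ˢ Finset.Icc 1 X with hS
  have h1 : ∑ p ∈ S.filter (fun p => p.1 * p.2 ≤ X), F p = ∑ p ∈ S, F p := by
    refine Finset.sum_subset (Finset.filter_subset _ _) fun p hp hp2 => ?_
    have h2 : X < p.1 * p.2 := by
      by_contra! h
      exact hp2 (Finset.mem_filter.mpr ⟨hp, h⟩)
    have h3 : x < ((p.1 * p.2 : ℕ) : ℝ) := Nat.lt_of_floor_lt h2
    push_cast at h3
    simp only [hF]
    rw [max_log_div_eq_zero hx h3.le, ofReal_zero, mul_zero]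
  rw [← h1, ← Finset.sum_fiberwise_of_maps_to (t := Finset.Icc 1 X) (g := fun p : ℕ × ℕ => p.1 * p.2)]
  · refine Finset.sum_congr rfl fun n hn => ?_
    rw [Finset.mem_Icc] at hn
    have h4 : (S.filter (fun p => p.1 * p.2 ≤ X)).filter (fun p => p.1 * p.2 = n) =
        n.divisorsAntidiagonal := by
      ext ⟨a, b⟩
      simp only [hS, Finset.mem_filter, Finset.mem_product, Finset.mem_Icc,
        Nat.mem_divisorsAntidiagonal]
      constructor
      · rintro ⟨_, h⟩
        exact ⟨h, by omega⟩
      · rintro ⟨h, h0⟩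
        have ha : 0 < a := Nat.pos_of_ne_zero fun h' => h0 (by rw [← h, h', zero_mul])
        have hb : 0 < b := Nat.pos_of_ne_zero fun h' => h0 (by rw [← h, h', mul_zero])
        have h5 : a ≤ a * b := Nat.le_mul_of_pos_right a hb
        have h6 : b ≤ a * b := Nat.le_mul_of_pos_left b ha
        omega
    beta_reduce
    rw [h4, ArithmeticFunction.mul_apply, ofReal_sum, Finset.mul_sum, Finset.sum_mul]
    refine Finset.sum_congr rfl fun p hp => ?_
    have h5 := (Nat.mem_divisorsAntidiagonal.mp hp).1
    have hn0 : (0 : ℝ) < n := by exact_mod_cast hn.1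
    have h6 : 0 ≤ Real.log (x / n) := by
      refine Real.log_nonneg ((one_le_div hn0).mpr ?_)
      exact (Nat.le_floor_iff hx).mp hn.2
    simp only [hF]
    have h7 : ((p.1 : ℝ) * p.2) = n := by exact_mod_cast h5
    have h8 : χ (n : ZMod q) = χ (p.1 : ZMod q) * χ (p.2 : ZMod q) := by
      rw [← map_mul, ← Nat.cast_mul, h5]
    rw [h7, max_eq_left h6, h8]
    push_cast
    ring
  · intro p hp
    rw [Finset.mem_filter, hS, Finset.mem_product, Finset.mem_Icc, Finset.mem_Icc] at hp
    exact Finset.mem_Icc.mpr ⟨Nat.mul_pos hp.1.1.1 hp.1.2.1, hp.2⟩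

lemma bilin_congr {q : ℕ} (χ : DirichletCharacter ℂ q) {c c' d d' : ℕ → ℂ} {M N : ℕ} (x : ℝ)
    (hc : ∀ m, 1 ≤ m → m ≤ M → c m = c' m) (hd : ∀ k, 1 ≤ k → k ≤ N → d k = d' k) :
    bilin χ c d M N x = bilin χ c' d' M N x := by
  refine Finset.sum_congr rfl fun m hm => Finset.sum_congr rfl fun k hk => ?_
  rw [Finset.mem_Icc] at hm hk
  rw [hc m hm.1 hm.2, hd k hk.1 hk.2]

/-- The convolution of the tail of `Λ` with the constant function `1`. -/
noncomputable def vonMangoldtTail (U n : ℕ) : ℝ := ∑ d ∈ n.divisors, (Λ d - trunc Λ U d)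

lemma trunc_vonMangoldt_nonneg (U d : ℕ) : 0 ≤ trunc Λ U d := by
  rw [trunc_apply]
  split_ifs
  · exact vonMangoldt_nonneg
  · exact le_rfl

lemma trunc_vonMangoldt_le (U d : ℕ) : trunc Λ U d ≤ Λ d := by
  rw [trunc_apply]
  split_ifs
  · exact le_rfl
  · exact vonMangoldt_nonneg

lemma vonMangoldtTail_nonneg (U n : ℕ) : 0 ≤ vonMangoldtTail U n :=
  Finset.sum_nonneg fun d _ => sub_nonneg.mpr (trunc_vonMangoldt_le U d)

lemma vonMangoldtTail_le (U n : ℕ) : vonMangoldtTail U n ≤ Real.log n := by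
  rw [← vonMangoldt_sum]
  exact Finset.sum_le_sum fun d _ => sub_le_self _ (trunc_vonMangoldt_nonneg U d)

lemma vonMangoldtTail_eq_zero {U n : ℕ} (h : n ≤ U) : vonMangoldtTail U n = 0 := by
  refine Finset.sum_eq_zero fun d hd => ?_
  rw [trunc_apply, if_pos ((Nat.divisor_le hd).trans h), sub_self]

lemma abs_trunc_moebius_le (U n : ℕ) : |trunc (moebius : ArithmeticFunction ℝ) U n| ≤ 1 := by
  rw [trunc_apply]
  split_ifs
  · rw [intCoe_apply]
    exact_mod_cast abs_moebius_le_one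
  · simp

lemma abs_trunc_mul_trunc_le (U n : ℕ) :
    |(trunc (moebius : ArithmeticFunction ℝ) U * trunc Λ U) n| ≤ Real.log n := by
  rw [ArithmeticFunction.mul_apply, ← vonMangoldt_sum,
    ← Nat.sum_divisorsAntidiagonal' (f := fun _ i => Λ i)]
  refine (Finset.abs_sum_le_sum_abs _ _).trans (Finset.sum_le_sum fun p _ => ?_)
  rw [abs_mul, abs_of_nonneg (trunc_vonMangoldt_nonneg U _)]
  refine (mul_le_of_le_one_left (trunc_vonMangoldt_nonneg U _) (abs_trunc_moebius_le U _)).trans ?_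
  exact trunc_vonMangoldt_le U _

lemma trunc_mul_trunc_eq_zero (f g : ArithmeticFunction ℝ) {U n : ℕ} (h : U ^ 2 < n) :
    (trunc f U * trunc g U) n = 0 := by
  rw [ArithmeticFunction.mul_apply]
  refine Finset.sum_eq_zero fun p hp => ?_
  have h1 := (Nat.mem_divisorsAntidiagonal.mp hp).1
  rw [trunc_apply, trunc_apply]
  split_ifs with h2 h3
  · nlinarith
  · simp
  · simp
  · simp

lemma card_primChars_le (q : ℕ) [NeZero q] : (primChars q).card ≤ q.totient := by
  have h := DirichletCharacter.card_eq_totient_of_hasEnoughRootsOfUnity ℂ q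
  rw [← h]
  refine (Finset.card_le_univ _).trans_eq ?_
  rw [Nat.card_eq_fintype_card]

/-- The tail of the Möbius function. -/
noncomputable def moebiusTail (U : ℕ) : ArithmeticFunction ℝ :=
  (moebius : ArithmeticFunction ℝ) - trunc (moebius : ArithmeticFunction ℝ) U

lemma moebiusTail_eq_zero {U n : ℕ} (h : n ≤ U) : moebiusTail U n = 0 := by
  change (moebius : ArithmeticFunction ℝ) n - trunc (moebius : ArithmeticFunction ℝ) U n = 0
  rw [trunc_apply, if_pos h, sub_self]

lemma abs_moebiusTail_le (U n : ℕ) : |moebiusTail U n| ≤ 1 := by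
  change |(moebius : ArithmeticFunction ℝ) n - trunc (moebius : ArithmeticFunction ℝ) U n| ≤ 1
  rw [trunc_apply]
  split_ifs
  · simp
  · rw [sub_zero, intCoe_apply]
    exact_mod_cast abs_moebius_le_one

lemma vonMangoldt_eq_vaughan (U n : ℕ) :
    Λ n = trunc Λ U n + (trunc (moebius : ArithmeticFunction ℝ) U * ArithmeticFunction.log) n -
      (trunc (moebius : ArithmeticFunction ℝ) U * trunc Λ U *
        (zeta : ArithmeticFunction ℝ)) n +
      ((Λ - trunc Λ U) * (zeta : ArithmeticFunction ℝ) * moebiusTail U) n := by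
  have h := vaughan_identity (R := ArithmeticFunction ℝ) vonMangoldt_mul_zeta
    (coe_moebius_mul_coe_zeta (R := ℝ)) (trunc Λ U) (trunc (moebius : ArithmeticFunction ℝ) U)
  exact congrArg (fun f : ArithmeticFunction ℝ => f n) h

lemma logSum_twist_eq_vaughan {q : ℕ} (χ : DirichletCharacter ℂ q) (U : ℕ) {x : ℝ} (hx : 0 ≤ x) :
    logSum (twist χ) x = logSum (fun n => χ n * ((trunc Λ U n : ℝ) : ℂ)) x +
      bilin χ (fun m => ((trunc (moebius : ArithmeticFunction ℝ) U m : ℝ) : ℂ))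
        (fun k => ((Real.log k : ℝ) : ℂ)) ⌊x⌋₊ ⌊x⌋₊ x -
      bilin χ (fun m => (((trunc (moebius : ArithmeticFunction ℝ) U * trunc Λ U) m : ℝ) : ℂ))
        (fun _ => ((1 : ℝ) : ℂ)) ⌊x⌋₊ ⌊x⌋₊ x +
      bilin χ (fun m => if m ≤ ⌊x⌋₊ then ((vonMangoldtTail U m : ℝ) : ℂ) else 0)
        (fun k => ((moebiusTail U k : ℝ) : ℂ)) ⌊x⌋₊ ⌊x⌋₊ x := by
  have h1 := logSum_mul χ (trunc (moebius : ArithmeticFunction ℝ) U) ArithmeticFunction.log hx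
  have h2 := logSum_mul χ (trunc (moebius : ArithmeticFunction ℝ) U * trunc Λ U)
    (zeta : ArithmeticFunction ℝ) hx
  have h3 := logSum_mul χ ((Λ - trunc Λ U) * (zeta : ArithmeticFunction ℝ)) (moebiusTail U) hx
  have h4 : bilin χ (fun m => (((trunc (moebius : ArithmeticFunction ℝ) U * trunc Λ U) m : ℝ) : ℂ))
      (fun k => (((zeta : ArithmeticFunction ℝ) k : ℝ) : ℂ)) ⌊x⌋₊ ⌊x⌋₊ x =
      bilin χ (fun m => (((trunc (moebius : ArithmeticFunction ℝ) U * trunc Λ U) m : ℝ) : ℂ))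
        (fun _ => ((1 : ℝ) : ℂ)) ⌊x⌋₊ ⌊x⌋₊ x :=
    bilin_congr χ x (fun _ _ _ => rfl) fun k hk _ => by
      rw [natCoe_apply, zeta_apply_ne (by omega), Nat.cast_one]
  have h5 : bilin χ (fun m => ((((Λ - trunc Λ U) * (zeta : ArithmeticFunction ℝ)) m : ℝ) : ℂ))
      (fun k => ((moebiusTail U k : ℝ) : ℂ)) ⌊x⌋₊ ⌊x⌋₊ x =
      bilin χ (fun m => if m ≤ ⌊x⌋₊ then ((vonMangoldtTail U m : ℝ) : ℂ) else 0)
        (fun k => ((moebiusTail U k : ℝ) : ℂ)) ⌊x⌋₊ ⌊x⌋₊ x :=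
    bilin_congr χ x (fun m _ hm => by
      rw [if_pos hm, coe_mul_zeta_apply]
      rfl) fun _ _ _ => rfl
  rw [h4] at h2
  rw [h5] at h3
  refine Eq.trans ?_ (congrArg₂ (· + ·) (congrArg₂ (· - ·) (congrArg₂ (· + ·) rfl h1) h2) h3)
  unfold logSum
  simp only []
  rw [← Finset.sum_add_distrib, ← Finset.sum_sub_distrib, ← Finset.sum_add_distrib]
  refine Finset.sum_congr rfl fun n _ => ?_
  rw [twist, vonMangoldt_eq_vaughan U n]
  push_cast
  ring

lemma norm_logSum_trunc_le {q : ℕ} (χ : DirichletCharacter ℂ q) (U : ℕ) {x : ℝ} (hx : 1 ≤ x) :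
    ‖logSum (fun n => χ n * ((trunc Λ U n : ℝ) : ℂ)) x‖ ≤ U * Real.log x ^ 2 := by
  have hlog := Real.log_nonneg hx
  have h1 : ∀ n ∈ Finset.Icc 1 ⌊x⌋₊, ‖χ n * ((trunc Λ U n : ℝ) : ℂ) * Real.log (x / n)‖ ≤
      if n ∈ Finset.Icc 1 U then Real.log x ^ 2 else 0 := by
    intro n hn
    rw [Finset.mem_Icc] at hn
    have hn1 : (1 : ℝ) ≤ n := by exact_mod_cast hn.1
    have hnx : (n : ℝ) ≤ x := (Nat.le_floor_iff (by linarith)).mp hn.2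
    split_ifs with h
    · rw [norm_mul, norm_mul, norm_real, norm_real, Real.norm_eq_abs, Real.norm_eq_abs,
        abs_of_nonneg (trunc_vonMangoldt_nonneg U n),
        abs_of_nonneg (Real.log_nonneg ((one_le_div (by linarith)).mpr hnx))]
      have h2 : trunc Λ U n ≤ Real.log x :=
        (trunc_vonMangoldt_le U n).trans (vonMangoldt_le_log.trans (Real.log_le_log (by linarith) hnx))
      have h3 : Real.log (x / n) ≤ Real.log x :=
        Real.log_le_log (by positivity) (div_le_self (by linarith) hn1)
      rw [sq]
      refine mul_le_mul ?_ h3 (Real.log_nonneg ((one_le_div (by linarith)).mpr hnx)) hlog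
      exact (mul_le_of_le_one_left (trunc_vonMangoldt_nonneg U n) (χ.norm_le_one _)).trans h2
    · rw [Finset.mem_Icc] at h
      rw [trunc_apply, if_neg (by omega)]
      simp
  refine (norm_sum_le_of_le _ h1).trans ?_
  rw [← Finset.sum_filter, Finset.sum_const, nsmul_eq_mul]
  refine mul_le_mul_of_nonneg_right ?_ (by positivity)
  have : (Finset.filter (fun m => m ∈ Finset.Icc 1 U) (Finset.Icc 1 ⌊x⌋₊)).card ≤ U := by
    refine (Finset.card_le_card (t := Finset.Icc 1 U) fun m hm => (Finset.mem_filter.mp hm).2).trans ?_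
    simp
  exact_mod_cast this

lemma norm_logSum_twist_le {q : ℕ} [NeZero q] {χ : DirichletCharacter ℂ q} (hχ : χ ≠ 1)
    {U : ℕ} (hU : 1 ≤ U) {x : ℝ} (hx : 1 ≤ x) (hlog : 1 ≤ Real.log x) :
    ‖logSum (twist χ) x‖ ≤ 7 * q * U ^ 2 * Real.log x ^ 2 +
      ‖bilin χ (fun m => if m ≤ ⌊x⌋₊ then ((vonMangoldtTail U m : ℝ) : ℂ) else 0)
        (fun k => ((moebiusTail U k : ℝ) : ℂ)) ⌊x⌋₊ ⌊x⌋₊ x‖ := by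
  have hfl : (⌊x⌋₊ : ℝ) ≤ x := Nat.floor_le (by linarith)
  have hle : ∀ k ≤ ⌊x⌋₊, Real.log (k : ℝ) ≤ Real.log x := by
    intro k hk
    rcases Nat.eq_zero_or_pos k with rfl | h
    · simpa using (by linarith : 0 ≤ Real.log x)
    · exact Real.log_le_log (by exact_mod_cast h) ((Nat.cast_le.mpr hk).trans hfl)
  have h1 := norm_logSum_trunc_le χ U hx
  have h2 := norm_bilin_typeI_le (χ := χ) (f := fun m =>
      ((trunc (moebius : ArithmeticFunction ℝ) U m : ℝ) : ℂ)) (g := fun k => Real.log k)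
      (F := 1) (G := Real.log x) (Y := U) (X := ⌊x⌋₊) hχ hx hfl zero_le_one
      (fun m hm => by rw [trunc_apply, if_neg (by omega), ofReal_zero])
      (fun m _ _ => by
        rw [norm_real, Real.norm_eq_abs]
        exact abs_trunc_moebius_le U m)
      (fun k => Real.log_natCast_nonneg k)
      (fun k hk => Real.log_le_log (by exact_mod_cast hk) (by push_cast; linarith)) hle
  have h3 := norm_bilin_typeI_le (χ := χ) (f := fun m =>
      (((trunc (moebius : ArithmeticFunction ℝ) U * trunc Λ U) m : ℝ) : ℂ)) (g := fun _ => 1)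
      (F := Real.log x) (G := 1) (Y := U ^ 2) (X := ⌊x⌋₊) hχ hx hfl (by linarith)
      (fun m hm => by rw [trunc_mul_trunc_eq_zero _ _ hm, ofReal_zero])
      (fun m _ hm => by
        rw [norm_real, Real.norm_eq_abs]
        exact (abs_trunc_mul_trunc_le U m).trans (hle m hm))
      (fun k => zero_le_one) (fun k _ => le_rfl) (fun k _ => le_rfl)
  rw [logSum_twist_eq_vaughan χ U (by linarith)]
  refine (norm_add_le _ _).trans (add_le_add ?_ le_rfl)
  refine (norm_sub_le _ _).trans ((add_le_add ((norm_add_le _ _).trans (add_le_add h1 h2)) h3).trans ?_)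
  have hU1 : (1 : ℝ) ≤ U := by exact_mod_cast hU
  have hq1 : (1 : ℝ) ≤ q := by exact_mod_cast NeZero.one_le
  have hUU : (U : ℝ) ≤ U ^ 2 := by nlinarith
  have h4 : (U : ℝ) ≤ q * U ^ 2 := by nlinarith
  have h5 : (q : ℝ) * U ≤ q * U ^ 2 := by nlinarith
  push_cast
  calc _ = (U + 3 * (q * U) + 3 * (q * U ^ 2)) * Real.log x ^ 2 := by ring
    _ ≤ (q * U ^ 2 + 3 * (q * U ^ 2) + 3 * (q * U ^ 2)) * Real.log x ^ 2 := by gcongr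
    _ = _ := by ring

lemma ne_one_of_isPrimitive {q : ℕ} (hq : 1 < q) {χ : DirichletCharacter ℂ q} (h : χ.IsPrimitive) :
    χ ≠ 1 := by
  have : NeZero q := ⟨by omega⟩
  rintro rfl
  rw [DirichletCharacter.isPrimitive_def, DirichletCharacter.conductor_one] at h
  omega

/-- The mean value of the weighted character sums of `Λ` over primitive characters with
conductor in a dyadic interval. -/
theorem sum_norm_logSum_twist_le {x : ℝ} {R U : ℕ} (hR : 1 ≤ R) (hU : 1 ≤ U)
    (hx : 1 ≤ x) (hlog : 1 ≤ Real.log x) :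
    ∑ q ∈ Finset.Ioc R (2 * R), (1 : ℝ) / q.totient * ∑ χ ∈ primChars q,
      ‖logSum (twist χ) x‖ ≤
      384 * Real.log x ^ 3 * (R ^ 2 * U ^ 2 + R * √x + x / √U + x / R) := by
  set f : ℕ → ℂ := fun m => if m ≤ ⌊x⌋₊ then ((vonMangoldtTail U m : ℝ) : ℂ) else 0 with hf
  set g : ℕ → ℂ := fun k => ((moebiusTail U k : ℝ) : ℂ) with hg
  have h1 : ∀ q ∈ Finset.Ioc R (2 * R), (1 : ℝ) / q.totient * ∑ χ ∈ primChars q,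
      ‖logSum (twist χ) x‖ ≤ 14 * R * U ^ 2 * Real.log x ^ 2 +
      (1 : ℝ) / q.totient * ∑ χ ∈ primChars q, ‖bilin χ f g ⌊x⌋₊ ⌊x⌋₊ x‖ := by
    intro q hq
    rw [Finset.mem_Ioc] at hq
    have : NeZero q := ⟨by omega⟩
    have hφ : (0 : ℝ) < q.totient := by exact_mod_cast Nat.totient_pos.mpr (by omega)
    have hqR : (q : ℝ) ≤ 2 * R := by exact_mod_cast hq.2
    have hc : ((primChars q).card : ℝ) ≤ q.totient := by exact_mod_cast card_primChars_le q
    have h2 : ∑ χ ∈ primChars q, ‖logSum (twist χ) x‖ ≤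
        ∑ χ ∈ primChars q, (7 * (2 * R) * U ^ 2 * Real.log x ^ 2 +
          ‖bilin χ f g ⌊x⌋₊ ⌊x⌋₊ x‖) := by
      refine Finset.sum_le_sum fun χ hχ => ?_
      refine (norm_logSum_twist_le (ne_one_of_isPrimitive (by omega) (mem_primChars.mp hχ)) hU hx
        hlog).trans (add_le_add ?_ le_rfl)
      gcongr
    rw [Finset.sum_add_distrib, Finset.sum_const, nsmul_eq_mul] at h2
    refine (mul_le_mul_of_nonneg_left h2 (by positivity)).trans ?_
    rw [mul_add]
    refine add_le_add ?_ le_rfl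
    calc _ ≤ 1 / (q.totient : ℝ) * (q.totient * (7 * (2 * R) * U ^ 2 * Real.log x ^ 2)) := by
          gcongr
      _ = _ := by
          field_simp
          ring
  have hfb : ∀ m, ‖f m‖ ≤ Real.log x := by
    intro m
    simp only [hf]
    split_ifs with h
    · rw [norm_real, Real.norm_eq_abs, abs_of_nonneg (vonMangoldtTail_nonneg U m)]
      refine (vonMangoldtTail_le U m).trans ?_
      rcases Nat.eq_zero_or_pos m with rfl | hm
      · simpa using (by linarith : 0 ≤ Real.log x)
      · exact Real.log_le_log (by exact_mod_cast hm) ((Nat.le_floor_iff (by linarith)).mp h)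
    · simpa using (by linarith : 0 ≤ Real.log x)
  have h2 := sum_norm_bilin_typeII_le (f := f) (g := g) hR hU (by linarith : 0 ≤ Real.log x) hfb
    (fun k => by
      rw [hg, norm_real, Real.norm_eq_abs]
      exact abs_moebiusTail_le U k)
    (fun m hm => by simp [hf, vonMangoldtTail_eq_zero hm])
    (fun k hk => by simp [hg, moebiusTail_eq_zero hk]) hlog hx
  refine (Finset.sum_le_sum h1).trans ?_
  rw [Finset.sum_add_distrib, Finset.sum_const, Nat.card_Ioc, nsmul_eq_mul]
  refine (add_le_add le_rfl h2).trans ?_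
  have h3 : 2 * R - R = R := by omega
  rw [h3]
  have h4 : (R : ℝ) * (14 * R * U ^ 2 * Real.log x ^ 2) ≤
      384 * Real.log x ^ 3 * (R ^ 2 * U ^ 2) := by
    have h5 : 14 * Real.log x ^ 2 ≤ 384 * Real.log x ^ 3 := by nlinarith [sq_nonneg (Real.log x)]
    have h6 : 0 ≤ (R : ℝ) ^ 2 * U ^ 2 := by positivity
    nlinarith
  linarith

end Vaughan

section Characters

open Complex ArithmeticFunction DirichletCharacter

/-- The sum of `Λ(n) log (x / n)` over `n ≤ x` in the residue class of `a` modulo `q`. -/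
noncomputable def psiLog (x : ℝ) (q a : ℕ) : ℝ :=
  ∑ n ∈ Finset.Icc 1 ⌊x⌋₊, if n % q = a % q then Λ n * Real.log (x / n) else 0

lemma totient_mul_psiLog {q : ℕ} [NeZero q] {a : ℕ} (ha : a.Coprime q) (x : ℝ) :
    (q.totient : ℂ) * (psiLog x q a : ℂ) =
      ∑ χ : DirichletCharacter ℂ q, χ (a : ZMod q)⁻¹ * logSum (twist χ) x := by
  have hu : IsUnit (a : ZMod q) := (ZMod.isUnit_iff_coprime a q).mpr ha
  unfold logSum
  simp only [Finset.mul_sum]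
  rw [Finset.sum_comm, psiLog, ofReal_sum, Finset.mul_sum]
  refine Finset.sum_congr rfl fun n _ => ?_
  have h1 : ∑ χ : DirichletCharacter ℂ q, χ (a : ZMod q)⁻¹ * (twist χ n * (Real.log (x / n) : ℂ)) =
      (∑ χ : DirichletCharacter ℂ q, χ (a : ZMod q)⁻¹ * χ (n : ZMod q)) *
        ((Λ n : ℂ) * (Real.log (x / n) : ℂ)) := by
    rw [Finset.sum_mul]
    refine Finset.sum_congr rfl fun χ _ => ?_
    rw [twist]
    ring
  rw [h1, sum_char_inv_mul_char_eq ℂ hu]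
  have h2 : ((a : ZMod q) = (n : ZMod q)) ↔ n % q = a % q := by
    rw [ZMod.natCast_eq_natCast_iff]
    exact eq_comm
  simp only [h2]
  split_ifs
  · push_cast
    ring
  · simp

lemma abs_psiLog_sub_le {q : ℕ} [NeZero q] {a : ℕ} (ha : a.Coprime q) (x : ℝ) :
    |psiLog x q a - x / q.totient| ≤ (1 : ℝ) / q.totient * ∑ χ : DirichletCharacter ℂ q,
      ‖logSum (twist χ) x - if χ.conductor = 1 then (x : ℂ) else 0‖ := by
  have hφ : (0 : ℝ) < q.totient := by exact_mod_cast Nat.totient_pos.mpr (NeZero.pos q)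
  have hu : IsUnit (a : ZMod q) := (ZMod.isUnit_iff_coprime a q).mpr ha
  have hui : IsUnit (a : ZMod q)⁻¹ := .of_mul_eq_one _ (ZMod.inv_mul_of_unit _ hu)
  have h1 : (q.totient : ℂ) * (psiLog x q a : ℂ) - x = ∑ χ : DirichletCharacter ℂ q,
      χ (a : ZMod q)⁻¹ * (logSum (twist χ) x - if χ.conductor = 1 then (x : ℂ) else 0) := by
    simp only [mul_sub]
    rw [Finset.sum_sub_distrib, ← totient_mul_psiLog ha]
    congr 1
    rw [Finset.sum_eq_single (1 : DirichletCharacter ℂ q)]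
    · rw [conductor_one, if_pos rfl, MulChar.one_apply hui, one_mul]
    · intro χ _ hχ
      rw [if_neg fun h => hχ (eq_one_iff_conductor_eq_one.mpr h), mul_zero]
    · simp
  have h2 : |psiLog x q a - x / q.totient| = (1 : ℝ) / q.totient *
      ‖(q.totient : ℂ) * (psiLog x q a : ℂ) - x‖ := by
    have : (q.totient : ℂ) * (psiLog x q a : ℂ) - x =
        ((q.totient * (psiLog x q a - x / q.totient) : ℝ) : ℂ) := by
      push_cast
      have : (q.totient : ℂ) ≠ 0 := by exact_mod_cast hφ.ne'
      field_simp
    rw [this, norm_real, Real.norm_eq_abs, abs_mul, abs_of_pos hφ]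
    field_simp
  rw [h2, h1]
  refine mul_le_mul_of_nonneg_left (norm_sum_le_of_le _ fun χ _ => ?_) (by positivity)
  rw [norm_mul]
  exact mul_le_of_le_one_left (norm_nonneg _) (χ.norm_le_one _)

lemma natLog_two_le {x : ℝ} (hx : 1 ≤ x) : (Nat.log 2 ⌊x⌋₊ : ℝ) ≤ 3 / 2 * Real.log x := by
  have hX : ⌊x⌋₊ ≠ 0 := (Nat.floor_pos.mpr hx).ne'
  have h1 : ((2 ^ Nat.log 2 ⌊x⌋₊ : ℕ) : ℝ) ≤ x :=
    (Nat.cast_le.mpr (Nat.pow_log_le_self 2 hX)).trans (Nat.floor_le (by linarith))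
  push_cast at h1
  have h2 := Real.log_le_log (by positivity) h1
  rw [Real.log_pow] at h2
  have h3 := Real.log_two_gt_d9
  have h4 : (0 : ℝ) ≤ Nat.log 2 ⌊x⌋₊ := Nat.cast_nonneg _
  nlinarith

lemma sum_vonMangoldt_not_coprime_le {q : ℕ} (hq : q ≠ 0) {x : ℝ} (hx : 1 ≤ x)
    (hqx : (q : ℝ) ≤ x) :
    ∑ n ∈ (Finset.Icc 1 ⌊x⌋₊).filter (fun n => ¬ n.Coprime q), Λ n ≤ 3 * Real.log x ^ 3 := by
  have hlog := Real.log_nonneg hx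
  set S := (Finset.Icc 1 ⌊x⌋₊).filter (fun n => ¬ n.Coprime q) with hS
  set T := (q.primeFactors ×ˢ Finset.Icc 1 (Nat.log 2 ⌊x⌋₊)).image (fun p => p.1 ^ p.2) with hT
  have h1 : ∀ n ∈ S, Λ n ≤ if n ∈ T then Real.log x else 0 := by
    intro n hn
    rw [hS, Finset.mem_filter, Finset.mem_Icc] at hn
    obtain ⟨⟨hn1, hnX⟩, hnq⟩ := hn
    have hnx : (n : ℝ) ≤ x := (Nat.le_floor_iff (by linarith)).mp hnX
    split_ifs with h
    · exact vonMangoldt_le_log.trans (Real.log_le_log (by exact_mod_cast hn1) hnx)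
    · rw [vonMangoldt_eq_zero_iff.mpr]
      intro hpp
      obtain ⟨p, k, hp, hk, rfl⟩ := (isPrimePow_nat_iff n).mp hpp
      refine h (Finset.mem_image.mpr ⟨(p, k), Finset.mem_product.mpr ⟨?_, ?_⟩, rfl⟩)
      · refine Nat.mem_primeFactors.mpr ⟨hp, ?_, hq⟩
        by_contra hpq
        exact hnq (((Nat.Prime.coprime_iff_not_dvd hp).mpr hpq).pow_left k)
      · refine Finset.mem_Icc.mpr ⟨hk, Nat.le_log_of_pow_le (by norm_num) ?_⟩
        exact (Nat.pow_le_pow_left hp.two_le k).trans hnX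
  refine (Finset.sum_le_sum h1).trans ?_
  rw [← Finset.sum_filter, Finset.sum_const, nsmul_eq_mul]
  have h2 : ((S.filter (fun n => n ∈ T)).card : ℝ) ≤ 3 * Real.log x ^ 2 := by
    have h3 : (S.filter (fun n => n ∈ T)).card ≤ q.primeFactors.card * Nat.log 2 ⌊x⌋₊ := by
      refine (Finset.card_le_card (t := T) fun m hm => (Finset.mem_filter.mp hm).2).trans ?_
      refine Finset.card_image_le.trans_eq ?_
      rw [Finset.card_product, Nat.card_Icc, Nat.add_sub_cancel]
    have hq0 : (0 : ℝ) < q := by exact_mod_cast Nat.pos_of_ne_zero hq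
    have h4 : (q.primeFactors.card : ℝ) ≤ 2 * Real.log x :=
      (card_primeFactors_le q hq).trans
        (mul_le_mul_of_nonneg_left (Real.log_le_log hq0 hqx) (by norm_num))
    calc _ ≤ ((q.primeFactors.card * Nat.log 2 ⌊x⌋₊ : ℕ) : ℝ) := by exact_mod_cast h3
      _ ≤ (2 * Real.log x) * (3 / 2 * Real.log x) := by
          push_cast
          exact mul_le_mul h4 (natLog_two_le hx) (Nat.cast_nonneg _) (by positivity)
      _ = _ := by ring
  calc _ ≤ 3 * Real.log x ^ 2 * Real.log x := mul_le_mul_of_nonneg_right h2 hlog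
    _ = _ := by ring

lemma norm_apply_sub_primitiveCharacter_le {q : ℕ} [NeZero q] (χ : DirichletCharacter ℂ q)
    (n : ℕ) : ‖χ n - χ.primitiveCharacter n‖ ≤ if ¬ n.Coprime q then 1 else 0 := by
  by_cases h : n.Coprime q
  · have h1 := primitiveCharacter_apply_of_isCoprime (χ := χ) (a := (n : ℤ))
      (Nat.isCoprime_iff_coprime.mpr h)
    push_cast at h1
    rw [h1, sub_self, norm_zero, if_neg (not_not.mpr h)]
  · have hu : ¬ IsUnit (n : ZMod q) := fun hu => h ((ZMod.isUnit_iff_coprime n q).mp hu)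
    rw [χ.map_nonunit hu, zero_sub, norm_neg, if_pos h]
    exact χ.primitiveCharacter.norm_le_one _

lemma norm_logSum_twist_sub_primitive_le {q : ℕ} [NeZero q] (χ : DirichletCharacter ℂ q) {x : ℝ}
    (hx : 1 ≤ x) (hqx : (q : ℝ) ≤ x) :
    ‖logSum (twist χ) x - logSum (twist χ.primitiveCharacter) x‖ ≤ 3 * Real.log x ^ 4 := by
  have hlog := Real.log_nonneg hx
  unfold logSum
  rw [← Finset.sum_sub_distrib]
  have h1 : ∀ n ∈ Finset.Icc 1 ⌊x⌋₊, ‖twist χ n * (Real.log (x / n) : ℂ) -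
      twist χ.primitiveCharacter n * (Real.log (x / n) : ℂ)‖ ≤
      (if ¬ n.Coprime q then Λ n else 0) * Real.log x := by
    intro n hn
    rw [Finset.mem_Icc] at hn
    have hn1 : (1 : ℝ) ≤ n := by exact_mod_cast hn.1
    have hnx : (n : ℝ) ≤ x := (Nat.le_floor_iff (by linarith)).mp hn.2
    have h2 : twist χ n * (Real.log (x / n) : ℂ) -
        twist χ.primitiveCharacter n * (Real.log (x / n) : ℂ) =
        (χ n - χ.primitiveCharacter n) * ((Λ n : ℝ) : ℂ) * (Real.log (x / n) : ℂ) := by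
      rw [twist, twist]
      ring
    have h3 : 0 ≤ Real.log (x / n) := Real.log_nonneg ((one_le_div (by linarith)).mpr hnx)
    rw [h2, norm_mul, norm_mul, norm_real, norm_real, Real.norm_eq_abs, Real.norm_eq_abs,
      abs_of_nonneg vonMangoldt_nonneg, abs_of_nonneg h3]
    have h4 : ‖χ n - χ.primitiveCharacter n‖ * Λ n ≤ if ¬ n.Coprime q then Λ n else 0 := by
      refine (mul_le_mul_of_nonneg_right (norm_apply_sub_primitiveCharacter_le χ n)
        vonMangoldt_nonneg).trans_eq ?_
      rw [ite_mul, one_mul, zero_mul]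
    have h5 : 0 ≤ if ¬ n.Coprime q then Λ n else 0 :=
      (mul_nonneg (norm_nonneg _) vonMangoldt_nonneg).trans h4
    exact mul_le_mul h4 (Real.log_le_log (by positivity) (div_le_self (by linarith) hn1)) h3 h5
  refine (norm_sum_le_of_le _ h1).trans ?_
  rw [← Finset.sum_mul, ← Finset.sum_filter]
  refine (mul_le_mul_of_nonneg_right (sum_vonMangoldt_not_coprime_le (NeZero.ne q) hx hqx)
    hlog).trans_eq ?_
  ring

open scoped Classical in
lemma sum_primitiveCharacter_le {q : ℕ} [NeZero q]
    (G : (d : ℕ) → DirichletCharacter ℂ d → ℝ) (hG : ∀ d χ, 0 ≤ G d χ) :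
    ∑ χ : DirichletCharacter ℂ q, G χ.conductor χ.primitiveCharacter ≤
      ∑ d ∈ q.divisors, ∑ ψ ∈ primChars d, G d ψ := by
  set i : DirichletCharacter ℂ q → (Σ d : ℕ, DirichletCharacter ℂ d) :=
    fun χ => ⟨χ.conductor, χ.primitiveCharacter⟩ with hi
  set j : (Σ d : ℕ, DirichletCharacter ℂ d) → DirichletCharacter ℂ q :=
    fun s => if h : s.1 ∣ q then changeLevel h s.2 else 1 with hj
  have hij : Function.LeftInverse j i := by
    intro χ
    simp only [hi, hj]
    rw [dif_pos χ.conductor_dvd_level]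
    exact changeLevel_primitiveCharacter χ
  rw [Finset.sum_sigma' q.divisors primChars G]
  have h1 : ∑ χ : DirichletCharacter ℂ q, G χ.conductor χ.primitiveCharacter =
      ∑ s ∈ Finset.univ.image i, G s.1 s.2 := by
    rw [Finset.sum_image fun _ _ _ _ h => hij.injective h]
  rw [h1]
  refine Finset.sum_le_sum_of_subset_of_nonneg ?_ fun s _ _ => hG _ _
  intro s hs
  obtain ⟨χ, _, rfl⟩ := Finset.mem_image.mp hs
  exact Finset.mem_sigma.mpr ⟨Nat.mem_divisors.mpr ⟨χ.conductor_dvd_level, NeZero.ne q⟩,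
    mem_primChars.mpr χ.primitiveCharacter_isPrimitive⟩

/-- The total deviation of the weighted sums of `Λ` twisted by primitive characters modulo `d`
from their main terms. -/
noncomputable def primDev (x : ℝ) (d : ℕ) : ℝ :=
  ∑ ψ ∈ primChars d, ‖logSum (twist ψ) x - if d = 1 then (x : ℂ) else 0‖

lemma primDev_nonneg (x : ℝ) (d : ℕ) : 0 ≤ primDev x d := Finset.sum_nonneg fun _ _ => norm_nonneg _

/-- A bound for the deviation of `psiLog x q a` from its main term, uniform in `a`. -/
noncomputable def apDev (x : ℝ) (q : ℕ) : ℝ :=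
  3 * Real.log x ^ 4 + (1 : ℝ) / q.totient * ∑ d ∈ q.divisors, primDev x d

lemma abs_psiLog_sub_le_apDev {q a : ℕ} (hq : 1 ≤ q) (ha : a.Coprime q) {x : ℝ} (hx : 1 ≤ x)
    (hqx : (q : ℝ) ≤ x) : |psiLog x q a - x / q.totient| ≤ apDev x q := by
  have : NeZero q := ⟨by omega⟩
  have hφ : (0 : ℝ) < q.totient := by exact_mod_cast Nat.totient_pos.mpr hq
  refine (abs_psiLog_sub_le ha x).trans ?_
  have h1 : ∀ χ ∈ (Finset.univ : Finset (DirichletCharacter ℂ q)),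
      ‖logSum (twist χ) x - if χ.conductor = 1 then (x : ℂ) else 0‖ ≤ 3 * Real.log x ^ 4 +
      ‖logSum (twist χ.primitiveCharacter) x - if χ.conductor = 1 then (x : ℂ) else 0‖ := by
    intro χ _
    refine le_trans (le_of_eq ?_) ((norm_add_le _ _).trans
      (add_le_add (norm_logSum_twist_sub_primitive_le χ hx hqx) le_rfl))
    congr 1
    ring
  have h2 := sum_primitiveCharacter_le (q := q)
    (fun d ψ => ‖logSum (twist ψ) x - if d = 1 then (x : ℂ) else 0‖) fun _ _ => norm_nonneg _
  have h3 : ((Finset.univ : Finset (DirichletCharacter ℂ q)).card : ℝ) = q.totient := by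
    rw [← card_eq_totient_of_hasEnoughRootsOfUnity ℂ q, Nat.card_eq_fintype_card]
    rfl
  refine (mul_le_mul_of_nonneg_left (Finset.sum_le_sum h1) (by positivity)).trans ?_
  rw [Finset.sum_add_distrib, Finset.sum_const, nsmul_eq_mul, h3, mul_add, apDev]
  refine add_le_add (le_of_eq ?_) (mul_le_mul_of_nonneg_left h2 (by positivity))
  field_simp

lemma sum_divisors_div_totient_le (P : ℕ → ℝ) (hP : ∀ d, 0 ≤ P d) (Q : ℕ) :
    ∑ q ∈ Finset.Icc 1 Q, (1 : ℝ) / q.totient * ∑ d ∈ q.divisors, P d ≤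
      (∑ k ∈ Finset.Icc 1 Q, (1 : ℝ) / k.totient) *
        ∑ d ∈ Finset.Icc 1 Q, (1 : ℝ) / d.totient * P d := by
  set G : ℕ × ℕ → ℝ := fun p => (1 : ℝ) / p.1.totient * P p.1 * (1 / p.2.totient) with hG
  have hG0 : ∀ p, 0 ≤ G p := fun p => by
    have := hP p.1
    positivity
  have h1 : ∀ q ∈ Finset.Icc 1 Q, (1 : ℝ) / q.totient * ∑ d ∈ q.divisors, P d ≤
      ∑ p ∈ (Finset.Icc 1 Q ×ˢ Finset.Icc 1 Q).filter (fun p => p.1 * p.2 = q), G p := by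
    intro q hq
    rw [Finset.mem_Icc] at hq
    have h2 := Nat.divisorsAntidiagonal_eq_prod_filter_of_le (by omega : q ≠ 0) hq.2
    have h3 : Finset.Ioc 0 Q = Finset.Icc 1 Q := rfl
    rw [h3] at h2
    rw [← h2, ← Nat.sum_divisorsAntidiagonal (f := fun i _ => P i), Finset.mul_sum]
    refine Finset.sum_le_sum fun p hp => ?_
    obtain ⟨hp1, hp2⟩ := Nat.mem_divisorsAntidiagonal.mp hp
    have ha : 0 < p.1 := Nat.pos_of_ne_zero fun h' => hp2 (by rw [← hp1, h', zero_mul])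
    have hb : 0 < p.2 := Nat.pos_of_ne_zero fun h' => hp2 (by rw [← hp1, h', mul_zero])
    have ha' : (0 : ℝ) < p.1.totient := by exact_mod_cast Nat.totient_pos.mpr ha
    have hb' : (0 : ℝ) < p.2.totient := by exact_mod_cast Nat.totient_pos.mpr hb
    have h4 : (p.1.totient : ℝ) * p.2.totient ≤ q.totient := by
      rw [← hp1]
      exact_mod_cast Nat.totient_super_multiplicative p.1 p.2
    calc _ ≤ (1 : ℝ) / (p.1.totient * p.2.totient) * P p.1 :=
          mul_le_mul_of_nonneg_right (one_div_le_one_div_of_le (by positivity) h4) (hP _)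
      _ = _ := by
          simp only [hG]
          field_simp
  refine (Finset.sum_le_sum h1).trans ((Finset.sum_fiberwise_le_sum_of_sum_fiber_nonneg
    fun q _ => Finset.sum_nonneg fun p _ => hG0 p).trans_eq ?_)
  rw [mul_comm, Finset.sum_mul_sum, Finset.sum_product]

lemma sum_apDev_le (x : ℝ) {Q : ℕ} (hQ : 1 ≤ Q) :
    ∑ q ∈ Finset.Icc 1 Q, apDev x q ≤ Q * (3 * Real.log x ^ 4) +
      (2 * Real.log Q + 1) * (1 + Real.log Q) *
        ∑ d ∈ Finset.Icc 1 Q, (1 : ℝ) / d.totient * primDev x d := by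
  unfold apDev
  rw [Finset.sum_add_distrib, Finset.sum_const, nsmul_eq_mul, Nat.card_Icc, Nat.add_sub_cancel]
  refine add_le_add le_rfl ((sum_divisors_div_totient_le _ (primDev_nonneg x) Q).trans ?_)
  refine mul_le_mul_of_nonneg_right (sum_inv_totient_le Q hQ) (Finset.sum_nonneg fun d _ => ?_)
  have := primDev_nonneg x d
  positivity

end Characters

section MeanValue

open Complex ArithmeticFunction

lemma log_rpow_le_rpow {b η x : ℝ} (hb : 0 < b) (hη : 0 < η) (hx : 1 ≤ x) :
    Real.log x ^ b ≤ (b / η) ^ b * x ^ η := by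
  have hlog := Real.log_nonneg hx
  have h := rpow_le_exp hb (mul_nonneg hη.le hlog)
  rw [Real.mul_rpow hη.le hlog, mul_comm η, ← Real.rpow_def_of_pos (by linarith)] at h
  rw [Real.div_rpow hb.le hη.le, div_mul_eq_mul_div, le_div_iff₀ (Real.rpow_pos_of_pos hη b)]
  linarith

lemma rpow_neg_le_log_rpow_neg {b η x : ℝ} (hb : 0 < b) (hη : 0 < η) (hx : 1 < x) :
    x ^ (-η) ≤ (b / η) ^ b * Real.log x ^ (-b) := by
  have hlog := Real.log_pos hx
  have h := log_rpow_le_rpow hb hη hx.le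
  rw [Real.rpow_neg (by linarith), Real.rpow_neg hlog.le, inv_le_iff_one_le_mul₀
    (Real.rpow_pos_of_pos (by linarith) η), mul_right_comm, ← div_eq_mul_inv,
    one_le_div (Real.rpow_pos_of_pos hlog b)]
  exact h

lemma sum_Ioc_le_of_dyadic {g : ℕ → ℝ} (hg : ∀ d, 0 ≤ g d) {B : ℝ} (hB : 0 ≤ B) {R₀ Q : ℕ}
    (h : ∀ R, R₀ ≤ R → R ≤ Q → ∑ d ∈ Finset.Ioc R (2 * R), g d ≤ B) (J : ℕ) :
    ∀ R, R₀ ≤ R → Q ≤ 2 ^ J * R → ∑ d ∈ Finset.Ioc R Q, g d ≤ J * B := by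
  induction J with
  | zero =>
    intro R _ hQ
    rw [Finset.Ioc_eq_empty (by omega)]
    simp
  | succ J ih =>
    intro R hR hQ
    rcases le_or_gt Q R with h1 | h1
    · rw [Finset.Ioc_eq_empty (by omega), Finset.sum_empty]
      positivity
    · have h2 : Finset.Ioc R Q ⊆ Finset.Ioc R (2 * R) ∪ Finset.Ioc (2 * R) Q := by
        intro d hd
        simp only [Finset.mem_union, Finset.mem_Ioc] at *
        omega
      have h3 : Disjoint (Finset.Ioc R (2 * R)) (Finset.Ioc (2 * R) Q) :=
        Finset.disjoint_left.mpr fun d hd hd2 => by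
          rw [Finset.mem_Ioc] at hd hd2
          omega
      refine (Finset.sum_le_sum_of_subset_of_nonneg h2 fun d _ _ => hg d).trans ?_
      rw [Finset.sum_union h3]
      have h4 := ih (2 * R) (by omega) (by
        rw [pow_succ] at hQ
        linarith)
      push_cast
      linarith [h R hR h1.le]

lemma primDev_one_le (A : ℝ) : ∃ C : ℝ, 0 < C ∧ ∀ x : ℝ, 1 ≤ Real.log x → 1 ≤ x →
    primDev x 1 ≤ C * x * Real.log x ^ (-A) := by
  obtain ⟨C, hC, h⟩ := exists_abs_sum_vonMangoldt_log_le A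
  refine ⟨C, hC, fun x hlog hx => ?_⟩
  have h1 : ∀ ψ : DirichletCharacter ℂ 1, ‖logSum (twist ψ) x - if (1 : ℕ) = 1 then (x : ℂ) else 0‖ ≤
      C * x * Real.log x ^ (-A) := by
    intro ψ
    have h2 : logSum (twist ψ) x = ((∑ n ∈ Finset.Icc 1 ⌊x⌋₊, Λ n * Real.log (x / n) : ℝ) : ℂ) := by
      rw [logSum, ofReal_sum]
      refine Finset.sum_congr rfl fun n _ => ?_
      rw [twist, Subsingleton.elim ((n : ℕ) : ZMod 1) 1, map_one]
      push_cast
      ring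
    rw [if_pos rfl, h2, ← ofReal_sub, norm_real, Real.norm_eq_abs]
    exact h x hlog hx
  refine (Finset.sum_le_card_nsmul _ _ _ fun ψ _ => h1 ψ).trans ?_
  have h3 : ((primChars 1).card : ℝ) ≤ 1 := by exact_mod_cast card_primChars_le 1
  rw [nsmul_eq_mul]
  exact mul_le_of_le_one_left (by positivity) h3

lemma primDev_eq {d : ℕ} (hd : d ≠ 1) (x : ℝ) :
    primDev x d = ∑ ψ ∈ primChars d, ‖logSum (twist ψ) x‖ := by
  unfold primDev
  simp only [if_neg hd, sub_zero]

lemma two_le_of_one_le_log {x : ℝ} (hx : 1 ≤ x) (hlog : 1 ≤ Real.log x) : 2 ≤ x := by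
  have := Real.log_le_sub_one_of_pos (by linarith : 0 < x)
  linarith

lemma sum_primDev_small_le (A : ℝ) {B : ℝ} (hB : 0 < B) : ∃ C : ℝ, 0 < C ∧ ∀ x : ℝ,
    1 ≤ Real.log x → 1 ≤ x →
    ∑ d ∈ Finset.Ioc 1 ⌊Real.log x ^ B⌋₊, (1 : ℝ) / d.totient * primDev x d ≤
      C * x * Real.log x ^ (-A) := by
  obtain ⟨C, hC, h⟩ := siegel_walfisz (A + B) hB
  refine ⟨C, hC, fun x hlog hx => ?_⟩
  have hx2 := two_le_of_one_le_log hx hlog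
  have h0 : 0 < Real.log x := by linarith
  have h1 : ∀ d ∈ Finset.Ioc 1 ⌊Real.log x ^ B⌋₊, (1 : ℝ) / d.totient * primDev x d ≤
      C * x * Real.log x ^ (-(A + B)) := by
    intro d hd
    rw [Finset.mem_Ioc] at hd
    have : NeZero d := ⟨by omega⟩
    have hφ : (0 : ℝ) < d.totient := by exact_mod_cast Nat.totient_pos.mpr (by omega)
    have hdB : (d : ℝ) ≤ Real.log x ^ B := (Nat.le_floor_iff (by positivity)).mp hd.2
    have hc : ((primChars d).card : ℝ) ≤ d.totient := by exact_mod_cast card_primChars_le d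
    rw [primDev_eq (by omega)]
    have h2 : ∑ ψ ∈ primChars d, ‖logSum (twist ψ) x‖ ≤
        d.totient * (C * x * Real.log x ^ (-(A + B))) := by
      refine (Finset.sum_le_card_nsmul _ _ _ fun ψ hψ => h x d ψ hx2 (mem_primChars.mp hψ)
        (ne_one_of_isPrimitive hd.1 (mem_primChars.mp hψ)) hdB).trans ?_
      rw [nsmul_eq_mul]
      exact mul_le_mul_of_nonneg_right hc (by positivity)
    refine (mul_le_mul_of_nonneg_left h2 (by positivity)).trans_eq ?_
    field_simp
  refine (Finset.sum_le_card_nsmul _ _ _ h1).trans ?_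
  rw [nsmul_eq_mul, Nat.card_Ioc]
  have h3 : ((⌊Real.log x ^ B⌋₊ - 1 : ℕ) : ℝ) ≤ Real.log x ^ B :=
    (Nat.cast_le.mpr (Nat.sub_le _ _)).trans (Nat.floor_le (by positivity))
  calc _ ≤ Real.log x ^ B * (C * x * Real.log x ^ (-(A + B))) :=
        mul_le_mul_of_nonneg_right h3 (by positivity)
    _ = C * x * (Real.log x ^ B * Real.log x ^ (-(A + B))) := by ring
    _ = _ := by
        rw [← Real.rpow_add h0]
        ring_nf

lemma sum_primDev_dyadic_le {θ A : ℝ} (hθ : θ < 1 / 2) (hA : 0 < A) : ∃ C : ℝ, 0 < C ∧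
    ∀ (x : ℝ) (R : ℕ), 1 ≤ Real.log x → 1 ≤ x → 1 ≤ R → (R : ℝ) ≤ x ^ θ →
    Real.log x ^ (A + 3) ≤ 2 * R →
    ∑ d ∈ Finset.Ioc R (2 * R), (1 : ℝ) / d.totient * primDev x d ≤
      C * x * Real.log x ^ (-A) := by
  set δ : ℝ := (1 - 2 * θ) / 3 with hδ
  have hδ0 : 0 < δ := by
    rw [hδ]
    linarith
  set K : ℝ := ((A + 3) / (δ / 2)) ^ (A + 3) with hK
  have hK0 : 0 < K := by positivity
  refine ⟨384 * (4 * K + 2), by positivity, fun x R hlog hx hR hRθ hRlog => ?_⟩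
  have hx2 := two_le_of_one_le_log hx hlog
  have hx0 : 0 < x := by linarith
  have h0 : 0 < Real.log x := by linarith
  have hR0 : (0 : ℝ) < R := by exact_mod_cast hR
  have hxδ : 1 ≤ x ^ δ := Real.one_le_rpow hx hδ0.le
  set U : ℕ := ⌊x ^ δ⌋₊ with hU
  have hU1 : 1 ≤ U := Nat.le_floor (by simpa using hxδ)
  have hUle : (U : ℝ) ≤ x ^ δ := Nat.floor_le (by positivity)
  have hU1' : (1 : ℝ) ≤ U := by exact_mod_cast hU1
  have hUge : x ^ δ ≤ 2 * U := by
    have := Nat.lt_floor_add_one (x ^ δ)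
    rw [← hU] at this
    linarith
  have hmain := sum_norm_logSum_twist_le hR hU1 hx hlog
  have heq : ∑ d ∈ Finset.Ioc R (2 * R), (1 : ℝ) / d.totient * primDev x d =
      ∑ q ∈ Finset.Ioc R (2 * R), (1 : ℝ) / q.totient * ∑ χ ∈ primChars q,
      ‖logSum (twist χ) x‖ := by
    refine Finset.sum_congr rfl fun d hd => ?_
    rw [Finset.mem_Ioc] at hd
    rw [primDev_eq (by omega)]
  rw [heq]
  refine hmain.trans ?_
  set Y : ℝ := x * x ^ (-(δ / 2)) with hY
  have hYeq : Y = x ^ (1 - δ / 2) := by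
    rw [hY, sub_eq_add_neg, Real.rpow_add hx0, Real.rpow_one]
  have t1 : (R : ℝ) ^ 2 * U ^ 2 ≤ Y := by
    calc (R : ℝ) ^ 2 * U ^ 2 ≤ (x ^ θ) ^ 2 * (x ^ δ) ^ 2 := by gcongr
      _ = x ^ (1 - δ) := by
          rw [← Real.rpow_natCast, ← Real.rpow_natCast, ← Real.rpow_mul hx0.le,
            ← Real.rpow_mul hx0.le, ← Real.rpow_add hx0]
          congr 1
          push_cast
          rw [hδ]
          ring
      _ ≤ Y := by
          rw [hYeq]
          exact Real.rpow_le_rpow_of_exponent_le hx (by linarith)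
  have t2 : R * √x ≤ Y := by
    calc R * √x ≤ x ^ θ * x ^ (1 / 2 : ℝ) := by
          rw [Real.sqrt_eq_rpow]
          gcongr
      _ ≤ Y := by
          rw [hYeq, ← Real.rpow_add hx0]
          refine Real.rpow_le_rpow_of_exponent_le hx ?_
          rw [hδ]
          linarith
  have t3 : x / √U ≤ 2 * Y := by
    have h1 : x ^ (δ / 2) ≤ 2 * √U := by
      have h2 : x ^ (δ / 2) = √(x ^ δ) := by
        rw [Real.sqrt_eq_rpow, ← Real.rpow_mul hx0.le]
        ring_nf
      rw [h2]
      refine Real.sqrt_le_iff.mpr ⟨by positivity, ?_⟩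
      rw [mul_pow, Real.sq_sqrt (by linarith)]
      linarith
    have h3 : 0 < x ^ (δ / 2) := by positivity
    have h4 : 0 < √(U : ℝ) := Real.sqrt_pos.mpr (by linarith)
    rw [hY, Real.rpow_neg hx0.le, div_le_iff₀ h4]
    have : 2 * (x * (x ^ (δ / 2))⁻¹) * √U = x * ((2 * √U) / x ^ (δ / 2)) := by ring
    rw [this]
    exact le_mul_of_one_le_right hx0.le ((one_le_div h3).mpr h1)
  have hYK : Y ≤ K * (x * Real.log x ^ (-(A + 3))) := by
    have := rpow_neg_le_log_rpow_neg (b := A + 3) (η := δ / 2) (x := x) (by linarith)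
      (by linarith) (by linarith)
    rw [hY]
    calc _ ≤ x * (K * Real.log x ^ (-(A + 3))) := mul_le_mul_of_nonneg_left this hx0.le
      _ = _ := by ring
  have t4 : x / R ≤ 2 * (x * Real.log x ^ (-(A + 3))) := by
    rw [Real.rpow_neg h0.le, div_le_iff₀ hR0]
    have h3 : 0 < Real.log x ^ (A + 3) := by positivity
    have : 2 * (x * (Real.log x ^ (A + 3))⁻¹) * R = x * ((2 * R) / Real.log x ^ (A + 3)) := by ring
    rw [this]
    exact le_mul_of_one_le_right hx0.le ((one_le_div h3).mpr hRlog)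
  have hpow : Real.log x ^ 3 * Real.log x ^ (-(A + 3)) = Real.log x ^ (-A) := by
    rw [← Real.rpow_natCast, ← Real.rpow_add h0]
    congr 1
    push_cast
    ring
  calc _ ≤ 384 * Real.log x ^ 3 * ((4 * K + 2) * (x * Real.log x ^ (-(A + 3)))) := by
        refine mul_le_mul_of_nonneg_left ?_ (by positivity)
        linarith
    _ = 384 * (4 * K + 2) * x * (Real.log x ^ 3 * Real.log x ^ (-(A + 3))) := by ring
    _ = _ := by rw [hpow]

/-- The mean value of `primDev`, up to a power of `x` smaller than `1 / 2`. -/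
theorem sum_primDev_le {θ A : ℝ} (hθ : θ < 1 / 2) (hA : 0 < A) : ∃ C : ℝ, 0 < C ∧
    ∀ (x : ℝ) (Q : ℕ), 1 ≤ Real.log x → 1 ≤ x → (Q : ℝ) ≤ x ^ θ →
    ∑ d ∈ Finset.Icc 1 Q, (1 : ℝ) / d.totient * primDev x d ≤ C * x * Real.log x ^ (-A) := by
  obtain ⟨C₁, hC₁, h₁⟩ := primDev_one_le A
  obtain ⟨C₂, hC₂, h₂⟩ := sum_primDev_small_le A (B := A + 4) (by linarith)
  obtain ⟨C₃, hC₃, h₃⟩ := sum_primDev_dyadic_le (A := A + 1) hθ (by linarith)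
  refine ⟨C₁ + C₂ + 3 * C₃, by positivity, fun x Q hlog hx hQ => ?_⟩
  have hx0 : 0 < x := by linarith
  have h0 : 0 < Real.log x := by linarith
  have hg : ∀ d : ℕ, 0 ≤ (1 : ℝ) / d.totient * primDev x d := fun d =>
    mul_nonneg (by positivity) (primDev_nonneg x d)
  set g : ℕ → ℝ := fun d => (1 : ℝ) / d.totient * primDev x d with hgdef
  set R₀ : ℕ := ⌊Real.log x ^ (A + 4)⌋₊ with hR₀
  have hL1 : 1 ≤ Real.log x ^ (A + 4) := Real.one_le_rpow hlog (by linarith)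
  have hR₀1 : 1 ≤ R₀ := Nat.le_floor (by simpa using hL1)
  have hR₀2 : Real.log x ^ (A + 4) ≤ 2 * R₀ := by
    have := Nat.lt_floor_add_one (Real.log x ^ (A + 4))
    rw [← hR₀] at this
    have h2 : (1 : ℝ) ≤ R₀ := by exact_mod_cast hR₀1
    linarith
  have hsub : Finset.Icc 1 Q ⊆ ({1} ∪ Finset.Ioc 1 R₀) ∪ Finset.Ioc R₀ Q := by
    intro d hd
    simp only [Finset.mem_union, Finset.mem_Ioc, Finset.mem_Icc, Finset.mem_singleton] at *
    omega
  have hbig : ∑ d ∈ Finset.Ioc R₀ Q, g d ≤ 3 * C₃ * x * Real.log x ^ (-A) := by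
    have h4 := sum_Ioc_le_of_dyadic hg (B := C₃ * x * Real.log x ^ (-(A + 1))) (R₀ := R₀) (Q := Q)
      (by positivity) (fun R hR hRQ => h₃ x R hlog hx (hR₀1.trans hR)
        ((Nat.cast_le.mpr hRQ).trans hQ) (by
          have : (R₀ : ℝ) ≤ R := by exact_mod_cast hR
          have h5 : A + 1 + 3 = A + 4 := by ring
          rw [h5]
          linarith)) (Nat.log 2 Q + 1) R₀ le_rfl
      ((Nat.lt_pow_succ_log_self (by norm_num) Q).le.trans (Nat.le_mul_of_pos_right _ hR₀1))
    have hJ : ((Nat.log 2 Q + 1 : ℕ) : ℝ) ≤ 3 * Real.log x := by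
      have hQX : Q ≤ ⌊x⌋₊ := Nat.le_floor (hQ.trans ((Real.rpow_le_rpow_of_exponent_le hx
        (by linarith : θ ≤ 1)).trans_eq (Real.rpow_one x)))
      have h5 : (Nat.log 2 Q : ℝ) ≤ Nat.log 2 ⌊x⌋₊ := by exact_mod_cast Nat.log_mono_right hQX
      push_cast
      linarith [natLog_two_le hx]
    refine h4.trans ((mul_le_mul_of_nonneg_right hJ (by positivity)).trans_eq ?_)
    have hpow : Real.log x * Real.log x ^ (-(A + 1)) = Real.log x ^ (-A) := by
      nth_rewrite 1 [← Real.rpow_one (Real.log x)]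
      rw [← Real.rpow_add h0]
      congr 1
      ring
    calc _ = 3 * C₃ * x * (Real.log x * Real.log x ^ (-(A + 1))) := by ring
      _ = _ := by rw [hpow]
  have hone : g 1 ≤ C₁ * x * Real.log x ^ (-A) := by
    simpa [hgdef] using h₁ x hlog hx
  calc ∑ d ∈ Finset.Icc 1 Q, g d ≤ ∑ d ∈ ({1} ∪ Finset.Ioc 1 R₀) ∪ Finset.Ioc R₀ Q, g d :=
        Finset.sum_le_sum_of_subset_of_nonneg hsub fun d _ _ => hg d
    _ ≤ (g 1 + ∑ d ∈ Finset.Ioc 1 R₀, g d) + ∑ d ∈ Finset.Ioc R₀ Q, g d := by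
        have hun : ∀ s t : Finset ℕ, ∑ d ∈ s ∪ t, g d ≤ ∑ d ∈ s, g d + ∑ d ∈ t, g d := fun s t => by
          rw [← Finset.sum_union_inter]
          exact le_add_of_nonneg_right (Finset.sum_nonneg fun d _ => hg d)
        refine (hun _ _).trans (add_le_add ((hun _ _).trans_eq ?_) le_rfl)
        rw [Finset.sum_singleton]
    _ ≤ (C₁ * x * Real.log x ^ (-A) + C₂ * x * Real.log x ^ (-A)) +
          3 * C₃ * x * Real.log x ^ (-A) := add_le_add (add_le_add hone (h₂ x hlog hx)) hbig
    _ = _ := by ring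

/-- The mean value of `apDev`, up to a power of `x` smaller than `1 / 2`. -/
theorem sum_apDev_le_log_rpow {θ A : ℝ} (hθ : θ < 1 / 2) (hA : 0 < A) : ∃ C : ℝ, 0 < C ∧
    ∀ (x : ℝ) (Q : ℕ), 1 ≤ Real.log x → 1 ≤ x → (Q : ℝ) ≤ x ^ θ →
    ∑ q ∈ Finset.Icc 1 Q, apDev x q ≤ C * x * Real.log x ^ (-A) := by
  obtain ⟨C, hC, h⟩ := sum_primDev_le (A := A + 2) hθ (by linarith)
  set K : ℝ := ((A + 4) / (1 / 2)) ^ (A + 4) with hK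
  have hK0 : 0 < K := by positivity
  refine ⟨3 * K + 6 * C, by positivity, fun x Q hlog hx hQ => ?_⟩
  have hx2 := two_le_of_one_le_log hx hlog
  have hx0 : 0 < x := by linarith
  have h0 : 0 < Real.log x := by linarith
  rcases Nat.eq_zero_or_pos Q with rfl | hQ1
  · simpa using by positivity
  have hQ1' : (1 : ℝ) ≤ Q := by exact_mod_cast hQ1
  have hlogQ : Real.log Q ≤ Real.log x := by
    refine Real.log_le_log (by linarith) (hQ.trans ?_)
    exact (Real.rpow_le_rpow_of_exponent_le hx (by linarith : θ ≤ 1)).trans_eq (Real.rpow_one x)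
  have hlogQ0 : 0 ≤ Real.log Q := Real.log_nonneg hQ1'
  have hpow : ∀ (a : ℝ) (n : ℕ), Real.log x ^ n * Real.log x ^ (-(a + n)) = Real.log x ^ (-a) := by
    intro a n
    rw [← Real.rpow_natCast, ← Real.rpow_add h0]
    congr 1
    ring
  have h1 : Q * (3 * Real.log x ^ 4) ≤ 3 * K * x * Real.log x ^ (-A) := by
    have hQx : (Q : ℝ) ≤ x * x ^ (-(1 / 2 : ℝ)) := by
      refine hQ.trans ?_
      nth_rewrite 2 [← Real.rpow_one x]
      rw [← Real.rpow_add hx0]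
      exact Real.rpow_le_rpow_of_exponent_le hx (by linarith)
    have h2 := rpow_neg_le_log_rpow_neg (b := A + 4) (η := 1 / 2) (x := x) (by linarith)
      (by norm_num) (by linarith)
    have h3 : (Q : ℝ) ≤ x * (K * Real.log x ^ (-(A + 4))) :=
      hQx.trans (mul_le_mul_of_nonneg_left h2 hx0.le)
    have h4 := hpow A 4
    push_cast at h4
    calc _ ≤ x * (K * Real.log x ^ (-(A + 4))) * (3 * Real.log x ^ 4) :=
          mul_le_mul_of_nonneg_right h3 (by positivity)
      _ = 3 * K * x * (Real.log x ^ 4 * Real.log x ^ (-(A + 4))) := by ring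
      _ = _ := by rw [h4]
  have h2 : (2 * Real.log Q + 1) * (1 + Real.log Q) *
      ∑ d ∈ Finset.Icc 1 Q, (1 : ℝ) / d.totient * primDev x d ≤ 6 * C * x * Real.log x ^ (-A) := by
    have h4 := hpow A 2
    push_cast at h4
    calc _ ≤ (3 * Real.log x * (2 * Real.log x)) * (C * x * Real.log x ^ (-(A + 2))) := by
          refine mul_le_mul (mul_le_mul (by linarith) (by linarith) (by linarith) (by linarith))
            (h x Q hlog hx hQ) (Finset.sum_nonneg fun d _ => ?_) (by positivity)
          exact mul_nonneg (by positivity) (primDev_nonneg x d)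
      _ = 6 * C * x * (Real.log x ^ 2 * Real.log x ^ (-(A + 2))) := by ring
      _ = _ := by rw [h4]
  calc _ ≤ _ := sum_apDev_le x hQ1
    _ ≤ _ := add_le_add h1 h2
    _ = _ := by ring

end MeanValue

section Desmoothing

open ArithmeticFunction

/-- Chebyshev's function of an arithmetic progression. -/
noncomputable def psiAP (x : ℝ) (q a : ℕ) : ℝ :=
  ∑ n ∈ Finset.Icc 1 ⌊x⌋₊, if n % q = a % q then Λ n else 0

lemma log_mul_psiAP_le {y z : ℝ} (hy : 0 < y) (hyz : y ≤ z) (q a : ℕ) :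
    Real.log (z / y) * psiAP y q a ≤ psiLog z q a - psiLog y q a := by
  have hz := hy.trans_le hyz
  have hsub : Finset.Icc 1 ⌊y⌋₊ ⊆ Finset.Icc 1 ⌊z⌋₊ :=
    Finset.Icc_subset_Icc_right (Nat.floor_le_floor hyz)
  have h1 : ∑ n ∈ Finset.Icc 1 ⌊y⌋₊, (if n % q = a % q then Λ n * Real.log (z / n) else 0) ≤
      psiLog z q a := by
    refine Finset.sum_le_sum_of_subset_of_nonneg hsub fun n hn _ => ?_
    split_ifs
    · rw [Finset.mem_Icc] at hn
      have hn0 : (0 : ℝ) < n := by exact_mod_cast hn.1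
      refine mul_nonneg vonMangoldt_nonneg (Real.log_nonneg ?_)
      rw [le_div_iff₀ hn0, one_mul]
      exact (Nat.le_floor_iff hz.le).mp hn.2
    · exact le_rfl
  have h2 : ∑ n ∈ Finset.Icc 1 ⌊y⌋₊, (if n % q = a % q then Λ n * Real.log (z / n) else 0) =
      Real.log (z / y) * psiAP y q a + psiLog y q a := by
    rw [psiAP, psiLog, Finset.mul_sum, ← Finset.sum_add_distrib]
    refine Finset.sum_congr rfl fun n hn => ?_
    split_ifs
    · rw [Finset.mem_Icc] at hn
      have hn0 : (n : ℝ) ≠ 0 := by exact_mod_cast (by omega : n ≠ 0)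
      rw [Real.log_div hz.ne' hn0, Real.log_div hz.ne' hy.ne', Real.log_div hy.ne' hn0]
      ring
    · simp
  linarith

lemma psiLog_sub_le {y z : ℝ} (hy : 0 < y) (hyz : y ≤ z) (q a : ℕ) :
    psiLog z q a - psiLog y q a ≤ Real.log (z / y) * psiAP z q a := by
  have hz := hy.trans_le hyz
  have hsub : Finset.Icc 1 ⌊y⌋₊ ⊆ Finset.Icc 1 ⌊z⌋₊ :=
    Finset.Icc_subset_Icc_right (Nat.floor_le_floor hyz)
  have h1 : ∑ n ∈ Finset.Icc 1 ⌊z⌋₊, (if n % q = a % q then Λ n * Real.log (y / n) else 0) ≤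
      psiLog y q a := by
    rw [psiLog, ← Finset.sum_sdiff hsub]
    refine add_le_of_nonpos_left (Finset.sum_nonpos fun n hn => ?_)
    rw [Finset.mem_sdiff, Finset.mem_Icc, Finset.mem_Icc] at hn
    split_ifs
    · have hn0 : (0 : ℝ) < n := by exact_mod_cast hn.1.1
      have hyn : y < n := (Nat.floor_lt hy.le).mp (by omega)
      refine mul_nonpos_of_nonneg_of_nonpos vonMangoldt_nonneg
        (Real.log_nonpos (by positivity) ?_)
      rw [div_le_one hn0]
      exact hyn.le
    · exact le_rfl
  have h2 : psiLog z q a = Real.log (z / y) * psiAP z q a +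
      ∑ n ∈ Finset.Icc 1 ⌊z⌋₊, (if n % q = a % q then Λ n * Real.log (y / n) else 0) := by
    rw [psiAP, psiLog, Finset.mul_sum, ← Finset.sum_add_distrib]
    refine Finset.sum_congr rfl fun n hn => ?_
    split_ifs
    · rw [Finset.mem_Icc] at hn
      have hn0 : (n : ℝ) ≠ 0 := by exact_mod_cast (by omega : n ≠ 0)
      rw [Real.log_div hz.ne' hn0, Real.log_div hz.ne' hy.ne', Real.log_div hy.ne' hn0]
      ring
    · simp
  linarith

lemma abs_psiAP_sub_le {q a : ℕ} (hq : 1 ≤ q) (ha : a.Coprime q) {x h : ℝ} (hh : 0 < h)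
    (hh1 : h ≤ 1) (hx : 1 ≤ x * Real.exp (-h)) (hqx : (q : ℝ) ≤ x * Real.exp (-h)) :
    |psiAP x q a - x / q.totient| ≤ h * x * (1 / q.totient) +
      1 / h * (apDev (x * Real.exp h) q + apDev x q + apDev (x * Real.exp (-h)) q) := by
  have hφ : (0 : ℝ) < q.totient := by exact_mod_cast Nat.totient_pos.mpr hq
  have hx0 : 0 < x := by
    by_contra hc
    have := mul_nonpos_of_nonpos_of_nonneg (not_lt.mp hc) (Real.exp_pos (-h)).le
    linarith
  have hlo : x * Real.exp (-h) ≤ x :=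
    mul_le_of_le_one_right hx0.le (Real.exp_le_one_iff.mpr (by linarith))
  have hhi : x ≤ x * Real.exp h := le_mul_of_one_le_right hx0.le (Real.one_le_exp hh.le)
  have e1 := abs_le.mp (abs_psiLog_sub_le_apDev hq ha (hx.trans (hlo.trans hhi))
    (hqx.trans (hlo.trans hhi)))
  have e2 := abs_le.mp (abs_psiLog_sub_le_apDev hq ha (hx.trans hlo) (hqx.trans hlo))
  have e3 := abs_le.mp (abs_psiLog_sub_le_apDev hq ha hx hqx)
  have p1 := log_mul_psiAP_le hx0 hhi q a
  have p2 := psiLog_sub_le (mul_pos hx0 (Real.exp_pos (-h))) hlo q a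
  have l1 : Real.log (x * Real.exp h / x) = h := by
    rw [mul_div_cancel_left₀ _ hx0.ne', Real.log_exp]
  have l2 : Real.log (x / (x * Real.exp (-h))) = h := by
    rw [div_mul_cancel_left₀ hx0.ne', ← Real.exp_neg, neg_neg, Real.log_exp]
  rw [l1] at p1
  rw [l2] at p2
  have b1 := abs_le.mp (Real.abs_exp_sub_one_sub_id_le (x := h) (abs_le.mpr ⟨by linarith, hh1⟩))
  have b2 := abs_le.mp (Real.abs_exp_sub_one_sub_id_le (x := -h)
    (abs_le.mpr ⟨by linarith, by linarith⟩))
  have hxφ : 0 < x / q.totient := by positivity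
  have c1 : x * Real.exp h / q.totient ≤ x / q.totient * (1 + h + h ^ 2) := by
    rw [mul_div_right_comm]
    exact mul_le_mul_of_nonneg_left (by linarith [b1.2]) hxφ.le
  have c2 : x * Real.exp (-h) / q.totient ≤ x / q.totient * (1 - h + h ^ 2) := by
    rw [mul_div_right_comm]
    exact mul_le_mul_of_nonneg_left (by nlinarith [b2.2]) hxφ.le
  have key : h * |psiAP x q a - x / q.totient| ≤ h * (h * x * (1 / q.totient)) +
      (apDev (x * Real.exp h) q + apDev x q + apDev (x * Real.exp (-h)) q) := by
    rw [← abs_of_pos hh, ← abs_mul, abs_of_pos hh, abs_le]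
    have : h * (h * x * (1 / q.totient)) = x / q.totient * h ^ 2 := by ring
    rw [this]
    constructor <;> nlinarith
  calc |psiAP x q a - x / q.totient| = 1 / h * (h * |psiAP x q a - x / q.totient|) := by
        field_simp
    _ ≤ 1 / h * (h * (h * x * (1 / q.totient)) +
        (apDev (x * Real.exp h) q + apDev x q + apDev (x * Real.exp (-h)) q)) :=
        mul_le_mul_of_nonneg_left key (by positivity)
    _ = _ := by field_simp

lemma psiAP_le {x : ℝ} (hx : 1 ≤ x) (q a : ℕ) : psiAP x q a ≤ x * Real.log x := by
  have hx0 : 0 ≤ x := by linarith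
  have hl := Real.log_nonneg hx
  calc psiAP x q a ≤ ∑ n ∈ Finset.Icc 1 ⌊x⌋₊, Real.log x := by
        refine Finset.sum_le_sum fun n hn => ?_
        rw [Finset.mem_Icc] at hn
        have hn0 : (0 : ℝ) < n := by exact_mod_cast hn.1
        split_ifs
        · exact vonMangoldt_le_log.trans
            (Real.log_le_log hn0 ((Nat.le_floor_iff hx0).mp hn.2))
        · exact hl
    _ = ⌊x⌋₊ * Real.log x := by simp
    _ ≤ x * Real.log x := mul_le_mul_of_nonneg_right (Nat.floor_le hx0) hl

lemma abs_psiAP_sub_le_of_le {x y : ℝ} (hx : 1 ≤ x) (hxy : x ≤ y) {q : ℕ} (hq : 1 ≤ q) (a : ℕ) :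
    |psiAP x q a - x / q.totient| ≤ y * Real.log y + y := by
  have hφ : (1 : ℝ) ≤ q.totient := by exact_mod_cast Nat.totient_pos.mpr hq
  have h0 : 0 ≤ psiAP x q a := Finset.sum_nonneg fun n _ => by
    split_ifs
    · exact vonMangoldt_nonneg
    · exact le_rfl
  have h1 : psiAP x q a ≤ y * Real.log y := (psiAP_le hx q a).trans
    (mul_le_mul hxy (Real.log_le_log (by linarith) hxy) (Real.log_nonneg hx) (by linarith))
  have h2 : 0 ≤ x / q.totient := by positivity
  have h3 : x / q.totient ≤ y := (div_le_self (by linarith) hφ).trans hxy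
  rw [abs_le]
  constructor <;> linarith

/-- The sum of the worst deviations over the moduli up to `Q`. -/
noncomputable def totalDev (x : ℝ) (Q : ℕ) : ℝ :=
  ∑ q ∈ Finset.Icc 1 Q, ⨆ a : {a : ℕ // a.Coprime q}, |psiAP x q a - x / q.totient|

lemma totalDev_le_sum {x : ℝ} {Q : ℕ} {B : ℕ → ℝ}
    (h : ∀ q ∈ Finset.Icc 1 Q, ∀ a : ℕ, a.Coprime q → |psiAP x q a - x / q.totient| ≤ B q) :
    totalDev x Q ≤ ∑ q ∈ Finset.Icc 1 Q, B q := by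
  refine Finset.sum_le_sum fun q hq => ?_
  have : Nonempty {a : ℕ // a.Coprime q} := ⟨⟨1, Nat.coprime_one_left q⟩⟩
  exact ciSup_le fun a => h q hq a a.2

lemma totalDev_le_of_le {θ x y : ℝ} (hθ : θ < 1 / 2) (hx : 1 ≤ x) (hxy : x ≤ y) :
    totalDev x ⌊x ^ θ⌋₊ ≤ y * (y * Real.log y + y) := by
  have hy : 1 ≤ y := hx.trans hxy
  have hyl : 0 ≤ y * Real.log y + y := by
    have := Real.log_nonneg hy
    positivity
  refine (totalDev_le_sum (B := fun _ => y * Real.log y + y) fun q hq a _ =>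
    abs_psiAP_sub_le_of_le hx hxy (Finset.mem_Icc.mp hq).1 a).trans ?_
  rw [Finset.sum_const, Nat.card_Icc, nsmul_eq_mul, Nat.add_sub_cancel]
  refine mul_le_mul_of_nonneg_right ?_ hyl
  calc (⌊x ^ θ⌋₊ : ℝ) ≤ x ^ θ := Nat.floor_le (by positivity)
    _ ≤ x ^ (1 : ℝ) := Real.rpow_le_rpow_of_exponent_le hx (by linarith)
    _ ≤ y := by rwa [Real.rpow_one]

lemma totalDev_le {x h : ℝ} {Q : ℕ} (hQ : 1 ≤ Q) (hh : 0 < h) (hh1 : h ≤ 1)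
    (hQx : (Q : ℝ) ≤ x * Real.exp (-h)) :
    totalDev x Q ≤ h * x * ((2 * Real.log Q + 1) * (1 + Real.log Q)) +
      1 / h * (∑ q ∈ Finset.Icc 1 Q, apDev (x * Real.exp h) q + ∑ q ∈ Finset.Icc 1 Q, apDev x q +
        ∑ q ∈ Finset.Icc 1 Q, apDev (x * Real.exp (-h)) q) := by
  have hQ1 : (1 : ℝ) ≤ Q := by exact_mod_cast hQ
  have hx0 : 0 < x := by
    by_contra hc
    have := mul_nonpos_of_nonpos_of_nonneg (not_lt.mp hc) (Real.exp_pos (-h)).le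
    linarith
  refine (totalDev_le_sum fun q hq a ha => abs_psiAP_sub_le (Finset.mem_Icc.mp hq).1 ha hh hh1
    (hQ1.trans hQx) ((Nat.cast_le.mpr (Finset.mem_Icc.mp hq).2).trans hQx)).trans ?_
  rw [Finset.sum_add_distrib, ← Finset.mul_sum, ← Finset.mul_sum, Finset.sum_add_distrib,
    Finset.sum_add_distrib]
  exact add_le_add_left (mul_le_mul_of_nonneg_left (sum_inv_totient_le Q hQ) (by positivity)) _

lemma mul_log_rpow_neg_le {x y b : ℝ} (hb : 0 < b) (hx : 0 < x) (hl : 2 ≤ Real.log x)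
    (hlo : x * Real.exp (-1) ≤ y) (hhi : y ≤ x * Real.exp 1) :
    y * Real.log y ^ (-b) ≤ 3 * 2 ^ b * (x * Real.log x ^ (-b)) := by
  have hlow : 0 < x * Real.exp (-1) := by positivity
  have h1 : Real.log x / 2 ≤ Real.log y := by
    have := Real.log_le_log hlow hlo
    rw [Real.log_mul hx.ne' (Real.exp_pos _).ne', Real.log_exp] at this
    linarith
  have h2 : Real.log y ^ (-b) ≤ (Real.log x / 2) ^ (-b) :=
    Real.rpow_le_rpow_of_nonpos (by linarith) h1 (by linarith)
  have h3 : (Real.log x / 2) ^ (-b) = 2 ^ b * Real.log x ^ (-b) := by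
    rw [Real.div_rpow (by linarith) (by norm_num), Real.rpow_neg (by norm_num : (0 : ℝ) ≤ 2),
      div_inv_eq_mul, mul_comm]
  rw [h3] at h2
  have h4 : y ≤ 3 * x := by nlinarith [Real.exp_one_lt_d9]
  have h5 : 0 < Real.log x := by linarith
  calc y * Real.log y ^ (-b) ≤ (3 * x) * (2 ^ b * Real.log x ^ (-b)) :=
        mul_le_mul h4 h2 (Real.rpow_nonneg (by linarith) _) (by positivity)
    _ = _ := by ring

lemma exists_totalDev_le {θ A : ℝ} (hθ0 : 0 < θ) (hθ : θ < 1 / 2) (hA : 0 < A) :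
    ∃ C L : ℝ, 0 < C ∧ 2 ≤ L ∧ ∀ x : ℝ, 0 < x → L ≤ Real.log x →
      totalDev x ⌊x ^ θ⌋₊ ≤ C * (x * Real.log x ^ (-A)) := by
  obtain ⟨τ, hτ, hτ2⟩ := exists_between hθ
  have hb : 0 < 2 * A + 2 := by linarith
  obtain ⟨C, hC, hCx⟩ := sum_apDev_le_log_rpow hτ2 hb
  refine ⟨6 + 9 * C * 2 ^ (2 * A + 2), max 2 (τ / (τ - θ)), by positivity, le_max_left _ _,
    fun x hx hL => ?_⟩
  have hl2 : 2 ≤ Real.log x := (le_max_left _ _).trans hL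
  have hlτ : τ / (τ - θ) ≤ Real.log x := (le_max_right _ _).trans hL
  have hl0 : 0 < Real.log x := by linarith
  have hx1 : 1 < x := (Real.log_pos_iff hx.le).mp hl0
  set Q := ⌊x ^ θ⌋₊ with hQdef
  have hQx : (Q : ℝ) ≤ x ^ θ := Nat.floor_le (by positivity)
  have hQ : 1 ≤ Q := Nat.le_floor (by
    rw [Nat.cast_one]
    exact Real.one_le_rpow hx1.le hθ0.le)
  have hQ1 : (1 : ℝ) ≤ Q := by exact_mod_cast hQ
  set h := Real.log x ^ (-(A + 2)) with hhdef
  have hh : 0 < h := by positivity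
  have hh1 : h ≤ 1 := Real.rpow_le_one_of_one_le_of_nonpos (by linarith) (by linarith)
  have hyb : ∀ y, x * Real.exp (-1) ≤ y → y ≤ x * Real.exp 1 →
      ∑ q ∈ Finset.Icc 1 Q, apDev y q ≤
        C * (3 * 2 ^ (2 * A + 2) * (x * Real.log x ^ (-(2 * A + 2)))) := by
    intro y hlo hhi
    have hlow : 0 < x * Real.exp (-1) := by positivity
    have hly : Real.log x - 1 ≤ Real.log y := by
      have := Real.log_le_log hlow hlo
      rw [Real.log_mul hx.ne' (Real.exp_pos _).ne', Real.log_exp] at this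
      linarith
    have hy0 : 0 < y := hlow.trans_le hlo
    have hy1 : 1 < y := (Real.log_pos_iff hy0.le).mp (by linarith)
    have hQy : (Q : ℝ) ≤ y ^ τ := by
      refine hQx.trans ?_
      rw [Real.rpow_def_of_pos hx, Real.rpow_def_of_pos hy0, Real.exp_le_exp]
      rw [div_le_iff₀ (by linarith)] at hlτ
      nlinarith
    calc _ ≤ C * y * Real.log y ^ (-(2 * A + 2)) := hCx y Q (by linarith) hy1.le hQy
      _ = C * (y * Real.log y ^ (-(2 * A + 2))) := mul_assoc _ _ _
      _ ≤ _ := mul_le_mul_of_nonneg_left (mul_log_rpow_neg_le hb hx hl2 hlo hhi) hC.le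
  have hmono : ∀ s t : ℝ, s ≤ t → x * Real.exp s ≤ x * Real.exp t := fun s t hst =>
    mul_le_mul_of_nonneg_left (Real.exp_le_exp.mpr hst) hx.le
  have s1 := hyb (x * Real.exp h) (hmono _ _ (by linarith)) (hmono _ _ hh1)
  have s2 := hyb x (by simpa using hmono (-1) 0 (by norm_num))
    (by simpa using hmono 0 1 (by norm_num))
  have s3 := hyb (x * Real.exp (-h)) (hmono _ _ (by linarith)) (hmono _ _ (by linarith))
  have hQh : (Q : ℝ) ≤ x * Real.exp (-h) := by
    refine le_trans ?_ (hmono (-1) (-h) (by linarith))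
    refine hQx.trans ?_
    rw [Real.rpow_def_of_pos hx]
    nth_rewrite 2 [← Real.exp_log hx]
    rw [← Real.exp_add, Real.exp_le_exp]
    nlinarith
  refine (totalDev_le hQ hh hh1 hQh).trans ?_
  have hlogQ : Real.log Q ≤ Real.log x := by
    refine Real.log_le_log (by linarith) (hQx.trans ?_)
    calc x ^ θ ≤ x ^ (1 : ℝ) := Real.rpow_le_rpow_of_exponent_le hx1.le (by linarith)
      _ = x := Real.rpow_one x
  have hlogQ0 := Real.log_nonneg hQ1
  have t1 : (2 * Real.log Q + 1) * (1 + Real.log Q) ≤ 6 * Real.log x ^ (2 : ℝ) := by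
    rw [Real.rpow_two]
    nlinarith
  have t2 : h * x * ((2 * Real.log Q + 1) * (1 + Real.log Q)) ≤ 6 * (x * Real.log x ^ (-A)) := by
    calc _ ≤ h * x * (6 * Real.log x ^ (2 : ℝ)) := mul_le_mul_of_nonneg_left t1 (by positivity)
      _ = 6 * (x * (Real.log x ^ (-(A + 2)) * Real.log x ^ (2 : ℝ))) := by rw [hhdef]; ring
      _ = _ := by rw [← Real.rpow_add hl0]; ring_nf
  have t3 : 1 / h * (x * Real.log x ^ (-(2 * A + 2))) = x * Real.log x ^ (-A) := by
    rw [hhdef, Real.rpow_neg hl0.le (A + 2), one_div, inv_inv, mul_left_comm, ← Real.rpow_add hl0]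
    ring_nf
  have t4 := mul_le_mul_of_nonneg_left (add_le_add (add_le_add s1 s2) s3)
    (by positivity : 0 ≤ 1 / h)
  calc _ ≤ 6 * (x * Real.log x ^ (-A)) + 1 / h * _ := add_le_add t2 t4
    _ = 6 * (x * Real.log x ^ (-A)) + 9 * C * 2 ^ (2 * A + 2) *
        (1 / h * (x * Real.log x ^ (-(2 * A + 2)))) := by ring
    _ = _ := by rw [t3]; ring

end Desmoothing

end BombieriVinogradov

/-- Bombieri–Vinogradov theorem: for every `0 < θ < 1/2` and every `A > 0` there is a constant
`C` such that for all `x ≥ 2`,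
`∑_{q ≤ x^θ} sup_{(a,q)=1} |∑_{n ≤ x, n ≡ a [MOD q]} Λ(n) − x/φ(q)| ≤ C · x · (log x)^(−A)`;
that is, the primes have level of distribution `θ` for every `θ < 1/2`. -/
theorem bombieri_vinogradov (θ : ℝ) (hθ0 : 0 < θ) (hθ : θ < 1 / 2) :
    ∀ A : ℝ, 0 < A → ∃ C : ℝ, ∀ x : ℝ, 2 ≤ x →
      ∑ q ∈ Finset.Icc 1 ⌊x ^ θ⌋₊,
        ⨆ a : {a : ℕ // a.Coprime q},
          |(∑ n ∈ Finset.Icc 1 ⌊x⌋₊,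
              if n % q = (a : ℕ) % q then Λ n else 0) - x / (Nat.totient q)|
      ≤ C * x * Real.log x ^ (-A) := by
  intro A hA
  obtain ⟨C, L, hC, hL, hCL⟩ := BombieriVinogradov.exists_totalDev_le hθ0 hθ hA
  set y := Real.exp L
  have hy : 1 ≤ y := Real.one_le_exp (by linarith)
  have hlogy : Real.log y = L := Real.log_exp L
  set K := y * (y * Real.log y + y)
  have hK : 0 ≤ K := by
    have : 0 ≤ Real.log y := Real.log_nonneg hy
    positivity
  refine ⟨C + K * L ^ A, fun x hx => ?_⟩
  change BombieriVinogradov.totalDev x ⌊x ^ θ⌋₊ ≤ _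
  have hlx : 0 < Real.log x := Real.log_pos (by linarith)
  have hL0 : 0 < L := by linarith
  have hpos : 0 ≤ x * Real.log x ^ (-A) := by positivity
  rw [mul_assoc, add_mul]
  have hKpos : 0 ≤ K * L ^ A := by positivity
  rcases le_total L (Real.log x) with hxL | hxL
  · exact (hCL x (by linarith) hxL).trans (le_add_of_nonneg_right (by positivity))
  · have hxy : x ≤ y := (Real.log_le_iff_le_exp (by linarith)).mp hxL
    refine (BombieriVinogradov.totalDev_le_of_le hθ (by linarith) hxy).trans ?_
    refine le_add_of_nonneg_of_le (by positivity) ?_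
    have h1 : L ^ (-A) ≤ Real.log x ^ (-A) := Real.rpow_le_rpow_of_nonpos hlx hxL (by linarith)
    calc K = K * L ^ A * (1 * L ^ (-A)) := by
          rw [one_mul, mul_assoc, ← Real.rpow_add hL0, add_neg_cancel, Real.rpow_zero, mul_one]
      _ ≤ K * L ^ A * (x * Real.log x ^ (-A)) :=
          mul_le_mul_of_nonneg_left
            (mul_le_mul (by linarith) h1 (by positivity) (by linarith)) hKpos
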